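/- Let A be a dg algebra over F₂ that is homologically smooth and proper, and let M be a dg (A,A)-bimodule that is bounded (supported in finitely many gradings) and π-formal. Then there is a spectral sequence ^{vh}E^r_{p,q} with: (1) ^{vh}E¹_{p,q} = HH_q(A, M ⊗̃_A M) for all p and q, where ⊗̃_A denotes the derived tensor product over A; and (2) there is an increasing filtration ^hF_i of V ≅ ⊕_j HH_j(A,M) such that ^{vh}E^∞_{p,q} = ^hF_{−q}V / ^hF_{−q−1}V. In particular, Σ_q dim_{F₂} HH_q(A, M ⊗̃_A M) ≥ Σ_q dim_{F₂} HH_q(A,M). -/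

import Mathlib

noncomputable section
open TensorProduct

namespace LT

/-- A differential graded (dg) algebra over a commutative ring `k`: a chain complex with a
degree `-1` differential together with an associative unital multiplication satisfying the
(signed) Leibniz rule; over `𝔽₂` the signs are invisible. The grading is given by an internal
direct sum decomposition into submodules. -/
structure DGA (k : Type) [CommRing k] : Type 1 where
  V : Type
  [acg : AddCommGroup V]
  [mod : Module k V]
  gr : ℤ → Submodule k V
  internal : DirectSum.IsInternal gr
  d : V →ₗ[k] V
  d_d : ∀ x, d (d x) = 0
  d_gr : ∀ i, ∀ x ∈ gr i, d x ∈ gr (i - 1)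
  mul : V →ₗ[k] V →ₗ[k] V
  mul_assoc' : ∀ x y z, mul (mul x y) z = mul x (mul y z)
  one : V
  one_gr : one ∈ gr 0
  one_mul' : ∀ x, mul one x = x
  mul_one' : ∀ x, mul x one = x
  mul_gr : ∀ i j, ∀ x ∈ gr i, ∀ y ∈ gr j, mul x y ∈ gr (i + j)
  leibniz : ∀ i, ∀ x ∈ gr i, ∀ y, d (mul x y) = mul (d x) y + (Int.negOnePow i : ℤ) • mul x (d y)

attribute [instance] DGA.acg
attribute [instance 2000] DGA.mod

variable {k : Type} [CommRing k]

/-- A dg `(A,A)`-bimodule over a dg algebra `A`. -/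
structure DGBimod (A : DGA k) : Type 1 where
  V : Type
  [acg : AddCommGroup V]
  [mod : Module k V]
  gr : ℤ → Submodule k V
  internal : DirectSum.IsInternal gr
  d : V →ₗ[k] V
  d_d : ∀ x, d (d x) = 0
  d_gr : ∀ i, ∀ x ∈ gr i, d x ∈ gr (i - 1)
  actL : A.V →ₗ[k] V →ₗ[k] V
  actR : V →ₗ[k] A.V →ₗ[k] V
  actL_one : ∀ m, actL A.one m = m
  actR_one : ∀ m, actR m A.one = m
  actL_mul : ∀ a b m, actL (A.mul a b) m = actL a (actL b m)
  actR_mul : ∀ m a b, actR (actR m a) b = actR m (A.mul a b)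
  actLR : ∀ a m b, actR (actL a m) b = actL a (actR m b)
  actL_gr : ∀ i j, ∀ a ∈ A.gr i, ∀ m ∈ gr j, actL a m ∈ gr (i + j)
  actR_gr : ∀ i j, ∀ m ∈ gr i, ∀ a ∈ A.gr j, actR m a ∈ gr (i + j)
  leibnizL : ∀ i, ∀ a ∈ A.gr i, ∀ m, d (actL a m) = actL (A.d a) m + (Int.negOnePow i : ℤ) • actL a (d m)
  leibnizR : ∀ j, ∀ m ∈ gr j, ∀ a, d (actR m a) = actR (d m) a + (Int.negOnePow j : ℤ) • actR m (A.d a)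

attribute [instance] DGBimod.acg
attribute [instance 2000] DGBimod.mod

/-- The diagonal bimodule: `A` viewed as a bimodule over itself. -/
def DGA.diag (A : DGA k) : DGBimod A where
  V := A.V
  gr := A.gr
  internal := A.internal
  d := A.d
  d_d := A.d_d
  d_gr := A.d_gr
  actL := A.mul
  actR := A.mul
  actL_one := A.one_mul'
  actR_one := A.mul_one'
  actL_mul := fun a b m => A.mul_assoc' a b m
  actR_mul := fun m a b => A.mul_assoc' m a b
  actLR := fun a m b => A.mul_assoc' a m b
  actL_gr := A.mul_gr
  actR_gr := A.mul_gr
  leibnizL := A.leibniz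
  leibnizR := A.leibniz

variable {A : DGA k}

/-- A homomorphism of dg bimodules of degree `s`: a linear map raising degree by `s`,
commuting with the differentials and the two actions. -/
def IsBHom (M N : DGBimod A) (s : ℤ) (f : M.V →ₗ[k] N.V) : Prop :=
  (∀ i, ∀ x ∈ M.gr i, f x ∈ N.gr (i + s)) ∧
  (∀ x, f (M.d x) = N.d (f x)) ∧
  (∀ a m, f (M.actL a m) = N.actL a (f m)) ∧
  (∀ m a, f (M.actR m a) = N.actR (f m) a)

/-- Graded maps of degree `s` compatible with the bimodule actions (no compatibility with the
differential required); these are used as homotopies. -/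
def grHomSub (M N : DGBimod A) (s : ℤ) : Submodule k (M.V →ₗ[k] N.V) where
  carrier := {f | (∀ i, ∀ x ∈ M.gr i, f x ∈ N.gr (i + s)) ∧
    (∀ a m, f (M.actL a m) = N.actL a (f m)) ∧
    (∀ m a, f (M.actR m a) = N.actR (f m) a)}
  add_mem' := by
    rintro f g ⟨hf1, hf2, hf3⟩ ⟨hg1, hg2, hg3⟩
    refine ⟨fun i x hx => ?_, fun a m => ?_, fun m a => ?_⟩ <;>
      simp [LinearMap.add_apply, hf2, hg2, hf3, hg3]
    exact Submodule.add_mem _ (hf1 i x hx) (hg1 i x hx)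
  zero_mem' := by
    refine ⟨fun i x hx => ?_, fun a m => ?_, fun m a => ?_⟩ <;> simp
  smul_mem' := by
    rintro c f ⟨hf1, hf2, hf3⟩
    refine ⟨fun i x hx => ?_, fun a m => ?_, fun m a => ?_⟩ <;>
      simp [LinearMap.smul_apply, hf2, hf3]
    exact Submodule.smul_mem _ _ (hf1 i x hx)

/-- Bimodule chain maps of degree `s`, as a submodule of all linear maps. -/
def bcmSub (M N : DGBimod A) (s : ℤ) : Submodule k (M.V →ₗ[k] N.V) where
  carrier := {f | IsBHom M N s f}
  add_mem' := by
    rintro f g ⟨hf1, hf0, hf2, hf3⟩ ⟨hg1, hg0, hg2, hg3⟩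
    refine ⟨fun i x hx => ?_, fun x => ?_, fun a m => ?_, fun m a => ?_⟩ <;>
      simp [LinearMap.add_apply, hf0, hg0, hf2, hg2, hf3, hg3]
    exact Submodule.add_mem _ (hf1 i x hx) (hg1 i x hx)
  zero_mem' := by
    refine ⟨fun i x hx => ?_, fun x => ?_, fun a m => ?_, fun m a => ?_⟩ <;> simp
  smul_mem' := by
    rintro c f ⟨hf1, hf0, hf2, hf3⟩
    refine ⟨fun i x hx => ?_, fun x => ?_, fun a m => ?_, fun m a => ?_⟩ <;>
      simp [LinearMap.smul_apply, hf0, hf2, hf3]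
    exact Submodule.smul_mem _ _ (hf1 i x hx)

/-- The nullhomotopic degree-`s` maps `d ∘ h + h ∘ d` for `h` a degree `s+1` bimodule map. -/
def nullHtpSub (M N : DGBimod A) (s : ℤ) : Submodule k (M.V →ₗ[k] N.V) :=
  Submodule.map
    ((LinearMap.llcomp k M.V N.V N.V N.d) + (LinearMap.lcomp k N.V M.d))
    (grHomSub M N (s + 1))

/-- Homotopy classes of degree-`s` bimodule chain maps `M → N`; for `M` a cell retract this
computes morphisms `Σ^s M → N` in the derived category of dg bimodules. -/
def HtpyHom (M N : DGBimod A) (s : ℤ) :=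
  bcmSub M N s ⧸ Submodule.comap (bcmSub M N s).subtype (nullHtpSub M N s)

instance (M N : DGBimod A) (s : ℤ) : AddCommGroup (HtpyHom M N s) :=
  inferInstanceAs (AddCommGroup (_ ⧸ _))
instance (M N : DGBimod A) (s : ℤ) : Module k (HtpyHom M N s) :=
  inferInstanceAs (Module k (_ ⧸ _))


/-- Homology in degree `n` of a graded module with "relations": the degree-`n` part of the
homology of the quotient complex `(T/N, d)` where the grading of `T/N` is induced by `gr`.
Taking `N = ⊥` gives ordinary graded homology. -/
def Hgr (T : Type) [AddCommGroup T] [Module k T] (gr : ℤ → Submodule k T)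
    (N : Submodule k T) (d : T →ₗ[k] T) (n : ℤ) : Type :=
  ↥((gr n ⊔ N) ⊓ Submodule.comap d N) ⧸
    Submodule.comap ((gr n ⊔ N) ⊓ Submodule.comap d N).subtype
      (Submodule.map d (gr (n + 1) ⊔ N) ⊔ N)

instance (T : Type) [AddCommGroup T] [Module k T] (gr : ℤ → Submodule k T)
    (N : Submodule k T) (d : T →ₗ[k] T) (n : ℤ) : AddCommGroup (Hgr T gr N d n) :=
  inferInstanceAs (AddCommGroup (_ ⧸ _))
instance (T : Type) [AddCommGroup T] [Module k T] (gr : ℤ → Submodule k T)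
    (N : Submodule k T) (d : T →ₗ[k] T) (n : ℤ) : Module k (Hgr T gr N d n) :=
  inferInstanceAs (Module k (_ ⧸ _))

/-- `f` induces an isomorphism on (graded) homology, with a degree shift `s`; stated
elementarily: the induced map on homology classes is surjective and injective. -/
def IsQIsoDeg (T S : Type) [AddCommGroup T] [Module k T] [AddCommGroup S] [Module k S]
    (grT : ℤ → Submodule k T) (grS : ℤ → Submodule k S)
    (dT : T →ₗ[k] T) (dS : S →ₗ[k] S) (s : ℤ) (f : T →ₗ[k] S) : Prop :=
  ∀ n : ℤ,
    (∀ y ∈ grS (n + s), dS y = 0 →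
      ∃ x ∈ grT n, dT x = 0 ∧ f x - y ∈ Submodule.map dS (grS (n + s + 1))) ∧
    (∀ x ∈ grT n, dT x = 0 → f x ∈ Submodule.map dS (grS (n + s + 1)) →
      x ∈ Submodule.map dT (grT (n + 1)))

variable {A : DGA k}

/-- The bilinear "sandwich" map `(a, b) ↦ a · m · b` for a fixed element `m` of a bimodule. -/
def sandwich (M : DGBimod A) (m : M.V) : A.V →ₗ[k] A.V →ₗ[k] M.V :=
  LinearMap.mk₂ k (fun a b => M.actR (M.actL a m) b)
    (fun a₁ a₂ b => by simp)
    (fun c a b => by simp)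
    (fun a b₁ b₂ => by simp)
    (fun c a b => by simp)

/-- The bimodule map `A ⊗ A → M`, `a ⊗ b ↦ a · m · b`. -/
def sandwichT (M : DGBimod A) (m : M.V) : (A.V ⊗[k] A.V) →ₗ[k] M.V :=
  TensorProduct.lift (sandwich M m)

/-- `S'/S` is a free dg bimodule: there is a family of "generators" `g i` of degrees `deg i`,
closed cycles modulo `S`, which generate `S'` freely over `A ⊗ A` modulo `S`. -/
def IsFreeStep (M : DGBimod A) (S S' : Submodule k M.V) : Prop :=
  ∃ (I : Type) (g : I → M.V) (deg : I → ℤ),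
    (∀ i, g i ∈ S') ∧ (∀ i, M.d (g i) ∈ S) ∧
    (∀ i p q, ∀ a ∈ A.gr p, ∀ b ∈ A.gr q, M.actR (M.actL a (g i)) b ∈ M.gr (p + q + deg i)) ∧
    S' ≤ S ⊔ (⨆ i, LinearMap.range (sandwichT M (g i))) ∧
    (∀ (u : Finset I) (c : I → A.V ⊗[k] A.V),
      (∑ i ∈ u, sandwichT M (g i) (c i)) ∈ S → ∀ i ∈ u, c i = 0)

/-- As `IsFreeStep`, with a finite generating family. -/
def IsFreeStepFin (M : DGBimod A) (S S' : Submodule k M.V) : Prop :=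
  ∃ (I : Type) (_ : Finite I) (g : I → M.V) (deg : I → ℤ),
    (∀ i, g i ∈ S') ∧ (∀ i, M.d (g i) ∈ S) ∧
    (∀ i p q, ∀ a ∈ A.gr p, ∀ b ∈ A.gr q, M.actR (M.actL a (g i)) b ∈ M.gr (p + q + deg i)) ∧
    S' ≤ S ⊔ (⨆ i, LinearMap.range (sandwichT M (g i))) ∧
    (∀ (u : Finset I) (c : I → A.V ⊗[k] A.V),
      (∑ i ∈ u, sandwichT M (g i) (c i)) ∈ S → ∀ i ∈ u, c i = 0)

/-- A filtration exhibiting `M` as a cell bimodule. -/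
def IsCellFiltration (M : DGBimod A) (Fil : ℕ → Submodule k M.V) : Prop :=
  Fil 0 = ⊥ ∧ Monotone Fil ∧ (⨆ n, Fil n) = ⊤ ∧
  (∀ n, ∀ x ∈ Fil n, M.d x ∈ Fil n) ∧
  (∀ n a, ∀ x ∈ Fil n, M.actL a x ∈ Fil n) ∧
  (∀ n a, ∀ x ∈ Fil n, M.actR x a ∈ Fil n) ∧
  (∀ n, IsFreeStep M (Fil n) (Fil (n + 1)))

/-- A cell bimodule: admits a filtration with free subquotients. -/
def IsCellBimod (M : DGBimod A) : Prop := ∃ Fil, IsCellFiltration M Fil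

/-- A finite cell bimodule: a finite filtration with finite-rank free subquotients. -/
def IsFiniteCellBimod (M : DGBimod A) : Prop :=
  ∃ Fil, (Fil 0 = ⊥ ∧ Monotone Fil ∧ (⨆ n, Fil n) = ⊤ ∧
    (∀ n, ∀ x ∈ Fil n, M.d x ∈ Fil n) ∧
    (∀ n a, ∀ x ∈ Fil n, M.actL a x ∈ Fil n) ∧
    (∀ n a, ∀ x ∈ Fil n, M.actR x a ∈ Fil n) ∧
    (∀ n, IsFreeStepFin M (Fil n) (Fil (n + 1)))) ∧ (∃ n₀, Fil n₀ = ⊤)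

/-- A (finite) cell retract: a subcomplex of a (finite) cell bimodule whose inclusion admits
a bimodule retraction. -/
def IsCellRetract (P : DGBimod A) : Prop :=
  ∃ (C : DGBimod A), IsCellBimod C ∧
    ∃ (ι : P.V →ₗ[k] C.V) (r : C.V →ₗ[k] P.V),
      IsBHom P C 0 ι ∧ IsBHom C P 0 r ∧ Function.Injective ι ∧ r.comp ι = LinearMap.id

def IsFiniteCellRetract (P : DGBimod A) : Prop :=
  ∃ (C : DGBimod A), IsFiniteCellBimod C ∧
    ∃ (ι : P.V →ₗ[k] C.V) (r : C.V →ₗ[k] P.V),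
      IsBHom P C 0 ι ∧ IsBHom C P 0 r ∧ Function.Injective ι ∧ r.comp ι = LinearMap.id

/-- `ρ : R → M` is a resolution: a quasi-isomorphism of dg bimodules from a cell retract. -/
def IsResolution (R M : DGBimod A) (ρ : R.V →ₗ[k] M.V) : Prop :=
  IsCellRetract R ∧ IsBHom R M 0 ρ ∧ IsQIsoDeg R.V M.V R.gr M.gr R.d M.d 0 ρ

/-- A bimodule is perfect if it admits a resolution by a finite cell retract. -/
def IsPerfect (M : DGBimod A) : Prop :=
  ∃ (R : DGBimod A) (ρ : R.V →ₗ[k] M.V),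
    IsFiniteCellRetract R ∧ IsBHom R M 0 ρ ∧ IsQIsoDeg R.V M.V R.gr M.gr R.d M.d 0 ρ

/-- `A` is homologically smooth: perfect as a bimodule over itself. -/
def HomSmooth (A : DGA k) : Prop := IsPerfect A.diag

/-- The homology of the dg algebra `A` in degree `n`. -/
abbrev AlgH (A : DGA k) (n : ℤ) := Hgr A.V A.gr ⊥ A.d n

/-- `A` is homologically proper: its total homology is finitely generated. -/
def HomProper (A : DGA k) : Prop :=
  (∀ n, Module.Finite k (AlgH A n)) ∧ (Set.Finite {n : ℤ | Nontrivial (AlgH A n)})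

/-- A dg bimodule is bounded if it is supported in finitely many gradings. -/
def BoundedBimod (M : DGBimod A) : Prop := ∃ u : Finset ℤ, ∀ i ∉ u, M.gr i = ⊥

/-! ### Bicomplexes and the spectral sequences of their two filtrations -/

/-- A bicomplex of `k`-modules "with relations", presented as one ambient module with a
bigrading by submodules, a horizontal differential `dh` (of bidegree `(-1,0)`), a vertical
differential `dv` (of bidegree `(0,-1)`) and a submodule `N` of relations (so that the actual
bicomplex is the quotient by `N`; take `N = ⊥` for an honest bicomplex). -/
structure RelBicx (k : Type) [CommRing k] : Type 1 where
  T : Type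
  [acg : AddCommGroup T]
  [mod : Module k T]
  gr : ℤ → ℤ → Submodule k T
  N : Submodule k T
  dh : T →ₗ[k] T
  dv : T →ₗ[k] T

attribute [instance] RelBicx.acg RelBicx.mod

namespace RelBicx

variable {k : Type} [CommRing k] (B : RelBicx k)

/-- The total differential. -/
def D : B.T →ₗ[k] B.T := B.dh + B.dv

/-- The column filtration (by the first index `p`) of the total complex, in total degree `n`. -/
def Fcol (p n : ℤ) : Submodule k B.T := ⨆ (i : ℤ) (_ : i ≤ p), B.gr i (n - i)

/-- The row filtration (by the second index `q`) of the total complex, in total degree `n`. -/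
def Frow (q n : ℤ) : Submodule k B.T := ⨆ (j : ℤ) (_ : j ≤ q), B.gr (n - j) j

/-- Approximate cycles for the spectral sequence of the filtration `F`:
elements of filtration `p` (mod `N`) whose total differential drops filtration by `r`. -/
def Zpage (F : ℤ → ℤ → Submodule k B.T) (r p n : ℤ) : Submodule k B.T :=
  (F p n ⊔ B.N) ⊓ Submodule.comap B.D (F (p - r) (n - 1) ⊔ B.N)

/-- The boundaries subobject for the `r`-th page at filtration `p`, total degree `n`. -/
def Bpage (F : ℤ → ℤ → Submodule k B.T) (r p n : ℤ) : Submodule k B.T :=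
  Submodule.map B.D (B.Zpage F (r - 1) (p + r - 1) (n + 1)) ⊔ B.Zpage F (r - 1) (p - 1) n ⊔ B.N

/-- The `r`-th page of the spectral sequence of the filtration `F`, at filtration degree `p`
and total degree `n` (the classical subquotient description `Z^r/B^r`). -/
def Epage (F : ℤ → ℤ → Submodule k B.T) (r p n : ℤ) : Type :=
  ↥(B.Zpage F r p n) ⧸
    Submodule.comap (B.Zpage F r p n).subtype (B.Bpage F r p n)

instance (F : ℤ → ℤ → Submodule k B.T) (r p n : ℤ) : AddCommGroup (B.Epage F r p n) :=
  inferInstanceAs (AddCommGroup (_ ⧸ _))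
instance (F : ℤ → ℤ → Submodule k B.T) (r p n : ℤ) : Module k (B.Epage F r p n) :=
  inferInstanceAs (Module k (_ ⧸ _))

/-- The spectral sequence `ᵛʰE` (filtration by columns; one first takes homology with respect
to the vertical differential). Indexing: `vhE r p q` is `ᵛʰE^r_{p,q}`. -/
def vhE (r p q : ℤ) : Type := B.Epage B.Fcol r p (p + q)

/-- The spectral sequence `ʰᵛE` (filtration by rows; one first takes homology with respect to
the horizontal differential), in the transposed indexing of Lipshitz–Treumann:
`hvE r p q` is `ʰᵛE^r_{p,q}`, whose filtration index is the row `q`. -/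
def hvE (r p q : ℤ) : Type := B.Epage B.Frow r q (p + q)

instance (r p q : ℤ) : AddCommGroup (B.vhE r p q) := inferInstanceAs (AddCommGroup (Epage _ _ _ _ _))
instance (r p q : ℤ) : Module k (B.vhE r p q) := inferInstanceAs (Module k (Epage _ _ _ _ _))
instance (r p q : ℤ) : AddCommGroup (B.hvE r p q) := inferInstanceAs (AddCommGroup (Epage _ _ _ _ _))
instance (r p q : ℤ) : Module k (B.hvE r p q) := inferInstanceAs (Module k (Epage _ _ _ _ _))

/-- Vanishing of the differential leaving the `r`-th page at position `(p, n)`: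
the total differential of any approximate cycle is, up to boundaries of earlier pages and
relations, an approximate cycle of deeper filtration. -/
def zeroDiff (F : ℤ → ℤ → Submodule k B.T) (r p n : ℤ) : Prop :=
  Submodule.map B.D (B.Zpage F r p n) ≤
    Submodule.map B.D (B.Zpage F (r - 1) (p - 1) n) ⊔ B.Zpage F (r - 1) (p - r - 1) (n - 1) ⊔ B.N

/-- The spectral sequence of the filtration `F` collapses at the `r₀`-th page. -/
def collapsesAt (F : ℤ → ℤ → Submodule k B.T) (r₀ : ℤ) : Prop :=
  ∀ r : ℤ, r₀ ≤ r → ∀ p n : ℤ, B.zeroDiff F r p n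

/-- The part of total degree `n` of the bicomplex. -/
def totGr (n : ℤ) : Submodule k B.T := ⨆ p : ℤ, B.gr p (n - p)

/-- The degree-`n` homology of the total complex (of the quotient by `N`). -/
def Htot (n : ℤ) : Type :=
  ↥((B.totGr n ⊔ B.N) ⊓ Submodule.comap B.D B.N) ⧸
    Submodule.comap ((B.totGr n ⊔ B.N) ⊓ Submodule.comap B.D B.N).subtype
      (Submodule.map B.D (B.totGr (n + 1) ⊔ B.N) ⊔ B.N)

instance (n : ℤ) : AddCommGroup (B.Htot n) := inferInstanceAs (AddCommGroup (_ ⧸ _))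
instance (n : ℤ) : Module k (B.Htot n) := inferInstanceAs (Module k (_ ⧸ _))

/-- The graded piece `F_p H_n / F_{p-1} H_n` of the filtration induced by `F` on the homology
of the total complex. -/
def grHtot (F : ℤ → ℤ → Submodule k B.T) (p n : ℤ) : Type :=
  ↥((F p n ⊔ B.N) ⊓ Submodule.comap B.D B.N) ⧸
    Submodule.comap ((F p n ⊔ B.N) ⊓ Submodule.comap B.D B.N).subtype
      (((F (p - 1) n ⊔ B.N) ⊓ Submodule.comap B.D B.N) ⊔
        Submodule.map B.D (B.totGr (n + 1) ⊔ B.N) ⊔ B.N)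

instance (F : ℤ → ℤ → Submodule k B.T) (p n : ℤ) : AddCommGroup (B.grHtot F p n) :=
  inferInstanceAs (AddCommGroup (_ ⧸ _))
instance (F : ℤ → ℤ → Submodule k B.T) (p n : ℤ) : Module k (B.grHtot F p n) :=
  inferInstanceAs (Module k (_ ⧸ _))

/-- The spectral sequence of the filtration `F` converges to the homology of the total
complex: for every position the pages eventually stabilize and agree with the associated
graded of the induced filtration on the homology of the total complex. -/
def convergesTo (F : ℤ → ℤ → Submodule k B.T) : Prop :=
  ∀ p n : ℤ, ∃ r₀ : ℤ, ∀ r : ℤ, r₀ ≤ r →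
    Nonempty (B.Epage F r p n ≃ₗ[k] B.grHtot F p n)

end RelBicx
/-! ### Hochschild chains, the involution `τ`, and the Hochschild–Tate bicomplex (over `𝔽₂`) -/

section Hochschild

variable {A : DGA (ZMod 2)} (R M : DGBimod A)

/-- The ambient space `R ⊗ M` of the Hochschild chain complex `HC(A, M)` (with respect to the
resolution `R` of the diagonal bimodule): `HC(A,M) = (R ⊗ M)/rel2`. -/
abbrev T2 := R.V ⊗[ZMod 2] M.V

/-- The differential `∂(r ⊗ m) = ∂r ⊗ m + r ⊗ ∂m` (char. 2). -/
def d2 : T2 R M →ₗ[ZMod 2] T2 R M :=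
  TensorProduct.map R.d LinearMap.id + TensorProduct.map LinearMap.id M.d

/-- The grading of `R ⊗ M`. -/
def gr2 (n : ℤ) : Submodule (ZMod 2) (T2 R M) :=
  Submodule.span (ZMod 2)
    {z | ∃ i j, ∃ r ∈ R.gr i, ∃ m ∈ M.gr j, i + j = n ∧ z = r ⊗ₜ[ZMod 2] m}

/-- The Hochschild relations `ra ⊗ m ∼ r ⊗ am` and `ar ⊗ m ∼ r ⊗ ma` (char. 2). -/
def rel2 : Submodule (ZMod 2) (T2 R M) :=
  Submodule.span (ZMod 2)
    ({z | ∃ r a m, z = (R.actR r a) ⊗ₜ[ZMod 2] m + r ⊗ₜ[ZMod 2] (M.actL a m)} ∪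
     {z | ∃ r a m, z = (R.actL a r) ⊗ₜ[ZMod 2] m + r ⊗ₜ[ZMod 2] (M.actR m a)})

/-- The underlying space of the Hochschild chain complex `HC(A, M)`. -/
abbrev HCQ := T2 R M ⧸ rel2 R M

/-- The Hochschild homology `HH_n(A, M)` (computed from the chosen resolution `R → A`). -/
abbrev HH (n : ℤ) := Hgr (T2 R M) (gr2 R M) (rel2 R M) (d2 R M) n

/-- The ambient space `R ⊗ (M ⊗ (R ⊗ M))` of the Hochschild chain complex of the derived
tensor product: `HC(A, M ⊗̃_A M) = (R ⊗ (M ⊠ R ⊠ M))/∼ = (R ⊗ M ⊗ R ⊗ M)/rel4`. -/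
abbrev T4 := R.V ⊗[ZMod 2] (M.V ⊗[ZMod 2] (R.V ⊗[ZMod 2] M.V))

/-- The differential of `R ⊗ M ⊗ R ⊗ M` (char. 2; no signs). -/
def d4 : T4 R M →ₗ[ZMod 2] T4 R M :=
  TensorProduct.map R.d LinearMap.id +
  TensorProduct.map LinearMap.id (TensorProduct.map M.d LinearMap.id +
    TensorProduct.map LinearMap.id (TensorProduct.map R.d LinearMap.id +
      TensorProduct.map LinearMap.id M.d))

/-- The grading of `R ⊗ M ⊗ R ⊗ M`. -/
def gr4 (n : ℤ) : Submodule (ZMod 2) (T4 R M) :=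
  Submodule.span (ZMod 2)
    {z | ∃ i₁ j₁ i₂ j₂, ∃ r ∈ R.gr i₁, ∃ m ∈ M.gr j₁, ∃ r' ∈ R.gr i₂, ∃ m' ∈ M.gr j₂,
      i₁ + j₁ + i₂ + j₂ = n ∧ z = r ⊗ₜ[ZMod 2] (m ⊗ₜ[ZMod 2] (r' ⊗ₜ[ZMod 2] m'))}

/-- The combined relations presenting `HC(A, M ⊗̃_A M)` as a quotient of `R ⊗ M ⊗ R ⊗ M`:
the two relations of the naive tensor products `M ⊠_A R ⊠_A M` and the two outer Hochschild
relations (char. 2). -/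
def rel4 : Submodule (ZMod 2) (T4 R M) :=
  Submodule.span (ZMod 2)
    ({z | ∃ r a m r' m', z = (R.actR r a) ⊗ₜ[ZMod 2] (m ⊗ₜ[ZMod 2] (r' ⊗ₜ[ZMod 2] m')) +
        r ⊗ₜ[ZMod 2] ((M.actL a m) ⊗ₜ[ZMod 2] (r' ⊗ₜ[ZMod 2] m'))} ∪
     {z | ∃ r a m r' m', z = (R.actL a r) ⊗ₜ[ZMod 2] (m ⊗ₜ[ZMod 2] (r' ⊗ₜ[ZMod 2] m')) +
        r ⊗ₜ[ZMod 2] (m ⊗ₜ[ZMod 2] (r' ⊗ₜ[ZMod 2] (M.actR m' a)))} ∪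
     {z | ∃ r a m r' m', z = r ⊗ₜ[ZMod 2] ((M.actR m a) ⊗ₜ[ZMod 2] (r' ⊗ₜ[ZMod 2] m')) +
        r ⊗ₜ[ZMod 2] (m ⊗ₜ[ZMod 2] ((R.actL a r') ⊗ₜ[ZMod 2] m'))} ∪
     {z | ∃ r a m r' m', z = r ⊗ₜ[ZMod 2] (m ⊗ₜ[ZMod 2] ((R.actR r' a) ⊗ₜ[ZMod 2] m')) +
        r ⊗ₜ[ZMod 2] (m ⊗ₜ[ZMod 2] (r' ⊗ₜ[ZMod 2] (M.actL a m')))})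


instance {A : DGA (ZMod 2)} (R M : DGBimod A) :
    HasQuotient (T4 R M) (Submodule (ZMod 2) (T4 R M)) := Submodule.hasQuotient

/-- The underlying space of the Hochschild chain complex `HC(A, M ⊗̃_A M)`. -/
abbrev HCQ4 := T4 R M ⧸ rel4 R M

/-- The Hochschild homology `HH_n(A, M ⊗̃_A M)` of the derived tensor square. -/
abbrev HH4 (n : ℤ) := Hgr (T4 R M) (gr4 R M) (rel4 R M) (d4 R M) n

/-- The involution `τ` of `R ⊗ (M ⊗ (R ⊗ M))` exchanging the two halves:
`r ⊗ (m ⊗ (r' ⊗ m')) ↦ r' ⊗ (m' ⊗ (r ⊗ m))`. -/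
def tau4 : T4 R M →ₗ[ZMod 2] T4 R M :=
  ((TensorProduct.assoc (ZMod 2) R.V M.V (R.V ⊗[ZMod 2] M.V)).toLinearMap).comp
    (((TensorProduct.comm (ZMod 2) (R.V ⊗[ZMod 2] M.V) (R.V ⊗[ZMod 2] M.V)).toLinearMap).comp
      ((TensorProduct.assoc (ZMod 2) R.V M.V (R.V ⊗[ZMod 2] M.V)).symm.toLinearMap))

/-- The Hochschild–Tate bicomplex `HC^{Tate}(A, M ⊗̃_A M)`: the `ℤ`-periodic bicomplex whose
columns are the Hochschild complex of `M ⊗̃_A M` and whose horizontal differential is `1 + τ`. -/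
def TateBicx : RelBicx (ZMod 2) where
  T := ℤ →₀ T4 R M
  gr := fun p q => Submodule.map (Finsupp.lsingle p) (gr4 R M q)
  N := ⨅ p : ℤ, Submodule.comap (Finsupp.lapply p) (rel4 R M)
  dv := Finsupp.mapRange.linearMap (d4 R M)
  dh := (Finsupp.lmapDomain (T4 R M) (ZMod 2) (fun p => p - 1)).comp
    (Finsupp.mapRange.linearMap (LinearMap.id + tau4 R M))


/-- An element of the Hochschild–Tate bicomplex concentrated in column `p`. -/
def tateSingle (p : ℤ) (x : T4 R M) : (TateBicx R M).T := Finsupp.single p x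

/-- A dg bimodule `M` is `π`-formal (with respect to the resolution `R` of the diagonal
bimodule) if the spectral sequence `ʰᵛE` of the Hochschild–Tate bicomplex of `M ⊗̃_A M`
collapses at the `E³`-page; equivalently, all the induced operations
`d^{2i} : HH_k(A,M) → HH_{k-i}(A,M)`, `i ≥ 2`, vanish. -/
def PiFormalBimod : Prop := (TateBicx R M).collapsesAt (TateBicx R M).Frow 3

/-- A dg algebra is `π`-formal if every dg bimodule over it is `π`-formal. -/
def PiFormalAlg (R : DGBimod A) : Prop := ∀ M : DGBimod A, PiFormalBimod R M

end Hochschild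

section Pages

theorem corr {U V W : Type} [AddCommGroup U] [Module (ZMod 2) U] [AddCommGroup V]
    [Module (ZMod 2) V] [AddCommGroup W] [Module (ZMod 2) W]
    (α : U →ₗ[ZMod 2] V) (β : U →ₗ[ZMod 2] W) (ZV BV : Submodule (ZMod 2) V)
    (ZW BW : Submodule (ZMod 2) W)
    (h1 : ∀ v ∈ ZV, ∃ u, α u ∈ ZV ∧ β u ∈ ZW ∧ α u - v ∈ BV)
    (h2 : ∀ w ∈ ZW, ∃ u, α u ∈ ZV ∧ β u ∈ ZW ∧ β u - w ∈ BW)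
    (h3 : ∀ u, α u ∈ ZV → β u ∈ ZW → (α u ∈ BV ↔ β u ∈ BW)) :
    Nonempty ((↥ZV ⧸ Submodule.comap ZV.subtype BV) ≃ₗ[ZMod 2]
      (↥ZW ⧸ Submodule.comap ZW.subtype BW)) := by
  let U' : Submodule (ZMod 2) U := Submodule.comap α ZV ⊓ Submodule.comap β ZW
  let α' : U' →ₗ[ZMod 2] ZV := (α.comp U'.subtype).codRestrict ZV (fun u => u.2.1)
  let β' : U' →ₗ[ZMod 2] ZW := (β.comp U'.subtype).codRestrict ZW (fun u => u.2.2)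
  let φ := (Submodule.comap ZV.subtype BV).mkQ.comp α'
  let ψ := (Submodule.comap ZW.subtype BW).mkQ.comp β'
  have hφ : Function.Surjective φ := by
    intro x
    obtain ⟨v, rfl⟩ := Submodule.mkQ_surjective _ x
    obtain ⟨u, hu1, hu2, hu⟩ := h1 v v.2
    refine ⟨⟨u, hu1, hu2⟩, ?_⟩
    exact (Submodule.Quotient.eq _).2 hu
  have hψ : Function.Surjective ψ := by
    intro x
    obtain ⟨v, rfl⟩ := Submodule.mkQ_surjective _ x
    obtain ⟨u, hu1, hu2, hu⟩ := h2 v v.2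
    refine ⟨⟨u, hu1, hu2⟩, ?_⟩
    exact (Submodule.Quotient.eq _).2 hu
  have hker : LinearMap.ker φ = LinearMap.ker ψ := by
    ext ⟨u, hu1, hu2⟩
    have e1 : (⟨u, hu1, hu2⟩ : U') ∈ LinearMap.ker φ ↔ α u ∈ BV := by
      rw [LinearMap.mem_ker]
      exact Submodule.Quotient.mk_eq_zero _
    have e2 : (⟨u, hu1, hu2⟩ : U') ∈ LinearMap.ker ψ ↔ β u ∈ BW := by
      rw [LinearMap.mem_ker]
      exact Submodule.Quotient.mk_eq_zero _
    rw [e1, e2]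
    exact h3 u hu1 hu2
  exact ⟨(φ.quotKerEquivOfSurjective hφ).symm.trans
    ((Submodule.quotEquivOfEq _ _ hker).trans (ψ.quotKerEquivOfSurjective hψ))⟩

variable {V W : Type} [AddCommGroup V] [Module (ZMod 2) V] [AddCommGroup W] [Module (ZMod 2) W]

def ZZ (F : ℤ → Submodule (ZMod 2) V) (D : V →ₗ[ZMod 2] V) (r p : ℤ) : Submodule (ZMod 2) V :=
  F p ⊓ Submodule.comap D (F (p - r))

def BB (F : ℤ → Submodule (ZMod 2) V) (D : V →ₗ[ZMod 2] V) (r p : ℤ) : Submodule (ZMod 2) V :=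
  Submodule.map D (ZZ F D (r - 1) (p + r - 1)) ⊔ ZZ F D (r - 1) (p - 1)

abbrev EE (F : ℤ → Submodule (ZMod 2) V) (D : V →ₗ[ZMod 2] V) (r p : ℤ) : Type :=
  ↥(ZZ F D r p) ⧸ Submodule.comap (ZZ F D r p).subtype (BB F D r p)

variable {F : ℤ → Submodule (ZMod 2) V} {D : V →ₗ[ZMod 2] V}
  {F' : ℤ → Submodule (ZMod 2) W} {D' : W →ₗ[ZMod 2] W}

theorem mem_ZZ {r p : ℤ} {x : V} : x ∈ ZZ F D r p ↔ x ∈ F p ∧ D x ∈ F (p - r) := Iff.rfl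

theorem mem_BB {r p : ℤ} {x : V} : x ∈ BB F D r p ↔ ∃ u v, u ∈ F (p + r - 1) ∧ D u ∈ F p ∧
    v ∈ F (p - 1) ∧ D v ∈ F (p - r) ∧ x = D u + v := by
  unfold BB
  rw [Submodule.mem_sup]
  constructor
  · rintro ⟨y, ⟨u, hu, rfl⟩, v, hv, rfl⟩
    obtain ⟨hu1, hu2⟩ := mem_ZZ.1 hu
    obtain ⟨hv1, hv2⟩ := mem_ZZ.1 hv
    rw [show p + r - 1 - (r - 1) = p by ring] at hu2
    rw [show p - 1 - (r - 1) = p - r by ring] at hv2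
    exact ⟨u, v, hu1, hu2, hv1, hv2, rfl⟩
  · rintro ⟨u, v, hu1, hu2, hv1, hv2, rfl⟩
    refine ⟨D u, ⟨u, mem_ZZ.2 ⟨hu1, ?_⟩, rfl⟩, v, mem_ZZ.2 ⟨hv1, ?_⟩, rfl⟩
    · rwa [show p + r - 1 - (r - 1) = p by ring]
    · rwa [show p - 1 - (r - 1) = p - r by ring]

def PageIso (F : ℤ → Submodule (ZMod 2) V) (D : V →ₗ[ZMod 2] V)
    (F' : ℤ → Submodule (ZMod 2) W) (D' : W →ₗ[ZMod 2] W) (f : V →ₗ[ZMod 2] W) (r : ℤ) : Prop :=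
  (∀ p, ∀ x ∈ ZZ F D r p, f x ∈ BB F' D' r p → x ∈ BB F D r p) ∧
  (∀ p, ∀ y ∈ ZZ F' D' r p, ∃ x ∈ ZZ F D r p, f x - y ∈ BB F' D' r p)

theorem PageIso.equiv {f : V →ₗ[ZMod 2] W} (hF : ∀ p x, x ∈ F p → f x ∈ F' p)
    (hD : ∀ x, f (D x) = D' (f x)) {r : ℤ} (h : PageIso F D F' D' f r) (p : ℤ) :
    Nonempty (EE F D r p ≃ₗ[ZMod 2] EE F' D' r p) := by
  have hZ : ∀ x ∈ ZZ F D r p, f x ∈ ZZ F' D' r p := fun x hx =>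
    mem_ZZ.2 ⟨hF _ _ hx.1, by rw [← hD]; exact hF _ _ hx.2⟩
  refine corr LinearMap.id f _ _ _ _ ?_ ?_ ?_
  · intro v hv
    exact ⟨v, hv, hZ v hv, by simp⟩
  · intro w hw
    obtain ⟨x, hx, hxw⟩ := h.2 p w hw
    exact ⟨x, hx, hZ x hx, hxw⟩
  · intro u hu _
    refine ⟨fun hb => ?_, fun hb => h.1 p u hu hb⟩
    obtain ⟨a, b, ha, ha', hb, hb', e⟩ := mem_BB.1 hb
    refine mem_BB.2 ⟨f a, f b, hF _ _ ha, by rw [← hD]; exact hF _ _ ha', hF _ _ hb,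
      by rw [← hD]; exact hF _ _ hb', ?_⟩
    rw [← hD, ← map_add, ← e]; rfl

theorem PageIso.succ {f : V →ₗ[ZMod 2] W} (mF : Monotone F) (mF' : Monotone F')
    (dD : ∀ x, D (D x) = 0) (dD' : ∀ x, D' (D' x) = 0)
    (hF : ∀ p x, x ∈ F p → f x ∈ F' p)
    (hD : ∀ x, f (D x) = D' (f x)) {r : ℤ} (h : PageIso F D F' D' f r) :
    PageIso F D F' D' f (r + 1) := by
  constructor
  · intro p x hx hfx
    obtain ⟨hx1, hx2⟩ := mem_ZZ.1 hx
    obtain ⟨u, v, hu1, hu2, hv1, hv2, e⟩ := mem_BB.1 hfx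
    obtain ⟨u1, hu1Z, hb⟩ := h.2 (p + r) u (mem_ZZ.2 ⟨by convert hu1 using 2; ring,
      by convert hu2 using 2; ring⟩)
    obtain ⟨hu11, hu12⟩ := mem_ZZ.1 hu1Z
    rw [show p + r - r = p by ring] at hu12
    obtain ⟨a, b, ha1, ha2, hb1, hb2, e2⟩ := mem_BB.1 hb
    have hxx : x - D u1 ∈ BB F D r p := by
      refine h.1 p _ (mem_ZZ.2 ⟨sub_mem hx1 hu12, ?_⟩) ?_
      · rw [map_sub, dD, sub_zero]; exact mF (by lia) hx2
      · refine mem_BB.2 ⟨-b, v, neg_mem (by convert hb1 using 2),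
          ?_, hv1, mF' (by lia) hv2, ?_⟩
        · rw [map_neg]; exact neg_mem (by convert hb2 using 2; ring)
        · have e3 : f u1 = D' a + b + u := by rw [← e2]; abel
          rw [map_sub, hD, e, e3, map_add, map_add, dD', map_neg]; abel
    obtain ⟨u2, v2, h1, h2, h3, h4, e5⟩ := mem_BB.1 hxx
    refine mem_BB.2 ⟨u1 + u2, v2, add_mem (by convert hu11 using 2; ring)
      (mF (by lia) h1), ?_, h3, ?_, ?_⟩
    · rw [map_add]; exact add_mem hu12 h2
    · have : D v2 = D x := by
        have := congrArg D e5
        rw [map_sub, map_add, dD, dD] at this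
        simpa using this.symm
      rw [this]; exact hx2
    · rw [map_add, add_assoc, ← e5]; abel
  · intro p y hy
    obtain ⟨hy1, hy2⟩ := mem_ZZ.1 hy
    obtain ⟨x, hx, hb⟩ := h.2 p y (mem_ZZ.2 ⟨hy1, mF' (by lia) hy2⟩)
    obtain ⟨hx1, hx2⟩ := mem_ZZ.1 hx
    obtain ⟨u, v, hu1, hu2, hv1, hv2, e⟩ := mem_BB.1 hb
    have e' : f x = D' u + v + y := by rw [← e]; abel
    have hDx : D x ∈ BB F D r (p - r) := by
      refine h.1 _ _ (mem_ZZ.2 ⟨hx2, by rw [dD]; exact zero_mem _⟩) ?_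
      refine mem_BB.2 ⟨v, D' y, by convert hv1 using 2; ring, hv2, by convert hy2 using 2; ring,
        by rw [dD']; exact zero_mem _, ?_⟩
      rw [hD, e', map_add, map_add, dD', zero_add]
    obtain ⟨u1, v1, h1, h2, h3, h4, e1⟩ := mem_BB.1 hDx
    rw [show p - r + r - 1 = p - 1 by ring] at h1
    have hD1 : D (x - u1) = v1 := by rw [map_sub, e1]; abel
    have hx1Z : D (x - u1) ∈ F (p - (r + 1)) := by
      rw [hD1]; convert h3 using 2; ring
    refine ⟨x - u1, mem_ZZ.2 ⟨sub_mem hx1 (mF (by lia) h1), hx1Z⟩, ?_⟩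
    refine mem_BB.2 ⟨u, v - f u1, mF' (by lia) hu1, hu2, sub_mem hv1 (hF _ _ h1), ?_, ?_⟩
    · have : D' (v - f u1) = f (D (x - u1)) - D' y := by
        rw [hD, map_sub, map_sub f, e', map_sub, map_add, map_add, dD']; abel
      rw [this]; exact sub_mem (hF _ _ hx1Z) hy2
    · rw [map_sub, e']; abel

theorem PageIso.of_le {f : V →ₗ[ZMod 2] W} (mF : Monotone F) (mF' : Monotone F')
    (dD : ∀ x, D (D x) = 0) (dD' : ∀ x, D' (D' x) = 0)
    (hF : ∀ p x, x ∈ F p → f x ∈ F' p)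
    (hD : ∀ x, f (D x) = D' (f x)) {r s : ℤ} (hrs : r ≤ s) (h : PageIso F D F' D' f r) :
    PageIso F D F' D' f s := by
  induction s, hrs using Int.leInduction with
  | base => exact h
  | succ s _ ih => exact ih.succ mF mF' dD dD' hF hD

def ZD (F : ℤ → Submodule (ZMod 2) V) (D : V →ₗ[ZMod 2] V) (r p : ℤ) : Prop :=
  ∀ x ∈ ZZ F D r p, D x ∈ BB F D r (p - r)

theorem ZD.transfer {f : V →ₗ[ZMod 2] W}
    (dD : ∀ x, D (D x) = 0) 
    (hF : ∀ p x, x ∈ F p → f x ∈ F' p)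
    (hD : ∀ x, f (D x) = D' (f x)) {r p : ℤ} (h : PageIso F D F' D' f r)
    (hz : ZD F' D' r p) : ZD F D r p := by
  intro x hx
  refine h.1 _ _ (mem_ZZ.2 ⟨hx.2, by rw [dD]; exact zero_mem _⟩) ?_
  rw [hD]
  exact hz _ (mem_ZZ.2 ⟨hF _ _ hx.1, by rw [← hD]; exact hF _ _ hx.2⟩)

theorem ZD.equiv (mF : Monotone F) (dD : ∀ x, D (D x) = 0) {r : ℤ} (hz : ∀ p, ZD F D r p) (p : ℤ) :
    Nonempty (EE F D (r + 1) p ≃ₗ[ZMod 2] EE F D r p) := by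
  have hZ : ∀ x ∈ ZZ F D (r + 1) p, x ∈ ZZ F D r p := fun x hx =>
    mem_ZZ.2 ⟨hx.1, mF (by lia) hx.2⟩
  refine corr LinearMap.id LinearMap.id _ _ _ _ ?_ ?_ ?_
  · intro v hv
    exact ⟨v, hv, hZ v hv, by simp⟩
  · intro x hx
    obtain ⟨u, v, h1, h2, h3, h4, e⟩ := mem_BB.1 (hz p x hx)
    rw [show p - r + r - 1 = p - 1 by ring] at h1
    have : x - u ∈ ZZ F D (r + 1) p := by
      refine mem_ZZ.2 ⟨sub_mem hx.1 (mF (by lia) h1), ?_⟩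
      rw [map_sub, e, add_sub_cancel_left]
      convert h3 using 2; ring
    refine ⟨x - u, this, hZ _ this, mem_BB.2 ⟨0, -u, zero_mem _, by simp, neg_mem h1, ?_, ?_⟩⟩
    · rw [map_neg]; exact neg_mem h2
    · simp
  · intro x hx hx'
    simp only [LinearMap.id_apply] at *
    constructor
    · intro hb
      obtain ⟨u, v, h1, h2, h3, h4, rfl⟩ := mem_BB.1 hb
      have hDu : D u ∈ BB F D r p := by
        have := hz (p + r) u (mem_ZZ.2 ⟨by convert h1 using 2; ring, by convert h2 using 2; ring⟩)
        rwa [show p + r - r = p by ring] at this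
      refine add_mem hDu (mem_BB.2 ⟨0, v, zero_mem _, by simp, h3, mF (by lia) h4, by simp⟩)
    · intro hb
      obtain ⟨u, v, h1, h2, h3, h4, rfl⟩ := mem_BB.1 hb
      refine mem_BB.2 ⟨u, v, mF (by lia) h1, h2, h3, ?_, rfl⟩
      have := hx.2
      simpa [dD] using this

theorem ZD.equiv_le (mF : Monotone F) (dD : ∀ x, D (D x) = 0) {r s : ℤ} (hrs : r ≤ s)
    (hz : ∀ t, r ≤ t → ∀ p, ZD F D t p) (p : ℤ) :
    Nonempty (EE F D s p ≃ₗ[ZMod 2] EE F D r p) := by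
  induction s, hrs using Int.leInduction with
  | base => exact ⟨LinearEquiv.refl _ _⟩
  | succ s hs ih =>
    obtain ⟨e⟩ := ih
    obtain ⟨e'⟩ := ZD.equiv mF dD (hz s hs) p
    exact ⟨e'.trans e⟩

/-- homology of an ungraded differential module -/
abbrev HD (D : V →ₗ[ZMod 2] V) : Type :=
  ↥(LinearMap.ker D) ⧸ Submodule.comap (LinearMap.ker D).subtype (LinearMap.range D)

def FilH (F : ℤ → Submodule (ZMod 2) V) (D : V →ₗ[ZMod 2] V) (p : ℤ) :
    Submodule (ZMod 2) (HD D) :=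
  Submodule.map (Submodule.mkQ _) (Submodule.comap (LinearMap.ker D).subtype (F p))

theorem FilH_mono (mF : Monotone F) : Monotone (FilH F D) := by
  intro a b hab
  exact Submodule.map_mono (Submodule.comap_mono (mF hab))

theorem FilH_bot {p : ℤ} (h : F p = ⊥) : FilH F D p = ⊥ := by
  rw [eq_bot_iff]
  rintro _ ⟨x, hx, rfl⟩
  have : x = 0 := by
    have : (x : V) ∈ F p := hx
    rw [h] at this
    exact Subtype.ext this
  simp [this]

theorem FilH_top {p : ℤ} (h : F p = ⊤) : FilH F D p = ⊤ := by
  rw [FilH, h, Submodule.comap_top, Submodule.map_top, Submodule.range_mkQ]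

theorem EE_inf (mF : Monotone F) (K : ℤ)
    (hbot : ∀ p, p < -K → F p = ⊥) (htop : ∀ p, K < p → F p = ⊤) (r p : ℤ)
    (hr : |p| + |K| + 2 < r) :
    Nonempty (EE F D r p ≃ₗ[ZMod 2]
      (↥(FilH F D p) ⧸ Submodule.comap (FilH F D p).subtype (FilH F D (p - 1)))) := by
  have hp := abs_le.1 (le_refl |p|)
  have hK := abs_le.1 (le_refl |K|)
  have b1 : F (p - r) = ⊥ := hbot _ (by lia)
  have t1 : F (p + r - 1) = ⊤ := htop _ (by lia)
  have key : ∀ u : LinearMap.ker D, (Submodule.mkQ _ u : HD D) ∈ FilH F D (p - 1) ↔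
      ∃ a b, D a + b = (u : V) ∧ b ∈ F (p - 1) ∧ D b = 0 := by
    intro u
    constructor
    · rintro ⟨b, hb, e⟩
      have := (Submodule.Quotient.eq _).1 e
      obtain ⟨a, ha⟩ := this
      refine ⟨-a, b, ?_, hb, b.2⟩
      rw [map_neg, ha]; simp
    · rintro ⟨a, b, e, hb, hb'⟩
      refine ⟨⟨b, hb'⟩, hb, ?_⟩
      refine (Submodule.Quotient.eq _).2 ⟨-a, ?_⟩
      simp [← e]
  refine corr (LinearMap.ker D).subtype (Submodule.mkQ _) _ _ _ _ ?_ ?_ ?_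
  · intro v hv
    obtain ⟨h1, h2⟩ := mem_ZZ.1 hv
    rw [b1] at h2
    exact ⟨⟨v, h2⟩, hv, ⟨_, h1, rfl⟩, by simp⟩
  · rintro _ ⟨w, hw, rfl⟩
    refine ⟨w, mem_ZZ.2 ⟨hw, ?_⟩, ⟨_, hw, rfl⟩, by simp⟩
    rw [Submodule.subtype_apply, w.2]; exact zero_mem _
  · intro u hu _
    rw [key, mem_BB, b1, t1]
    constructor
    · rintro ⟨a, b, h1, h2, h3, h4, e⟩
      exact ⟨a, b, e.symm, h3, h4⟩
    · rintro ⟨a, b, e, h3, h4⟩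
      refine ⟨a, b, trivial, ?_, h3, h4, e.symm⟩
      have : D a = u - b := by rw [← e]; simp
      rw [this]
      exact sub_mem hu.1 (mF (by lia) h3)

theorem rank_gr_le (dD : ∀ x, D (D x) = 0) (p : ℤ) : Module.rank (ZMod 2)
      (↥(FilH F D p) ⧸ Submodule.comap (FilH F D p).subtype (FilH F D (p - 1))) ≤
    Module.rank (ZMod 2) (EE F D 0 p) := by
  -- a linear map from `F p ∩ ker D` to both
  let U : Submodule (ZMod 2) V := F p ⊓ LinearMap.ker D
  let φ : U →ₗ[ZMod 2] ZZ F D 0 p := Submodule.inclusion (fun x hx => mem_ZZ.2 ⟨hx.1, by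
    rw [show D x = 0 from hx.2]; exact zero_mem _⟩)
  let φ' : U →ₗ[ZMod 2] EE F D 0 p := (Submodule.mkQ _).comp φ
  let ψ : U →ₗ[ZMod 2] FilH F D p := 
    LinearMap.codRestrict _ ((Submodule.mkQ _).comp (Submodule.inclusion inf_le_right))
      (fun u => ⟨⟨u.1, u.2.2⟩, u.2.1, rfl⟩)
  let ψ' : U →ₗ[ZMod 2] (↥(FilH F D p) ⧸
      Submodule.comap (FilH F D p).subtype (FilH F D (p - 1))) := (Submodule.mkQ _).comp ψ
  have hs : Function.Surjective ψ' := by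
    intro x
    obtain ⟨⟨_, ⟨w, hw, rfl⟩⟩, rfl⟩ := Submodule.mkQ_surjective _ x
    exact ⟨⟨w.1, hw, w.2⟩, rfl⟩
  have hk : LinearMap.ker φ' ≤ LinearMap.ker ψ' := by
    intro u hu
    have hu : φ u ∈ Submodule.comap (ZZ F D 0 p).subtype (BB F D 0 p) :=
      (Submodule.Quotient.mk_eq_zero _).1 hu
    have hu : (u : V) ∈ BB F D 0 p := hu
    refine (Submodule.Quotient.mk_eq_zero _).2 ?_
    obtain ⟨a, b, h1, h2, h3, h4, e⟩ := mem_BB.1 hu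
    have hb : D b = 0 := by
      have : D (u : V) = 0 := u.2.2
      rw [e, map_add, dD, zero_add] at this
      exact this
    refine ⟨⟨b, hb⟩, h3, ?_⟩
    refine (Submodule.Quotient.eq _).2 ⟨-a, ?_⟩
    simp [e]
  let g := Submodule.liftQ (LinearMap.ker φ') ψ' hk
  have hg : Function.Surjective g := by
    intro y
    obtain ⟨u, rfl⟩ := hs y
    exact ⟨Submodule.mkQ _ u, rfl⟩
  refine (LinearMap.rank_le_of_surjective g hg).trans ?_
  rw [φ'.quotKerEquivRange.rank_eq]
  exact Submodule.rank_le _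

theorem sum_reindex {ι κ : Type} (e : ι → κ) (he : Function.Injective e) (f : κ → Cardinal.{0})
    (hf : ∀ y, f y ≠ 0 → ∃ x, e x = y) :
    Cardinal.sum (fun x => f (e x)) = Cardinal.sum f := by
  refine Cardinal.mk_congr (Equiv.ofBijective
    (fun x : (Σ i, (f (e i)).out) => (⟨e x.1, x.2⟩ : Σ k, (f k).out)) ⟨?_, ?_⟩)
  · rintro ⟨i, x⟩ ⟨j, y⟩ h
    have hij : i = j := he (congrArg Sigma.fst h)
    subst hij
    simpa using h
  · rintro ⟨y, z⟩
    obtain ⟨x, rfl⟩ := hf y (by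
      intro h0
      have : Cardinal.mk (f y).out = 0 := by rw [Cardinal.mk_out, h0]
      exact (Cardinal.mk_eq_zero_iff.1 this).elim z)
    exact ⟨⟨x, z⟩, rfl⟩

theorem rank_filtration (Fl : ℤ → Submodule (ZMod 2) V) (mF : Monotone Fl) (a b : ℤ)
    (hb : ∀ p, p ≤ a → Fl p = ⊥) (ht : ∀ p, b ≤ p → Fl p = ⊤) :
    Module.rank (ZMod 2) V = Cardinal.sum (fun p : ℤ => Module.rank (ZMod 2)
      (↥(Fl p) ⧸ Submodule.comap (Fl p).subtype (Fl (p - 1)))) := by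
  set g : ℤ → Cardinal := fun p : ℤ => Module.rank (ZMod 2)
      (↥(Fl p) ⧸ Submodule.comap (Fl p).subtype (Fl (p - 1))) with hg
  have step : ∀ p, Module.rank (ZMod 2) (Fl p) = g p + Module.rank (ZMod 2) (Fl (p - 1)) := by
    intro p
    rw [← (Submodule.comapSubtypeEquivOfLe (mF (by lia : p - 1 ≤ p))).rank_eq]
    exact (Submodule.rank_quotient_add_rank _).symm
  have single : ∀ (q : ℤ) (c : Cardinal.{0}),
      Cardinal.sum (fun p : ℤ => if p = q then c else 0) = c := by
    intro q c
    rw [← sum_reindex (fun _ : Unit => q) (fun _ _ _ => rfl)]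
    · simp
    · intro y hy
      by_contra h
      exact hy (if_neg (fun h' => h ⟨(), h'.symm⟩))
  have main : ∀ n : ℕ, Module.rank (ZMod 2) (Fl (a + n)) =
      Cardinal.sum (fun p : ℤ => if p ≤ a + n then g p else 0) := by
    intro n
    induction n with
    | zero =>
      have h0 : Module.rank (ZMod 2) (Fl (a + (0 : ℕ))) = 0 := by
        rw [hb _ (by simp)]; simp
      rw [h0]
      have : (fun p : ℤ => if p ≤ a + (0 : ℕ) then g p else 0) = fun _ => 0 := by
        funext p
        split_ifs with h
        · have h1 := step p
          have h2 : Module.rank (ZMod 2) (Fl p) = 0 := by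
            rw [hb _ (by simpa using h)]; simp
          rw [h2] at h1
          exact (add_eq_zero.1 h1.symm).1
        · rfl
      rw [this]; simp
    | succ n ih =>
      rw [step, show a + ((n + 1 : ℕ) : ℤ) - 1 = a + n by push_cast; ring, ih,
        ← single (a + (n + 1 : ℕ)) (g (a + (n + 1 : ℕ))), ← Cardinal.sum_add_distrib']
      congr 1
      funext p
      by_cases h1 : p = a + (n + 1 : ℕ)
      · subst h1
        simp
      · by_cases h2 : p ≤ a + n
        · rw [if_neg h1, if_pos h2, if_pos (by push_cast; lia), zero_add]
        · rw [if_neg h1, if_neg h2, if_neg (by push_cast at h1 ⊢; lia), zero_add]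
  have hm := main (b - a).toNat
  rw [ht _ (by lia), rank_top] at hm
  rw [hm]
  congr 1
  funext p
  split_ifs with h
  · rfl
  · have h1 : Fl (p - 1) = ⊤ := ht _ (by lia)
    have : Subsingleton (↥(Fl p) ⧸ Submodule.comap (Fl p).subtype (Fl (p - 1))) := by
      rw [Submodule.Quotient.subsingleton_iff, h1, Submodule.comap_top]
    exact rank_zero_iff.2 this |>.symm
end Pages

section Tau

/-- A grading given by a locally finite family of orthogonal projections. -/
structure Grd (V : Type) [AddCommGroup V] [Module (ZMod 2) V] where
  π : ℤ → V →ₗ[ZMod 2] V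
  same : ∀ i x, π i (π i x) = π i x
  ne : ∀ i j x, i ≠ j → π i (π j x) = 0
  fin : ∀ x, {i | π i x ≠ 0}.Finite
  sep : ∀ x, (∀ i, π i x = 0) → x = 0

namespace Grd
variable {V : Type} [AddCommGroup V] [Module (ZMod 2) V] (G : Grd V)

def le (p : ℤ) : Submodule (ZMod 2) V where
  carrier := {x | ∀ i, p < i → G.π i x = 0}
  add_mem' := by
    intro a b ha hb i hi
    rw [map_add, ha i hi, hb i hi, add_zero]
  zero_mem' := by intro i _; simp
  smul_mem' := by
    intro c x hx i hi
    rw [map_smul, hx i hi, smul_zero]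

def col (p : ℤ) : Submodule (ZMod 2) V where
  carrier := {x | ∀ i, i < -p → G.π i x = 0}
  add_mem' := by
    intro a b ha hb i hi
    rw [map_add, ha i hi, hb i hi, add_zero]
  zero_mem' := by intro i _; simp
  smul_mem' := by
    intro c x hx i hi
    rw [map_smul, hx i hi, smul_zero]

theorem mem_le {p : ℤ} {x : V} : x ∈ G.le p ↔ ∀ i, p < i → G.π i x = 0 := Iff.rfl
theorem mem_col {p : ℤ} {x : V} : x ∈ G.col p ↔ ∀ i, i < -p → G.π i x = 0 := Iff.rfl

theorem le_mono : Monotone G.le := fun _ _ h _ hx i hi => hx i (by lia)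
theorem col_mono : Monotone G.col := fun _ _ h _ hx i hi => hx i (by lia)

theorem hom_le {p q : ℤ} {x : V} (hx : G.π p x = x) (h : p ≤ q) : x ∈ G.le q := by
  intro i hi
  rw [← hx]; exact G.ne _ _ _ (by lia)

theorem hom_col {p q : ℤ} {x : V} (hx : G.π p x = x) (h : -q ≤ p) : x ∈ G.col q := by
  intro i hi
  rw [← hx]; exact G.ne _ _ _ (by lia)

theorem le_pred {p q : ℤ} {x : V} (hx : x ∈ G.le p) (h : G.π p x = 0) (hq : q = p - 1) :
    x ∈ G.le q := by
  intro i hi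
  rcases eq_or_lt_of_le (show p ≤ i by lia) with h' | h'
  · rw [← h']; exact h
  · exact hx i h'

theorem col_pred {p q : ℤ} {x : V} (hx : x ∈ G.col p) (h : G.π (-p) x = 0) (hq : q = p - 1) :
    x ∈ G.col q := by
  intro i hi
  rcases eq_or_lt_of_le (show i ≤ -p by lia) with h' | h'
  · rw [h']; exact h
  · exact hx i h'

theorem pi_of_hom {p : ℤ} {x : V} (hx : G.π p x = x) (i : ℤ) :
    G.π i x = if i = p then x else 0 := by
  split_ifs with h
  · rw [h, hx]
  · rw [← hx]; exact G.ne _ _ _ h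

theorem sum_pi (x : V) : ∑ i ∈ (G.fin x).toFinset, G.π i x = x := by
  rw [← sub_eq_zero]
  apply G.sep
  intro j
  rw [map_sub, map_sum, sub_eq_zero]
  by_cases h : G.π j x = 0
  · rw [h]
    refine Finset.sum_eq_zero fun i _ => ?_
    by_cases hij : j = i
    · subst hij; rw [G.same, h]
    · exact G.ne _ _ _ hij
  · rw [Finset.sum_eq_single j]
    · exact G.same _ _
    · intro i _ hij; exact G.ne _ _ _ (Ne.symm hij)
    · intro hj; simp [h] at hj

end Grd

/-- complex with an involution, and the square structure on it -/
structure TC : Type 1 where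
  C : Type
  [acgC : AddCommGroup C]
  [modC : Module (ZMod 2) C]
  G : Grd C
  d : C →ₗ[ZMod 2] C
  τ : C →ₗ[ZMod 2] C
  d_d : ∀ x, d (d x) = 0
  τ_τ : ∀ x, τ (τ x) = x
  d_τ : ∀ x, d (τ x) = τ (d x)
  π_d : ∀ i x, G.π i (d x) = d (G.π (i + 1) x)
  π_τ : ∀ i x, G.π i (τ x) = τ (G.π i x)
  N : Type
  [acgN : AddCommGroup N]
  [modN : Module (ZMod 2) N]
  GN : Grd N
  dN : N →ₗ[ZMod 2] N
  π_dN : ∀ i x, GN.π i (dN x) = dN (GN.π (i + 1) x)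
  rel : Submodule (ZMod 2) N
  P : N →ₗ[ZMod 2] N →ₗ[ZMod 2] C
  τ_P : ∀ x y, τ (P x y) = P y x
  d_P : ∀ x y, d (P x y) = P (dN x) y + P x (dN y)
  π_P : ∀ i j x y, GN.π i x = x → GN.π j y = y → G.π (i + j) (P x y) = P x y
  dN_dN : ∀ x, dN (dN x) = 0
  T1 : ∀ z, τ z = z → ∃ x w, z = P x x + (w + τ w)
  T2 : ∀ x, (∃ w, P x x = w + τ w) ↔ x ∈ rel

attribute [instance] TC.acgC TC.modC TC.acgN TC.modN

namespace TC
variable (S : TC)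

def D : S.C →ₗ[ZMod 2] S.C := S.d + (LinearMap.id + S.τ)

theorem D_apply (x : S.C) : S.D x = S.d x + (x + S.τ x) := rfl

theorem π_D (i : ℤ) (x : S.C) : S.G.π i (S.D x) =
    S.d (S.G.π (i + 1) x) + (S.G.π i x + S.τ (S.G.π i x)) := by
  rw [D_apply, map_add, map_add, S.π_d, S.π_τ]

theorem D_D (x : S.C) : S.D (S.D x) = 0 := by
  simp only [D_apply, map_add, S.d_d, S.d_τ, S.τ_τ]
  linear_combination (norm := (match_scalars <;> decide)) (0 : ZMod 2) • (rfl : x = x)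

theorem D_le {p q : ℤ} {x : S.C} (hx : x ∈ S.G.le p) (h : p ≤ q) : S.D x ∈ S.G.le q := by
  intro i hi
  rw [π_D, hx _ (by lia), hx _ (by lia)]; simp

theorem P_sq_add (x y : S.N) : S.P (x + y) (x + y) =
    S.P x x + S.P y y + (S.P x y + S.τ (S.P x y)) := by
  rw [S.τ_P]; simp only [map_add, LinearMap.add_apply]; abel

theorem P_sq_sum (s : Finset ℤ) (f : ℤ → S.N) : ∃ w, S.P (∑ i ∈ s, f i) (∑ i ∈ s, f i) =
    (∑ i ∈ s, S.P (f i) (f i)) + (w + S.τ w) := by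
  classical
  induction s using Finset.induction_on with
  | empty => exact ⟨0, by simp⟩
  | insert a s ha ih =>
    obtain ⟨w, hw⟩ := ih
    refine ⟨S.P (f a) (∑ i ∈ s, f i) + w, ?_⟩
    rw [Finset.sum_insert ha, Finset.sum_insert ha, P_sq_add, hw, map_add]
    abel

/-- graded version of `T1` -/
theorem T1gr (p : ℤ) (z : S.C) (hz : S.G.π p z = z) (ht : S.τ z = z) :
    ∃ x w, S.G.π p w = w ∧ (∀ q, p = q + q → S.GN.π q x = x) ∧ ((∀ q, p ≠ q + q) → x = 0) ∧
      z = S.P x x + (w + S.τ w) := by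
  obtain ⟨x, w, e⟩ := S.T1 z ht
  obtain ⟨w', e'⟩ := S.P_sq_sum (S.GN.fin x).toFinset (fun i => S.GN.π i x)
  rw [S.GN.sum_pi] at e'
  have e2 : z = S.G.π p (∑ i ∈ (S.GN.fin x).toFinset, S.P (S.GN.π i x) (S.GN.π i x)) +
      (S.G.π p (w' + w) + S.τ (S.G.π p (w' + w))) := by
    conv_lhs => rw [← hz, e, e']
    simp only [map_add, S.π_τ]
    abel
  have hP : ∀ i, S.G.π p (S.P (S.GN.π i x) (S.GN.π i x)) =
      if p = i + i then S.P (S.GN.π i x) (S.GN.π i x) else 0 := fun i =>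
    S.G.pi_of_hom (S.π_P i i _ _ (S.GN.same _ _) (S.GN.same _ _)) p
  rw [map_sum] at e2
  simp only [hP] at e2
  by_cases hp : ∃ q, p = q + q
  · obtain ⟨q, hq⟩ := hp
    refine ⟨S.GN.π q x, S.G.π p (w' + w), S.G.same _ _, ?_, fun h => absurd hq (h q), ?_⟩
    · intro q' hq'
      obtain rfl : q = q' := by lia
      exact S.GN.same _ _
    · conv_lhs => rw [e2]
      congr 1
      by_cases h0 : S.GN.π q x = 0
      · rw [h0]
        simp only [map_zero]
        refine Finset.sum_eq_zero fun i _ => ?_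
        split_ifs with h
        · obtain rfl : q = i := by lia
          rw [h0]; simp
        · rfl
      · rw [Finset.sum_eq_single q, if_pos hq]
        · intro i _ hi; exact if_neg (by lia)
        · intro hq; simp [h0] at hq
  · push Not at hp
    refine ⟨0, S.G.π p (w' + w), S.G.same _ _, by simp, by simp, ?_⟩
    conv_lhs => rw [e2]
    congr 1
    rw [Finset.sum_eq_zero fun i _ => if_neg (hp i)]
    simp

theorem T1odd {p : ℤ} {z : S.C} (hz : S.G.π p z = z) (ht : S.τ z = z) (hp : ∀ q, p ≠ q + q) :
    ∃ w, S.G.π p w = w ∧ z = w + S.τ w := by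
  obtain ⟨x, w, h1, h2, h3, e⟩ := S.T1gr p z hz ht
  rw [h3 hp] at e
  exact ⟨w, h1, by simpa using e⟩

theorem T1even {q : ℤ} {z : S.C} (hz : S.G.π (q + q) z = z) (ht : S.τ z = z) :
    ∃ x w, S.G.π (q + q) w = w ∧ S.GN.π q x = x ∧ z = S.P x x + (w + S.τ w) := by
  obtain ⟨x, w, h1, h2, h3, e⟩ := S.T1gr _ z hz ht
  exact ⟨x, w, h1, h2 q rfl, e⟩

theorem T2gr {q : ℤ} {x : S.N} (hx : S.GN.π q x = x) (hr : x ∈ S.rel) :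
    ∃ w, S.G.π (q + q) w = w ∧ S.P x x = w + S.τ w := by
  obtain ⟨w, hw⟩ := (S.T2 x).2 hr
  refine ⟨S.G.π (q + q) w, S.G.same _ _, ?_⟩
  rw [← S.π_τ, ← map_add, ← hw, S.π_P _ _ _ _ hx hx]

/-- the correction `Q x = x ⊗ x + x ⊗ dx`. -/
def Q (x : S.N) : S.C := S.P x x + S.P x (S.dN x)

theorem D_Q (x : S.N) : S.D (S.Q x) = S.P (S.dN x) (S.dN x) := by
  simp only [Q, D_apply, map_add, S.d_P, S.τ_P, S.dN_dN, map_zero]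
  linear_combination (norm := (match_scalars <;> decide))
    (0 : ZMod 2) • (rfl : S.P x x = S.P x x)

theorem dN_hom {q q' : ℤ} {x : S.N} (hx : S.GN.π q x = x) (h : q' = q - 1) :
    S.GN.π q' (S.dN x) = S.dN x := by
  rw [S.π_dN, h, sub_add_cancel, hx]

theorem Q_le {q p : ℤ} {x : S.N} (hx : S.GN.π q x = x) (h : q + q ≤ p) : S.Q x ∈ S.G.le p := by
  refine add_mem (S.G.hom_le (S.π_P _ _ _ _ hx hx) h) ?_
  exact S.G.hom_le (S.π_P _ _ _ _ hx (S.dN_hom hx rfl)) (by lia)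

theorem π_Q {q : ℤ} {x : S.N} (hx : S.GN.π q x = x) : S.G.π (q + q) (S.Q x) = S.P x x := by
  rw [Q, map_add, S.π_P _ _ _ _ hx hx, S.G.pi_of_hom (S.π_P _ _ _ _ hx (S.dN_hom hx rfl)),
    if_neg (by lia), add_zero]

/-- `z` has leading term `x ⊗ x` modulo the image of `1 + τ` -/
def Lead (q : ℤ) (z : S.C) (x : S.N) : Prop :=
  ∃ w, S.G.π (q + q) w = w ∧ S.G.π (q + q) z = S.P x x + (w + S.τ w)

theorem Lead.add {q : ℤ} {z z' : S.C} {x x' : S.N} (h : S.Lead q z x) (h' : S.Lead q z' x')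
    (hx : S.GN.π q x = x) (hx' : S.GN.π q x' = x') :
    S.Lead q (z + z') (x + x') := by
  obtain ⟨w, hw, e⟩ := h
  obtain ⟨w', hw', e'⟩ := h'
  refine ⟨w + w' + S.P x x', ?_, ?_⟩
  · rw [map_add, map_add, hw, hw', S.π_P _ _ _ _ hx hx']
  · rw [map_add, e, e', P_sq_add]
    simp only [map_add]
    linear_combination (norm := (match_scalars <;> decide))
      (0 : ZMod 2) • (rfl : S.P x x = S.P x x)

/-- Killing the leading term. -/
theorem kill_odd {p : ℤ} {u : S.C} (hu : u ∈ S.G.le p) (hD : S.D u ∈ S.G.le (p - 1))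
    (hp : ∀ q, p ≠ q + q) : ∃ w, S.G.π p w = w ∧ u + S.D w ∈ S.G.le (p - 1) := by
  have ht : S.τ (S.G.π p u) = S.G.π p u := by
    have := hD p (by lia)
    rw [π_D, hu _ (by lia), map_zero, zero_add] at this
    linear_combination (norm := (match_scalars <;> decide)) (1 : ZMod 2) • this
  obtain ⟨w, hw, e⟩ := S.T1odd (S.G.same p u) ht hp
  refine ⟨w, hw, S.G.le_pred (add_mem hu (S.D_le (S.G.hom_le hw le_rfl) le_rfl)) ?_ rfl⟩
  rw [map_add, π_D, S.G.pi_of_hom hw, if_neg (by lia), hw, e]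
  simp only [map_zero]
  linear_combination (norm := (match_scalars <;> decide)) (0 : ZMod 2) • (rfl : w = w)

theorem kill_even {q p : ℤ} {u : S.C} (hpq : p = q + q) (hu : u ∈ S.G.le p)
    (hD : S.D u ∈ S.G.le (p - 1)) :
    ∃ x w, S.G.π p w = w ∧ S.GN.π q x = x ∧ S.G.π p u = S.P x x + (w + S.τ w) ∧
      u + S.Q x + S.D w ∈ S.G.le (p - 1) := by
  subst hpq
  have ht : S.τ (S.G.π (q + q) u) = S.G.π (q + q) u := by
    have := hD (q + q) (by lia)
    rw [π_D, hu _ (by lia), map_zero, zero_add] at this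
    linear_combination (norm := (match_scalars <;> decide)) (1 : ZMod 2) • this
  obtain ⟨x, w, hw, hx, e⟩ := S.T1even (S.G.same _ u) ht
  refine ⟨x, w, hw, hx, e, S.G.le_pred (add_mem (add_mem hu (S.Q_le hx le_rfl))
    (S.D_le (S.G.hom_le hw le_rfl) le_rfl)) ?_ rfl⟩
  rw [map_add, map_add, S.π_Q hx, π_D, S.G.pi_of_hom hw, if_neg (by lia), hw, e]
  simp only [map_zero]
  linear_combination (norm := (match_scalars <;> decide)) (0 : ZMod 2) • (rfl : w = w)

theorem L4 {p : ℤ} {z : S.C} (hp : ∀ q, p ≠ q + q) (hz : z ∈ ZZ S.G.le S.D 3 p) :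
    z ∈ BB S.G.le S.D 3 p := by
  obtain ⟨h1, h2⟩ := mem_ZZ.1 hz
  obtain ⟨w, hw, h⟩ := S.kill_odd h1 (S.G.le_mono (by lia) h2) hp
  refine mem_BB.2 ⟨w, z + S.D w, S.G.hom_le hw (by lia), S.D_le (S.G.hom_le hw le_rfl) le_rfl, h,
    ?_, ?_⟩
  · rw [map_add, D_D, add_zero]; exact h2
  · linear_combination (norm := (match_scalars <;> decide)) (0 : ZMod 2) • (rfl : z = z)

theorem L2 {q : ℤ} {x : S.N} (hx : S.GN.π q x = x) (hr : S.dN x ∈ S.rel) :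
    ∃ z ∈ ZZ S.G.le S.D 3 (q + q), S.Lead q z x := by
  obtain ⟨w, hw, e⟩ := S.T2gr (S.dN_hom hx rfl) hr
  refine ⟨S.Q x + w, mem_ZZ.2 ⟨add_mem (S.Q_le hx le_rfl) (S.G.hom_le hw (by lia)), ?_⟩, ?_⟩
  · rw [map_add, D_Q, e, D_apply]
    have : w + S.τ w + (S.d w + (w + S.τ w)) = S.d w := by
      linear_combination (norm := (match_scalars <;> decide)) (0 : ZMod 2) • (rfl : w = w)
    rw [this]
    intro i hi
    rw [S.π_d, S.G.pi_of_hom hw, if_neg (by lia), map_zero]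
  · refine ⟨0, by simp, ?_⟩
    rw [map_add, S.π_Q hx, S.G.pi_of_hom hw, if_neg (by lia)]; simp

theorem L1 {q : ℤ} {z : S.C} (hz : z ∈ ZZ S.G.le S.D 3 (q + q)) :
    ∃ x, S.GN.π q x = x ∧ S.dN x ∈ S.rel ∧ S.Lead q z x := by
  obtain ⟨h1, h2⟩ := mem_ZZ.1 hz
  obtain ⟨x, w, hw, hx, e, h⟩ := S.kill_even rfl h1 (S.G.le_mono (by lia) h2)
  refine ⟨x, hx, ?_, w, hw, e⟩
  have hP := S.π_P _ _ _ _ (S.dN_hom hx rfl) (S.dN_hom hx rfl)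
  have hD : S.D (z + S.Q x + S.D w) = S.D z + S.P (S.dN x) (S.dN x) := by
    rw [map_add, map_add, D_Q, D_D, add_zero]
  obtain ⟨w', hw', h'⟩ := S.kill_odd h (by
    rw [hD]
    exact add_mem (S.G.le_mono (by lia) h2) (S.G.hom_le hP (by lia))) (by lia)
  have := S.π_D (q - 1 + (q - 1)) (z + S.Q x + S.D w + S.D w')
  rw [map_add S.D, D_D, add_zero, hD, map_add, h2 _ (by lia), hP, zero_add,
    h' _ (by lia), map_zero, zero_add] at this
  exact (S.T2 _).1 ⟨_, this⟩

theorem L3 {q : ℤ} {z : S.C} {x : S.N} (hz : z ∈ ZZ S.G.le S.D 3 (q + q)) (hx : S.GN.π q x = x)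
    (hl : S.Lead q z x) : z ∈ BB S.G.le S.D 3 (q + q) ↔
      ∃ y, S.GN.π (q + 1) y = y ∧ x + S.dN y ∈ S.rel := by
  obtain ⟨h1, h2⟩ := mem_ZZ.1 hz
  obtain ⟨w, hw, e⟩ := hl
  constructor
  · intro hb
    obtain ⟨u, v, hu1, hu2, hv1, hv2, ez⟩ := mem_BB.1 hb
    obtain ⟨y, a, ha, hy, ey, hk⟩ := S.kill_even (q := q + 1) (p := q + q + 2) (by ring)
      (by convert hu1 using 2; ring) (S.G.le_mono (by lia) hu2)
    have hdy : S.GN.π q (S.dN y) = S.dN y := S.dN_hom hy (by ring)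
    have hP := S.π_P _ _ _ _ hdy hdy
    have hD : S.D (u + S.Q y + S.D a) = S.D u + S.P (S.dN y) (S.dN y) := by
      rw [map_add, map_add, D_Q, D_D, add_zero]
    obtain ⟨b, hb, hk'⟩ := S.kill_odd hk (by
      rw [hD]
      exact add_mem (S.G.le_mono (by lia) hu2) (S.G.hom_le hP (by lia))) (by lia)
    have := S.π_D (q + q) (u + S.Q y + S.D a + S.D b)
    rw [map_add S.D, D_D, add_zero, hD, map_add, hP, hk' _ (by lia), map_zero, zero_add] at this
    have hu : S.G.π (q + q) (S.D u) = S.P x x + (w + S.τ w) := by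
      rw [← e, ez, map_add, hv1 _ (by lia), add_zero]
    rw [hu] at this
    generalize S.G.π (q + q) (u + S.Q y + S.D a + S.D b) = c at this
    refine ⟨y, hy, (S.T2 _).1 ⟨w + S.P x (S.dN y) + c, ?_⟩⟩
    rw [P_sq_add, map_add S.τ, map_add S.τ]
    linear_combination (norm := (match_scalars <;> decide)) (1 : ZMod 2) • this
  · rintro ⟨y, hy, hr⟩
    have hdy : S.GN.π q (S.dN y) = S.dN y := S.dN_hom hy (by ring)
    have hP := S.π_P _ _ _ _ hdy hdy
    obtain ⟨a, ha, ea⟩ := S.T2gr (q := q) (by rw [map_add, hx, hdy]) hr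
    rw [P_sq_add] at ea
    have hPx := S.π_P _ _ _ _ hx hdy
    have hbh : S.G.π (q + q) (a + w + S.P x (S.dN y)) = a + w + S.P x (S.dN y) := by
      rw [map_add, map_add, ha, hw, hPx]
    refine mem_BB.2 ⟨S.Q y + (a + w + S.P x (S.dN y)),
      z + S.D (S.Q y + (a + w + S.P x (S.dN y))), ?_, ?_, ?_, ?_, ?_⟩
    · exact add_mem (S.Q_le hy (by lia)) (S.G.hom_le hbh (by lia))
    · rw [map_add, D_Q]
      exact add_mem (S.G.hom_le hP le_rfl) (S.D_le (S.G.hom_le hbh le_rfl) le_rfl)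
    · refine S.G.le_pred (add_mem h1 ?_) ?_ rfl
      · rw [map_add, D_Q]
        exact add_mem (S.G.hom_le hP le_rfl) (S.D_le (S.G.hom_le hbh le_rfl) le_rfl)
      · rw [map_add S.D, D_Q, map_add, map_add, hP, e, π_D, S.G.pi_of_hom hbh, if_neg (by lia),
          hbh]
        simp only [map_add, map_zero]
        linear_combination (norm := (match_scalars <;> decide)) (1 : ZMod 2) • ea
    · rw [map_add, D_D, add_zero]; exact h2
    · linear_combination (norm := (match_scalars <;> decide)) (0 : ZMod 2) • (rfl : z = z)

end TC
end Tau

section TauHom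
namespace TC

theorem mem_ZZcol (S : TC) {p : ℤ} {x : S.C} :
    x ∈ ZZ S.G.col S.D 0 p ↔ x ∈ S.G.col p ∧ S.d (S.G.π (-p) x) = 0 := by
  rw [mem_ZZ, sub_zero]
  refine and_congr_right fun hx => ?_
  constructor
  · intro h
    have := h (-p - 1) (by lia)
    rw [π_D, hx (-p - 1) (by lia), sub_add_cancel] at this
    simpa using this
  · intro h i hi
    rw [π_D, hx i hi]
    rcases eq_or_ne (i + 1) (-p) with h' | h'
    · rw [h', h]; simp
    · rw [hx _ (by lia)]; simp

theorem mem_BBcol (S : TC) {p : ℤ} {x : S.C} (hx : x ∈ ZZ S.G.col S.D 0 p) :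
    x ∈ BB S.G.col S.D 0 p ↔ ∃ y, S.G.π (-p + 1) y = y ∧ S.G.π (-p) x = S.d y := by
  rw [mem_BB]
  constructor
  · rintro ⟨u, v, hu, -, hv, -, rfl⟩
    refine ⟨S.G.π (-p + 1) u, S.G.same _ _, ?_⟩
    rw [map_add, π_D, hv _ (by lia), hu (-p) (by lia)]
    simp
  · rintro ⟨y, hy, e⟩
    have hyc : y ∈ S.G.col (p - 1) := S.G.hom_col hy (by lia)
    have hDy : S.D y ∈ S.G.col p := by
      intro i hi
      rw [π_D, hyc _ (by lia), hyc _ (by lia)]; simp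
    refine ⟨y, x + S.D y, by convert hyc using 2; ring, hDy, ?_, ?_, ?_⟩
    · refine S.G.col_pred (add_mem hx.1 hDy) ?_ rfl
      rw [map_add, π_D, hy, hyc (-p) (by lia), e]
      simp [ZModModule.add_self]
    · rw [map_add, D_D, add_zero]; exact hx.2
    · linear_combination (norm := (match_scalars <;> decide)) (0 : ZMod 2) • (rfl : x = x)

/-- morphism of `TC` -/
structure Hom (S' S : TC) where
  f : S'.C →ₗ[ZMod 2] S.C
  fN : S'.N →ₗ[ZMod 2] S.N
  f_d : ∀ x, f (S'.d x) = S.d (f x)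
  f_τ : ∀ x, f (S'.τ x) = S.τ (f x)
  f_π : ∀ i x, f (S'.G.π i x) = S.G.π i (f x)
  fN_π : ∀ i x, fN (S'.GN.π i x) = S.GN.π i (fN x)
  f_P : ∀ x y, f (S'.P x y) = S.P (fN x) (fN y)

variable {S' S : TC} (f : Hom S' S)
namespace Hom

theorem f_D (x : S'.C) : f.f (S'.D x) = S.D (f.f x) := by
  simp only [D_apply, map_add, f.f_d, f.f_τ]

theorem f_le (p : ℤ) (x : S'.C) (hx : x ∈ S'.G.le p) : f.f x ∈ S.G.le p := by
  intro i hi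
  rw [← f.f_π, hx i hi, map_zero]

theorem f_col (p : ℤ) (x : S'.C) (hx : x ∈ S'.G.col p) : f.f x ∈ S.G.col p := by
  intro i hi
  rw [← f.f_π, hx i hi, map_zero]

theorem f_ZZle {r p : ℤ} {x : S'.C} (hx : x ∈ ZZ S'.G.le S'.D r p) :
    f.f x ∈ ZZ S.G.le S.D r p :=
  mem_ZZ.2 ⟨f.f_le _ _ hx.1, by rw [← f.f_D]; exact f.f_le _ _ hx.2⟩

theorem f_ZZcol {r p : ℤ} {x : S'.C} (hx : x ∈ ZZ S'.G.col S'.D r p) :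
    f.f x ∈ ZZ S.G.col S.D r p :=
  mem_ZZ.2 ⟨f.f_col _ _ hx.1, by rw [← f.f_D]; exact f.f_col _ _ hx.2⟩

theorem lead {q : ℤ} {z : S'.C} {x : S'.N} (h : S'.Lead q z x) : S.Lead q (f.f z) (f.fN x) := by
  obtain ⟨w, hw, e⟩ := h
  refine ⟨f.f w, by rw [← f.f_π, hw], ?_⟩
  rw [← f.f_π, e, map_add, map_add, f.f_P, f.f_τ]

theorem pageIso_le
    (hsurj : ∀ q x, S.GN.π q x = x → S.dN x ∈ S.rel → ∃ x' y, S'.GN.π q x' = x' ∧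
      S'.dN x' ∈ S'.rel ∧ S.GN.π (q + 1) y = y ∧ f.fN x' + x + S.dN y ∈ S.rel)
    (hinj : ∀ q x' y, S'.GN.π q x' = x' → S'.dN x' ∈ S'.rel → S.GN.π (q + 1) y = y →
      f.fN x' + S.dN y ∈ S.rel → ∃ y', S'.GN.π (q + 1) y' = y' ∧ x' + S'.dN y' ∈ S'.rel) :
    PageIso S'.G.le S'.D S.G.le S.D f.f 3 := by
  constructor
  · intro p x hx hfx
    by_cases hp : ∀ q, p ≠ q + q
    · exact S'.L4 hp hx
    push Not at hp
    obtain ⟨q, rfl⟩ := hp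
    obtain ⟨x', h1, h2, h3⟩ := S'.L1 hx
    have h1' : S.GN.π q (f.fN x') = f.fN x' := by rw [← f.fN_π, h1]
    obtain ⟨y, hy, hr⟩ := (S.L3 (f.f_ZZle hx) h1' (f.lead h3)).1 hfx
    exact (S'.L3 hx h1 h3).2 (hinj q x' y h1 h2 hy hr)
  · intro p y hy
    by_cases hp : ∀ q, p ≠ q + q
    · exact ⟨0, zero_mem _, by rw [map_zero, zero_sub]; exact neg_mem (S.L4 hp hy)⟩
    push Not at hp
    obtain ⟨q, rfl⟩ := hp
    obtain ⟨x, h1, h2, h3⟩ := S.L1 hy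
    obtain ⟨x', y2, h4, h5, h6, h7⟩ := hsurj q x h1 h2
    obtain ⟨z', hz', hl⟩ := S'.L2 h4 h5
    have h4' : S.GN.π q (f.fN x') = f.fN x' := by rw [← f.fN_π, h4]
    refine ⟨z', hz', ?_⟩
    rw [ZModModule.sub_eq_add]
    refine (S.L3 (add_mem (f.f_ZZle hz') hy) ?_ (Lead.add S (f.lead hl) h3 h4' h1)).2 ⟨y2, h6, h7⟩
    rw [map_add, h4', h1]

theorem pageIso_col
    (hsurj : ∀ q x, S.G.π q x = x → S.d x = 0 → ∃ x' y, S'.G.π q x' = x' ∧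
      S'.d x' = 0 ∧ S.G.π (q + 1) y = y ∧ f.f x' + x = S.d y)
    (hinj : ∀ q x' y, S'.G.π q x' = x' → S'.d x' = 0 → S.G.π (q + 1) y = y →
      f.f x' = S.d y → ∃ y', S'.G.π (q + 1) y' = y' ∧ x' = S'.d y') :
    PageIso S'.G.col S'.D S.G.col S.D f.f 0 := by
  constructor
  · intro p x hx hfx
    obtain ⟨y, hy, e⟩ := (S.mem_BBcol (f.f_ZZcol hx)).1 hfx
    rw [S'.mem_BBcol hx]
    rw [← f.f_π] at e
    exact hinj (-p) _ y (S'.G.same _ _) (S'.mem_ZZcol.1 hx).2 hy e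
  · intro p y hy
    obtain ⟨h1, h2⟩ := S.mem_ZZcol.1 hy
    obtain ⟨x', y2, h3, h4, h5, h6⟩ := hsurj (-p) _ (S.G.same _ _) h2
    have hx' : x' ∈ ZZ S'.G.col S'.D 0 p :=
      S'.mem_ZZcol.2 ⟨S'.G.hom_col h3 (by lia), by rw [h3, h4]⟩
    refine ⟨x', hx', ?_⟩
    rw [S.mem_BBcol (sub_mem (f.f_ZZcol hx') hy)]
    refine ⟨y2, h5, ?_⟩
    rw [← h6, map_sub, ← f.f_π, h3, ZModModule.sub_eq_add]

end Hom

theorem EE_le_HH (S : TC) (grN : ℤ → Submodule (ZMod 2) S.N)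
    (hgr : ∀ q x, x ∈ grN q ↔ S.GN.π q x = x) (hrel : ∀ x ∈ S.rel, S.dN x ∈ S.rel) (q : ℤ) :
    Nonempty (EE S.G.le S.D 3 (q + q) ≃ₗ[ZMod 2] Hgr S.N grN S.rel S.dN q) := by
  let Γ : Submodule (ZMod 2) (S.C × S.N) :=
    { carrier := {u | S.GN.π q u.2 = u.2 ∧ S.Lead q u.1 u.2}
      add_mem' := by
        rintro ⟨a, b⟩ ⟨a', b'⟩ ⟨h1, h2⟩ ⟨h3, h4⟩
        exact ⟨by simpa using congrArg₂ (· + ·) h1 h3, Lead.add S h2 h4 h1 h3⟩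
      zero_mem' := ⟨by simp, 0, by simp, by simp⟩
      smul_mem' := by
        rintro c ⟨a, b⟩ ⟨h1, h2⟩
        have hc : c = 0 ∨ c = 1 := by revert c; decide
        rcases hc with rfl | rfl
        · simp only [zero_smul]; exact ⟨by simp, 0, by simp, by simp⟩
        · simp only [one_smul]; exact ⟨h1, h2⟩ }
  refine corr (U := Γ) ((LinearMap.fst _ _ _).comp Γ.subtype) ((LinearMap.snd _ _ _).comp Γ.subtype)
    _ _ _ _ ?_ ?_ ?_
  · intro z hz
    obtain ⟨x, h1, h2, h3⟩ := S.L1 hz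
    refine ⟨⟨(z, x), h1, h3⟩, hz, ⟨?_, h2⟩, by simp⟩
    exact Submodule.mem_sup_left ((hgr _ _).2 h1)
  · rintro w ⟨hw1, hw2⟩
    obtain ⟨x, hx, n, hn, rfl⟩ := Submodule.mem_sup.1 hw1
    have hdx : S.dN x ∈ S.rel := by
      have : S.dN (x + n) ∈ S.rel := hw2
      rw [map_add] at this
      exact (Submodule.add_mem_iff_left _ (hrel n hn)).1 this
    have hx' := (hgr _ _).1 hx
    obtain ⟨z, hz, hl⟩ := S.L2 hx' hdx
    refine ⟨⟨(z, x), hx', hl⟩, hz, ⟨Submodule.mem_sup_left hx, hdx⟩, ?_⟩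
    refine Submodule.mem_sup_right ?_
    change x - (x + n) ∈ S.rel
    rw [sub_add_cancel_left]
    exact neg_mem hn
  · rintro ⟨⟨z, x⟩, hx, hl⟩ hz hw
    change z ∈ _ ↔ x ∈ _
    replace hz : z ∈ ZZ S.G.le S.D 3 (q + q) := hz
    rw [S.L3 hz hx hl]
    constructor
    · rintro ⟨y, hy, hr⟩
      refine Submodule.mem_sup.2 ⟨S.dN y, ⟨y, Submodule.mem_sup_left ((hgr _ _).2 hy), rfl⟩, _, hr, ?_⟩
      simp only
      linear_combination (norm := (match_scalars <;> decide)) (0 : ZMod 2) • (rfl : x = x)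
    · intro h
      obtain ⟨_, ⟨y, hy, rfl⟩, n, hn, e⟩ := Submodule.mem_sup.1 h
      obtain ⟨y1, hy1, n', hn', rfl⟩ := Submodule.mem_sup.1 hy
      refine ⟨y1, (hgr _ _).1 hy1, ?_⟩
      have : x + S.dN y1 = S.dN n' + n := by
        rw [map_add] at e
        linear_combination (norm := (match_scalars <;> decide)) (-1 : ZMod 2) • e
      rw [this]
      exact add_mem (hrel _ hn') hn

theorem EE_le_odd (S : TC) {p : ℤ} (hp : ∀ q, p ≠ q + q) : Subsingleton (EE S.G.le S.D 3 p) := by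
  refine (Submodule.Quotient.subsingleton_iff (p := _)).2 ?_
  rw [eq_top_iff]
  rintro ⟨x, hx⟩ -
  exact S.L4 hp hx

end TC
end TauHom

section Gradings

variable {V W : Type} [AddCommGroup V] [Module (ZMod 2) V] [AddCommGroup W] [Module (ZMod 2) W]

def HasDelta (gr : ℤ → Submodule (ZMod 2) V) : Prop :=
  ∃ δ : V →ₗ[ZMod 2] (ℤ →₀ V), ∀ i, ∀ x ∈ gr i, δ x = Finsupp.single i x

theorem iSup_ext {gr : ℤ → Submodule (ZMod 2) V} (ht : (⨆ i, gr i) = ⊤)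
    {f g : V →ₗ[ZMod 2] W} (h : ∀ i, ∀ x ∈ gr i, f x = g x) (x : V) : f x = g x := by
  have hx : x ∈ ⨆ i, gr i := ht ▸ Submodule.mem_top
  induction hx using Submodule.iSup_induction' with
  | mem i x hx => exact h i x hx
  | zero => simp
  | add x y _ _ hx hy => rw [map_add, map_add, hx, hy]

theorem Grd.exists_of (gr : ℤ → Submodule (ZMod 2) V) (hd : HasDelta gr) (ht : (⨆ i, gr i) = ⊤) :
    ∃ G : Grd V, ∀ i x, x ∈ gr i ↔ G.π i x = x := by
  obtain ⟨δ, hδ⟩ := hd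
  have key : ∀ i j, ∀ x ∈ gr j, δ x i = if i = j then x else 0 := by
    intro i j x hx
    rw [hδ j x hx, Finsupp.single_apply]
    simp only [eq_comm]
  let π : ℤ → V →ₗ[ZMod 2] V := fun i => (Finsupp.lapply i).comp δ
  have hπ : ∀ i x, π i x = δ x i := fun i x => rfl
  refine ⟨⟨π, ?_, ?_, ?_, ?_⟩, ?_⟩
  · intro i x
    refine iSup_ext ht (f := (π i).comp (π i)) (g := π i) (fun j x hx => ?_) x
    simp only [LinearMap.comp_apply, hπ, key i j x hx]
    split_ifs with h
    · rw [key i j x hx, if_pos h]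
    · simp
  · intro i j x hij
    refine iSup_ext ht (f := (π i).comp (π j)) (g := 0) (fun l x hx => ?_) x
    simp only [LinearMap.comp_apply, hπ, key j l x hx]
    split_ifs with h
    · rw [key i l x hx, if_neg (by lia)]; simp
    · simp
  · intro x
    refine (δ x).support.finite_toSet.subset ?_
    intro i hi
    simpa [hπ] using hi
  · intro x hx
    have h1 : (Finsupp.lsum (ZMod 2) (fun _ : ℤ => (LinearMap.id : V →ₗ[ZMod 2] V))) (δ x) = x := by
      refine iSup_ext ht (f := (Finsupp.lsum (ZMod 2)
        (fun _ : ℤ => (LinearMap.id : V →ₗ[ZMod 2] V))).comp δ) (g := LinearMap.id) (fun l x hx => ?_) x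
      simp [hδ l x hx]
    have h2 : δ x = 0 := by ext i; exact hx i
    rw [← h1, h2, map_zero]
  · intro i x
    constructor
    · intro hx
      change δ x i = x
      rw [key i i x hx, if_pos rfl]
    · intro hx
      rw [← hx]
      change π i x ∈ gr i
      have hmem : x ∈ ⨆ i, gr i := ht ▸ Submodule.mem_top
      clear hx
      induction hmem using Submodule.iSup_induction' with
      | mem j x hx =>
        rw [hπ, key i j x hx]
        split_ifs with h
        · rw [h]; exact hx
        · exact zero_mem _
      | zero => simp
      | add x y _ _ hx hy => rw [map_add]; exact add_mem hx hy

theorem Grd.comm (G : Grd V) (H : Grd W) (f : V →ₗ[ZMod 2] W) (s : ℤ)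
    (h : ∀ i x, G.π i x = x → H.π (i + s) (f x) = f x) (i : ℤ) (x : V) :
    H.π (i + s) (f x) = f (G.π i x) := by
  conv_lhs => rw [← G.sum_pi x, map_sum, map_sum]
  have : ∀ j, H.π (i + s) (f (G.π j x)) = f (G.π i (G.π j x)) := by
    intro j
    rw [H.pi_of_hom (h j _ (G.same _ _)), G.pi_of_hom (G.same j x)]
    by_cases hij : i = j
    · simp [hij]
    · rw [if_neg (by lia), if_neg hij, map_zero]
  simp only [this]
  rw [← map_sum, ← map_sum, G.sum_pi]

/-- quotient grading -/
def Grd.quot (G : Grd V) (N : Submodule (ZMod 2) V) (hN : ∀ i, ∀ x ∈ N, G.π i x ∈ N) :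
    Grd (V ⧸ N) where
  π i := Submodule.mapQ N N (G.π i) (fun x hx => hN i x hx)
  same i x := by
    obtain ⟨x, rfl⟩ := Submodule.mkQ_surjective N x
    simp [G.same]
  ne i j x h := by
    obtain ⟨x, rfl⟩ := Submodule.mkQ_surjective N x
    simp [G.ne i j x h]
  fin x := by
    obtain ⟨x, rfl⟩ := Submodule.mkQ_surjective N x
    refine (G.fin x).subset ?_
    intro i hi h
    apply hi
    simp [h]
  sep x hx := by
    obtain ⟨x, rfl⟩ := Submodule.mkQ_surjective N x
    simp only [Submodule.mkQ_apply, Submodule.mapQ_apply, Submodule.Quotient.mk_eq_zero] at hx ⊢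
    rw [← G.sum_pi x]
    exact sum_mem fun i _ => hx i

theorem Grd.quot_pi (G : Grd V) (N : Submodule (ZMod 2) V) (hN : ∀ i, ∀ x ∈ N, G.π i x ∈ N)
    (i : ℤ) (x : V) : (G.quot N hN).π i (N.mkQ x) = N.mkQ (G.π i x) := rfl

theorem Grd.homog (G : Grd V) (gr : ℤ → Submodule (ZMod 2) V) (hG : ∀ i x, x ∈ gr i ↔ G.π i x = x)
    (N : Submodule (ZMod 2) V) (h : N ≤ ⨆ i, gr i ⊓ N) : ∀ i, ∀ x ∈ N, G.π i x ∈ N := by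
  intro i x hx
  have hmem := h hx
  clear hx
  induction hmem using Submodule.iSup_induction' with
  | mem j x hx =>
    rw [G.pi_of_hom ((hG _ _).1 hx.1)]
    split_ifs with h
    · exact hx.2
    · exact zero_mem _
  | zero => simp
  | add x y _ _ hx hy => rw [map_add]; exact add_mem hx hy

def grT (gV : ℤ → Submodule (ZMod 2) V) (gW : ℤ → Submodule (ZMod 2) W) (n : ℤ) :
    Submodule (ZMod 2) (V ⊗[ZMod 2] W) :=
  Submodule.span (ZMod 2) {z | ∃ i j, ∃ r ∈ gV i, ∃ m ∈ gW j, i + j = n ∧ z = r ⊗ₜ[ZMod 2] m}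

theorem HasDelta.span {gr : ℤ → Set V} {δ : V →ₗ[ZMod 2] (ℤ →₀ V)}
    (h : ∀ i, ∀ x ∈ gr i, δ x = Finsupp.single i x) (i : ℤ) (x : V)
    (hx : x ∈ Submodule.span (ZMod 2) (gr i)) : δ x = Finsupp.single i x := by
  induction hx using Submodule.span_induction with
  | mem x hx => exact h i x hx
  | zero => simp
  | add x y _ _ hx hy => rw [map_add, hx, hy, Finsupp.single_add]
  | smul c x _ hx => rw [map_smul, hx, Finsupp.smul_single]

theorem HasDelta.tens {gV : ℤ → Submodule (ZMod 2) V} {gW : ℤ → Submodule (ZMod 2) W}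
    (hV : HasDelta gV) (hW : HasDelta gW) : HasDelta (grT gV gW) := by
  obtain ⟨δ, hδ⟩ := hV
  obtain ⟨ε, hε⟩ := hW
  refine ⟨(Finsupp.lmapDomain _ (ZMod 2) (fun x : ℤ × ℤ => x.1 + x.2)).comp
    ((finsuppTensorFinsupp (ZMod 2) (ZMod 2) V W ℤ ℤ).toLinearMap.comp
      (TensorProduct.map δ ε)), HasDelta.span ?_⟩
  rintro n _ ⟨i, j, r, hr, m, hm, rfl, rfl⟩
  simp [hδ i r hr, hε j m hm, finsuppTensorFinsupp_single]

theorem grT_tmul {gV : ℤ → Submodule (ZMod 2) V} {gW : ℤ → Submodule (ZMod 2) W} {i j n : ℤ}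
    {x : V} {y : W} (hx : x ∈ gV i) (hy : y ∈ gW j) (h : i + j = n) :
    x ⊗ₜ[ZMod 2] y ∈ grT gV gW n :=
  Submodule.subset_span ⟨i, j, x, hx, y, hy, h, rfl⟩

theorem grT_top {gV : ℤ → Submodule (ZMod 2) V} {gW : ℤ → Submodule (ZMod 2) W}
    (hV : (⨆ i, gV i) = ⊤) (hW : (⨆ i, gW i) = ⊤) : (⨆ i, grT gV gW i) = ⊤ := by
  rw [eq_top_iff]
  rintro z -
  induction z using TensorProduct.induction_on with
  | zero => exact zero_mem _
  | add x y hx hy => exact add_mem hx hy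
  | tmul x y =>
    have hx : x ∈ ⨆ i, gV i := hV ▸ Submodule.mem_top
    have hy : y ∈ ⨆ i, gW i := hW ▸ Submodule.mem_top
    induction hx using Submodule.iSup_induction' with
    | zero => rw [TensorProduct.zero_tmul]; exact zero_mem _
    | add x x' _ _ hx hx' => rw [TensorProduct.add_tmul]; exact add_mem hx hx'
    | mem i x hx =>
      induction hy using Submodule.iSup_induction' with
      | zero => rw [TensorProduct.tmul_zero]; exact zero_mem _
      | add x x' _ _ hx hx' => rw [TensorProduct.tmul_add]; exact add_mem hx hx'
      | mem j y hy => exact Submodule.mem_iSup_of_mem (i + j) (grT_tmul hx hy rfl)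

theorem HasDelta.internal {gr : ℤ → Submodule (ZMod 2) V} (h : DirectSum.IsInternal gr) :
    HasDelta gr := by
  let e := LinearEquiv.ofBijective (DirectSum.coeLinearMap gr) h
  refine ⟨(DirectSum.toModule (ZMod 2) ℤ (ℤ →₀ V)
    (fun i => (Finsupp.lsingle i).comp (gr i).subtype)).comp e.symm.toLinearMap, fun i x hx => ?_⟩
  have : e.symm x = DirectSum.lof (ZMod 2) ℤ (fun i => gr i) i ⟨x, hx⟩ := by
    rw [LinearEquiv.symm_apply_eq]
    exact (DirectSum.coeLinearMap_lof gr i ⟨x, hx⟩).symm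
  rw [LinearMap.comp_apply, LinearEquiv.coe_coe, this, DirectSum.toModule_lof]
  rfl

variable {A : DGA (ZMod 2)} (X R M : DGBimod A)

theorem DGBimod.top : (⨆ i, X.gr i) = ⊤ := X.internal.submodule_iSup_eq_top

theorem DGA.top : (⨆ i, A.gr i) = ⊤ := A.internal.submodule_iSup_eq_top

/-- grading of a bimodule -/
def GB : Grd X.V := Classical.choose (Grd.exists_of X.gr (HasDelta.internal X.internal) X.top)
theorem mem_GB {i : ℤ} {x : X.V} : x ∈ X.gr i ↔ (GB X).π i x = x :=
  Classical.choose_spec (Grd.exists_of X.gr (HasDelta.internal X.internal) X.top) i x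

theorem gr2_eq : gr2 R M = grT R.gr M.gr := rfl

theorem G2_exists : ∃ G : Grd (T2 R M), ∀ i x, x ∈ gr2 R M i ↔ G.π i x = x :=
  Grd.exists_of _ (HasDelta.tens (HasDelta.internal R.internal) (HasDelta.internal M.internal))
    (grT_top R.top M.top)

def G2 : Grd (T2 R M) := Classical.choose (G2_exists R M)
theorem mem_G2 {i : ℤ} {x : T2 R M} : x ∈ gr2 R M i ↔ (G2 R M).π i x = x :=
  Classical.choose_spec (G2_exists R M) i x

theorem gr4_le (n : ℤ) : gr4 R M n ≤ grT R.gr (grT M.gr (grT R.gr M.gr)) n := by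
  refine Submodule.span_le.2 ?_
  rintro _ ⟨i, j, i', j', r, hr, m, hm, r', hr', m', hm', h, rfl⟩
  exact grT_tmul hr (grT_tmul hm (grT_tmul hr' hm' rfl) rfl) (by lia)

theorem mem_gr4 {i j i' j' n : ℤ} {r : R.V} (hr : r ∈ R.gr i) {m : M.V} (hm : m ∈ M.gr j)
    {r' : R.V} (hr' : r' ∈ R.gr i') {m' : M.V} (hm' : m' ∈ M.gr j') (h : i + j + i' + j' = n) :
    r ⊗ₜ[ZMod 2] (m ⊗ₜ[ZMod 2] (r' ⊗ₜ[ZMod 2] m')) ∈ gr4 R M n :=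
  Submodule.subset_span ⟨i, j, i', j', r, hr, m, hm, r', hr', m', hm', h, rfl⟩

/-- induction on homogeneous elements -/
theorem DGBimod.hind {p : X.V → Prop} (h1 : ∀ i, ∀ x ∈ X.gr i, p x) (h0 : p 0)
    (ha : ∀ x y, p x → p y → p (x + y)) (x : X.V) : p x :=
  Submodule.iSup_induction X.gr (motive := p) (X.top ▸ Submodule.mem_top : x ∈ ⨆ i, X.gr i) h1 h0 ha

theorem DGA.hind {p : A.V → Prop} (h1 : ∀ i, ∀ x ∈ A.gr i, p x) (h0 : p 0)
    (ha : ∀ x y, p x → p y → p (x + y)) (x : A.V) : p x :=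
  Submodule.iSup_induction A.gr (motive := p) (A.top ▸ Submodule.mem_top : x ∈ ⨆ i, A.gr i) h1 h0 ha

theorem gr4_top : (⨆ i, gr4 R M i) = ⊤ := by
  rw [eq_top_iff]
  rintro z -
  induction z using TensorProduct.induction_on with
  | zero => exact zero_mem _
  | add x y hx hy => exact add_mem hx hy
  | tmul r z =>
    induction z using TensorProduct.induction_on with
    | zero => rw [TensorProduct.tmul_zero]; exact zero_mem _
    | add x y hx hy => rw [TensorProduct.tmul_add]; exact add_mem hx hy
    | tmul m z =>
      induction z using TensorProduct.induction_on with
      | zero => rw [TensorProduct.tmul_zero, TensorProduct.tmul_zero]; exact zero_mem _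
      | add x y hx hy => rw [TensorProduct.tmul_add, TensorProduct.tmul_add]; exact add_mem hx hy
      | tmul r' m' =>
        induction r using R.hind with
        | h0 => simp
        | ha x y hx hy => simp only [TensorProduct.add_tmul]; exact add_mem hx hy
        | h1 i r hr =>
        induction m using M.hind with
        | h0 => simp
        | ha x y hx hy => simp only [TensorProduct.add_tmul, TensorProduct.tmul_add]; exact add_mem hx hy
        | h1 j m hm =>
        induction r' using R.hind with
        | h0 => simp
        | ha x y hx hy => simp only [TensorProduct.add_tmul, TensorProduct.tmul_add]; exact add_mem hx hy
        | h1 i' r' hr' =>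
        induction m' using M.hind with
        | h0 => simp
        | ha x y hx hy => simp only [TensorProduct.tmul_add]; exact add_mem hx hy
        | h1 j' m' hm' => exact Submodule.mem_iSup_of_mem _ (mem_gr4 R M hr hm hr' hm' rfl)

theorem G4_exists : ∃ G : Grd (T4 R M), ∀ i x, x ∈ gr4 R M i ↔ G.π i x = x := by
  refine Grd.exists_of _ ?_ (gr4_top R M)
  obtain ⟨δ, hδ⟩ := HasDelta.tens (HasDelta.internal R.internal) (HasDelta.tens
    (HasDelta.internal M.internal) (HasDelta.tens (HasDelta.internal R.internal)
      (HasDelta.internal M.internal)))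
  exact ⟨δ, fun i x hx => hδ i x (gr4_le R M i hx)⟩

def G4 : Grd (T4 R M) := Classical.choose (G4_exists R M)
theorem mem_G4 {i : ℤ} {x : T4 R M} : x ∈ gr4 R M i ↔ (G4 R M).π i x = x :=
  Classical.choose_spec (G4_exists R M) i x

theorem rel2_hom : ∀ i, ∀ x ∈ rel2 R M, (G2 R M).π i x ∈ rel2 R M := by
  refine Grd.homog _ (gr2 R M) (fun i x => mem_G2 R M) _ ?_
  refine Submodule.span_le.2 ?_
  rintro _ (⟨r, a, m, rfl⟩ | ⟨r, a, m, rfl⟩) <;> rw [SetLike.mem_coe]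
  · induction r using R.hind with
    | h0 => simp
    | ha x y hx hy => convert add_mem hx hy using 1; simp [TensorProduct.add_tmul]; abel
    | h1 i r hr =>
    induction a using DGA.hind with
    | h0 => simp
    | ha x y hx hy =>
      convert add_mem hx hy using 1; simp [TensorProduct.add_tmul, TensorProduct.tmul_add]; abel
    | h1 j a ha =>
    induction m using M.hind with
    | h0 => simp
    | ha x y hx hy => convert add_mem hx hy using 1; simp [TensorProduct.tmul_add]; abel
    | h1 l m hm =>
    refine Submodule.mem_iSup_of_mem (i + j + l) ⟨add_mem ?_ ?_, ?_⟩
    · exact grT_tmul (R.actR_gr _ _ _ hr _ ha) hm rfl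
    · exact grT_tmul hr (M.actL_gr _ _ _ ha _ hm) (by ring)
    · exact Submodule.subset_span (Or.inl ⟨r, a, m, rfl⟩)
  · induction r using R.hind with
    | h0 => simp
    | ha x y hx hy => convert add_mem hx hy using 1; simp [TensorProduct.add_tmul]; abel
    | h1 i r hr =>
    induction a using DGA.hind with
    | h0 => simp
    | ha x y hx hy =>
      convert add_mem hx hy using 1; simp [TensorProduct.add_tmul, TensorProduct.tmul_add]; abel
    | h1 j a ha =>
    induction m using M.hind with
    | h0 => simp
    | ha x y hx hy => convert add_mem hx hy using 1; simp [TensorProduct.tmul_add]; abel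
    | h1 l m hm =>
    refine Submodule.mem_iSup_of_mem (i + j + l) ⟨add_mem ?_ ?_, ?_⟩
    · exact grT_tmul (R.actL_gr _ _ _ ha _ hr) hm (by ring)
    · exact grT_tmul hr (M.actR_gr _ _ _ hm _ ha) (by ring)
    · exact Submodule.subset_span (Or.inr ⟨r, a, m, rfl⟩)

/-- induction over five homogeneous variables -/
theorem hind5 {R M : DGBimod A} {U : Type} [AddCommGroup U] [Module (ZMod 2) U]
    (g : R.V → A.V → M.V → R.V → M.V → U)
    (g1 : ∀ x y a m r' m', g (x + y) a m r' m' = g x a m r' m' + g y a m r' m')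
    (g2 : ∀ r x y m r' m', g r (x + y) m r' m' = g r x m r' m' + g r y m r' m')
    (g3 : ∀ r a x y r' m', g r a (x + y) r' m' = g r a x r' m' + g r a y r' m')
    (g4 : ∀ r a m x y m', g r a m (x + y) m' = g r a m x m' + g r a m y m')
    (g5 : ∀ r a m r' x y, g r a m r' (x + y) = g r a m r' x + g r a m r' y)
    (K : Submodule (ZMod 2) U)
    (h : ∀ i₁ i₂ i₃ i₄ i₅, ∀ r ∈ R.gr i₁, ∀ a ∈ A.gr i₂, ∀ m ∈ M.gr i₃, ∀ r' ∈ R.gr i₄,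
      ∀ m' ∈ M.gr i₅, g r a m r' m' ∈ K) (r a m r' m') : g r a m r' m' ∈ K := by
  induction r using R.hind with
  | h0 => have := g1 0 0 a m r' m'; rw [add_zero, left_eq_add] at this; rw [this]; exact zero_mem _
  | ha x y hx hy => rw [g1]; exact add_mem hx hy
  | h1 i₁ r hr =>
  induction a using DGA.hind with
  | h0 => have := g2 r 0 0 m r' m'; rw [add_zero, left_eq_add] at this; rw [this]; exact zero_mem _
  | ha x y hx hy => rw [g2]; exact add_mem hx hy
  | h1 i₂ a ha =>
  induction m using M.hind with
  | h0 => have := g3 r a 0 0 r' m'; rw [add_zero, left_eq_add] at this; rw [this]; exact zero_mem _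
  | ha x y hx hy => rw [g3]; exact add_mem hx hy
  | h1 i₃ m hm =>
  induction r' using R.hind with
  | h0 => have := g4 r a m 0 0 m'; rw [add_zero, left_eq_add] at this; rw [this]; exact zero_mem _
  | ha x y hx hy => rw [g4]; exact add_mem hx hy
  | h1 i₄ r' hr' =>
  induction m' using M.hind with
  | h0 => have := g5 r a m r' 0 0; rw [add_zero, left_eq_add] at this; rw [this]; exact zero_mem _
  | ha x y hx hy => rw [g5]; exact add_mem hx hy
  | h1 i₅ m' hm' => exact h _ _ _ _ _ _ hr _ ha _ hm _ hr' _ hm'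

theorem rel4_hom : ∀ i, ∀ x ∈ rel4 R M, (G4 R M).π i x ∈ rel4 R M := by
  refine Grd.homog _ (gr4 R M) (fun i x => mem_G4 R M) _ ?_
  refine Submodule.span_le.2 ?_
  rintro _ (((⟨r, a, m, r', m', rfl⟩ | ⟨r, a, m, r', m', rfl⟩) | ⟨r, a, m, r', m', rfl⟩) |
    ⟨r, a, m, r', m', rfl⟩) <;> rw [SetLike.mem_coe]
  · refine hind5 (fun r a m r' m' => (R.actR r a) ⊗ₜ[ZMod 2] (m ⊗ₜ[ZMod 2] (r' ⊗ₜ[ZMod 2] m')) +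
        r ⊗ₜ[ZMod 2] ((M.actL a m) ⊗ₜ[ZMod 2] (r' ⊗ₜ[ZMod 2] m'))) ?_ ?_ ?_ ?_ ?_ _ ?_ r a m r' m'
    iterate 5 intros; simp only [map_add, LinearMap.add_apply, add_tmul, tmul_add]; abel
    intro i₁ i₂ i₃ i₄ i₅ r hr a ha m hm r' hr' m' hm'
    refine Submodule.mem_iSup_of_mem (i₁ + i₂ + i₃ + i₄ + i₅) ⟨add_mem ?_ ?_, ?_⟩
    · exact mem_gr4 R M (R.actR_gr _ _ _ hr _ ha) hm hr' hm' rfl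
    · exact mem_gr4 R M hr (M.actL_gr _ _ _ ha _ hm) hr' hm' (by ring)
    · exact Submodule.subset_span (Or.inl (Or.inl (Or.inl ⟨r, a, m, r', m', rfl⟩)))
  · refine hind5 (fun r a m r' m' => (R.actL a r) ⊗ₜ[ZMod 2] (m ⊗ₜ[ZMod 2] (r' ⊗ₜ[ZMod 2] m')) +
        r ⊗ₜ[ZMod 2] (m ⊗ₜ[ZMod 2] (r' ⊗ₜ[ZMod 2] (M.actR m' a)))) ?_ ?_ ?_ ?_ ?_ _ ?_ r a m r' m'
    iterate 5 intros; simp only [map_add, LinearMap.add_apply, add_tmul, tmul_add]; abel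
    intro i₁ i₂ i₃ i₄ i₅ r hr a ha m hm r' hr' m' hm'
    refine Submodule.mem_iSup_of_mem (i₁ + i₂ + i₃ + i₄ + i₅) ⟨add_mem ?_ ?_, ?_⟩
    · exact mem_gr4 R M (R.actL_gr _ _ _ ha _ hr) hm hr' hm' (by ring)
    · exact mem_gr4 R M hr hm hr' (M.actR_gr _ _ _ hm' _ ha) (by ring)
    · exact Submodule.subset_span (Or.inl (Or.inl (Or.inr ⟨r, a, m, r', m', rfl⟩)))
  · refine hind5 (fun r a m r' m' => r ⊗ₜ[ZMod 2] ((M.actR m a) ⊗ₜ[ZMod 2] (r' ⊗ₜ[ZMod 2] m')) +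
        r ⊗ₜ[ZMod 2] (m ⊗ₜ[ZMod 2] ((R.actL a r') ⊗ₜ[ZMod 2] m'))) ?_ ?_ ?_ ?_ ?_ _ ?_ r a m r' m'
    iterate 5 intros; simp only [map_add, LinearMap.add_apply, add_tmul, tmul_add]; abel
    intro i₁ i₂ i₃ i₄ i₅ r hr a ha m hm r' hr' m' hm'
    refine Submodule.mem_iSup_of_mem (i₁ + i₂ + i₃ + i₄ + i₅) ⟨add_mem ?_ ?_, ?_⟩
    · exact mem_gr4 R M hr (M.actR_gr _ _ _ hm _ ha) hr' hm' (by ring)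
    · exact mem_gr4 R M hr hm (R.actL_gr _ _ _ ha _ hr') hm' (by ring)
    · exact Submodule.subset_span (Or.inl (Or.inr ⟨r, a, m, r', m', rfl⟩))
  · refine hind5 (fun r a m r' m' => r ⊗ₜ[ZMod 2] (m ⊗ₜ[ZMod 2] ((R.actR r' a) ⊗ₜ[ZMod 2] m')) +
        r ⊗ₜ[ZMod 2] (m ⊗ₜ[ZMod 2] (r' ⊗ₜ[ZMod 2] (M.actL a m')))) ?_ ?_ ?_ ?_ ?_ _ ?_ r a m r' m'
    iterate 5 intros; simp only [map_add, LinearMap.add_apply, add_tmul, tmul_add]; abel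
    intro i₁ i₂ i₃ i₄ i₅ r hr a ha m hm r' hr' m' hm'
    refine Submodule.mem_iSup_of_mem (i₁ + i₂ + i₃ + i₄ + i₅) ⟨add_mem ?_ ?_, ?_⟩
    · exact mem_gr4 R M hr hm (R.actR_gr _ _ _ hr' _ ha) hm' (by ring)
    · exact mem_gr4 R M hr hm hr' (M.actL_gr _ _ _ ha _ hm') (by ring)
    · exact Submodule.subset_span (Or.inr ⟨r, a, m, r', m', rfl⟩)

/-- the grading on the quotient -/
def GC : Grd (HCQ4 R M) := (G4 R M).quot (rel4 R M) (rel4_hom R M)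

end Gradings

section BuildTC

variable {A : DGA (ZMod 2)}

theorem sgn_smul {V : Type} [AddCommGroup V] [Module (ZMod 2) V] (i : ℤ) (x : V) :
    (Int.negOnePow i : ℤ) • x = x := by
  rcases Int.even_or_odd i with h | h
  · rw [Int.negOnePow_even i h]; simp
  · rw [Int.negOnePow_odd i h]
    simp [ZModModule.neg_eq_self]

theorem dL (X : DGBimod A) (a : A.V) (m : X.V) :
    X.d (X.actL a m) = X.actL (A.d a) m + X.actL a (X.d m) := by
  induction a using DGA.hind with
  | h0 => simp
  | ha x y hx hy => simp only [map_add, LinearMap.add_apply, hx, hy]; abel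
  | h1 i a ha => rw [X.leibnizL i a ha, sgn_smul]

theorem dR (X : DGBimod A) (m : X.V) (a : A.V) :
    X.d (X.actR m a) = X.actR (X.d m) a + X.actR m (A.d a) := by
  induction m using X.hind with
  | h0 => simp
  | ha x y hx hy => simp only [map_add, LinearMap.add_apply, hx, hy]; abel
  | h1 i m hm => rw [X.leibnizR i m hm, sgn_smul]

variable (R M : DGBimod A)

theorem d2_tmul (r : R.V) (m : M.V) :
    d2 R M (r ⊗ₜ m) = R.d r ⊗ₜ m + r ⊗ₜ M.d m := by
  simp [d2]

theorem d4_tmul (r : R.V) (m : M.V) (r' : R.V) (m' : M.V) :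
    d4 R M (r ⊗ₜ (m ⊗ₜ (r' ⊗ₜ m'))) = R.d r ⊗ₜ (m ⊗ₜ (r' ⊗ₜ m')) + r ⊗ₜ (M.d m ⊗ₜ (r' ⊗ₜ m')) +
      r ⊗ₜ (m ⊗ₜ (R.d r' ⊗ₜ m')) + r ⊗ₜ (m ⊗ₜ (r' ⊗ₜ M.d m')) := by
  simp [d4, tmul_add, add_assoc]

theorem tau4_tmul (r : R.V) (m : M.V) (r' : R.V) (m' : M.V) :
    tau4 R M (r ⊗ₜ (m ⊗ₜ (r' ⊗ₜ m'))) = r' ⊗ₜ (m' ⊗ₜ (r ⊗ₜ m)) := by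
  simp [tau4]

theorem T4ext {W : Type} [AddCommGroup W] [Module (ZMod 2) W] {f g : T4 R M →ₗ[ZMod 2] W}
    (h : ∀ r m r' m', f (r ⊗ₜ (m ⊗ₜ (r' ⊗ₜ m'))) = g (r ⊗ₜ (m ⊗ₜ (r' ⊗ₜ m')))) (x : T4 R M) :
    f x = g x := by
  have : f = g := by
    ext r m r' m'
    exact h r m r' m'
  rw [this]

theorem T2ext {W : Type} [AddCommGroup W] [Module (ZMod 2) W] {f g : T2 R M →ₗ[ZMod 2] W}
    (h : ∀ r m, f (r ⊗ₜ m) = g (r ⊗ₜ m)) (x : T2 R M) :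
    f x = g x := by
  have : f = g := by
    ext r m
    exact h r m
  rw [this]

theorem d2_d2 (x : T2 R M) : d2 R M (d2 R M x) = 0 := by
  refine T2ext R M (f := (d2 R M).comp (d2 R M)) (g := 0) (fun r m => ?_) x
  simp only [LinearMap.comp_apply, d2_tmul, map_add, R.d_d, M.d_d, zero_tmul, tmul_zero,
    LinearMap.zero_apply]
  rw [zero_add, add_zero, ZModModule.add_self]

theorem d4_d4 (x : T4 R M) : d4 R M (d4 R M x) = 0 := by
  refine T4ext R M (f := (d4 R M).comp (d4 R M)) (g := 0) (fun r m r' m' => ?_) x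
  simp only [LinearMap.comp_apply, d4_tmul, map_add, R.d_d, M.d_d, zero_tmul, tmul_zero,
    LinearMap.zero_apply]
  linear_combination (norm := (match_scalars <;> decide)) (0 : ZMod 2) •
    (rfl : r ⊗ₜ[ZMod 2] (m ⊗ₜ[ZMod 2] (r' ⊗ₜ[ZMod 2] m')) = r ⊗ₜ (m ⊗ₜ (r' ⊗ₜ m')))

theorem tau4_tau4 (x : T4 R M) : tau4 R M (tau4 R M x) = x := by
  refine T4ext R M (f := (tau4 R M).comp (tau4 R M)) (g := LinearMap.id) (fun r m r' m' => ?_) x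
  simp only [LinearMap.comp_apply, tau4_tmul, LinearMap.id_apply]

theorem d4_tau4 (x : T4 R M) : d4 R M (tau4 R M x) = tau4 R M (d4 R M x) := by
  refine T4ext R M (f := (d4 R M).comp (tau4 R M)) (g := (tau4 R M).comp (d4 R M))
    (fun r m r' m' => ?_) x
  simp only [LinearMap.comp_apply, tau4_tmul, d4_tmul, map_add]
  abel

theorem d2_rel (x : T2 R M) (hx : x ∈ rel2 R M) : d2 R M x ∈ rel2 R M := by
  have g1 : ∀ r a m, (R.actR r a) ⊗ₜ[ZMod 2] m + r ⊗ₜ[ZMod 2] (M.actL a m) ∈ rel2 R M :=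
    fun r a m => Submodule.subset_span (Or.inl ⟨r, a, m, rfl⟩)
  have g2 : ∀ r a m, (R.actL a r) ⊗ₜ[ZMod 2] m + r ⊗ₜ[ZMod 2] (M.actR m a) ∈ rel2 R M :=
    fun r a m => Submodule.subset_span (Or.inr ⟨r, a, m, rfl⟩)
  refine (Submodule.span_le.2 ?_ : rel2 R M ≤ (rel2 R M).comap (d2 R M)) hx
  rintro _ (⟨r, a, m, rfl⟩ | ⟨r, a, m, rfl⟩) <;> rw [SetLike.mem_coe, Submodule.mem_comap]
  · convert add_mem (add_mem (g1 (R.d r) a m) (g1 r (A.d a) m)) (g1 r a (M.d m)) using 1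
    simp only [map_add, d2_tmul, dL, dR, add_tmul, tmul_add]
    abel
  · convert add_mem (add_mem (g2 (R.d r) a m) (g2 r (A.d a) m)) (g2 r a (M.d m)) using 1
    simp only [map_add, d2_tmul, dL, dR, add_tmul, tmul_add]
    abel

theorem gen1 (r a m r' m') : (R.actR r a) ⊗ₜ[ZMod 2] (m ⊗ₜ[ZMod 2] (r' ⊗ₜ[ZMod 2] m')) +
        r ⊗ₜ[ZMod 2] ((M.actL a m) ⊗ₜ[ZMod 2] (r' ⊗ₜ[ZMod 2] m')) ∈ rel4 R M :=
  Submodule.subset_span (Or.inl (Or.inl (Or.inl ⟨r, a, m, r', m', rfl⟩)))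
theorem gen2 (r a m r' m') : (R.actL a r) ⊗ₜ[ZMod 2] (m ⊗ₜ[ZMod 2] (r' ⊗ₜ[ZMod 2] m')) +
        r ⊗ₜ[ZMod 2] (m ⊗ₜ[ZMod 2] (r' ⊗ₜ[ZMod 2] (M.actR m' a))) ∈ rel4 R M :=
  Submodule.subset_span (Or.inl (Or.inl (Or.inr ⟨r, a, m, r', m', rfl⟩)))
theorem gen3 (r a m r' m') : r ⊗ₜ[ZMod 2] ((M.actR m a) ⊗ₜ[ZMod 2] (r' ⊗ₜ[ZMod 2] m')) +
        r ⊗ₜ[ZMod 2] (m ⊗ₜ[ZMod 2] ((R.actL a r') ⊗ₜ[ZMod 2] m')) ∈ rel4 R M :=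
  Submodule.subset_span (Or.inl (Or.inr ⟨r, a, m, r', m', rfl⟩))
theorem gen4 (r a m r' m') : r ⊗ₜ[ZMod 2] (m ⊗ₜ[ZMod 2] ((R.actR r' a) ⊗ₜ[ZMod 2] m')) +
        r ⊗ₜ[ZMod 2] (m ⊗ₜ[ZMod 2] (r' ⊗ₜ[ZMod 2] (M.actL a m'))) ∈ rel4 R M :=
  Submodule.subset_span (Or.inr ⟨r, a, m, r', m', rfl⟩)

/-- a map sends `rel4` to `K` if it does so on generators -/
theorem rel4_map {W : Type} [AddCommGroup W] [Module (ZMod 2) W] (f : T4 R M →ₗ[ZMod 2] W)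
    (K : Submodule (ZMod 2) W)
    (h1 : ∀ r a m r' m', f ((R.actR r a) ⊗ₜ[ZMod 2] (m ⊗ₜ[ZMod 2] (r' ⊗ₜ[ZMod 2] m')) +
        r ⊗ₜ[ZMod 2] ((M.actL a m) ⊗ₜ[ZMod 2] (r' ⊗ₜ[ZMod 2] m'))) ∈ K)
    (h2 : ∀ r a m r' m', f ((R.actL a r) ⊗ₜ[ZMod 2] (m ⊗ₜ[ZMod 2] (r' ⊗ₜ[ZMod 2] m')) +
        r ⊗ₜ[ZMod 2] (m ⊗ₜ[ZMod 2] (r' ⊗ₜ[ZMod 2] (M.actR m' a)))) ∈ K)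
    (h3 : ∀ r a m r' m', f (r ⊗ₜ[ZMod 2] ((M.actR m a) ⊗ₜ[ZMod 2] (r' ⊗ₜ[ZMod 2] m')) +
        r ⊗ₜ[ZMod 2] (m ⊗ₜ[ZMod 2] ((R.actL a r') ⊗ₜ[ZMod 2] m'))) ∈ K)
    (h4 : ∀ r a m r' m', f (r ⊗ₜ[ZMod 2] (m ⊗ₜ[ZMod 2] ((R.actR r' a) ⊗ₜ[ZMod 2] m')) +
        r ⊗ₜ[ZMod 2] (m ⊗ₜ[ZMod 2] (r' ⊗ₜ[ZMod 2] (M.actL a m')))) ∈ K)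
    (x : T4 R M) (hx : x ∈ rel4 R M) : f x ∈ K := by
  refine (Submodule.span_le.2 ?_ : rel4 R M ≤ K.comap f) hx
  rintro _ (((⟨r, a, m, r', m', rfl⟩ | ⟨r, a, m, r', m', rfl⟩) | ⟨r, a, m, r', m', rfl⟩) |
    ⟨r, a, m, r', m', rfl⟩) <;> rw [SetLike.mem_coe, Submodule.mem_comap]
  · exact h1 _ _ _ _ _
  · exact h2 _ _ _ _ _
  · exact h3 _ _ _ _ _
  · exact h4 _ _ _ _ _

theorem d4_rel (x : T4 R M) (hx : x ∈ rel4 R M) : d4 R M x ∈ rel4 R M := by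
  refine rel4_map R M (d4 R M) _ ?_ ?_ ?_ ?_ x hx <;> intro r a m r' m'
  · convert add_mem (add_mem (add_mem (add_mem (gen1 R M (R.d r) a m r' m')
      (gen1 R M r (A.d a) m r' m')) (gen1 R M r a (M.d m) r' m')) (gen1 R M r a m (R.d r') m'))
      (gen1 R M r a m r' (M.d m')) using 1
    simp only [map_add, d4_tmul, dL, dR, add_tmul, tmul_add]
    abel
  · convert add_mem (add_mem (add_mem (add_mem (gen2 R M (R.d r) a m r' m')
      (gen2 R M r (A.d a) m r' m')) (gen2 R M r a (M.d m) r' m')) (gen2 R M r a m (R.d r') m'))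
      (gen2 R M r a m r' (M.d m')) using 1
    simp only [map_add, d4_tmul, dL, dR, add_tmul, tmul_add]
    abel
  · convert add_mem (add_mem (add_mem (add_mem (gen3 R M (R.d r) a m r' m')
      (gen3 R M r (A.d a) m r' m')) (gen3 R M r a (M.d m) r' m')) (gen3 R M r a m (R.d r') m'))
      (gen3 R M r a m r' (M.d m')) using 1
    simp only [map_add, d4_tmul, dL, dR, add_tmul, tmul_add]
    abel
  · convert add_mem (add_mem (add_mem (add_mem (gen4 R M (R.d r) a m r' m')
      (gen4 R M r (A.d a) m r' m')) (gen4 R M r a (M.d m) r' m')) (gen4 R M r a m (R.d r') m'))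
      (gen4 R M r a m r' (M.d m')) using 1
    simp only [map_add, d4_tmul, dL, dR, add_tmul, tmul_add]
    abel

theorem tau4_rel (x : T4 R M) (hx : x ∈ rel4 R M) : tau4 R M x ∈ rel4 R M := by
  refine rel4_map R M (tau4 R M) _ ?_ ?_ ?_ ?_ x hx <;> intro r a m r' m' <;>
    rw [map_add, tau4_tmul, tau4_tmul]
  · exact gen4 R M _ _ _ _ _
  · rw [add_comm]; exact gen3 R M _ _ _ _ _
  · rw [add_comm]; exact gen2 R M _ _ _ _ _
  · exact gen1 R M _ _ _ _ _

theorem d2_gr {i : ℤ} {x : T2 R M} (hx : x ∈ gr2 R M i) : d2 R M x ∈ gr2 R M (i - 1) := by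
  refine (Submodule.span_le.2 ?_ : gr2 R M i ≤ (gr2 R M (i - 1)).comap (d2 R M)) hx
  rintro _ ⟨p, q, r, hr, m, hm, rfl, rfl⟩
  rw [SetLike.mem_coe, Submodule.mem_comap, d2_tmul]
  exact add_mem (grT_tmul (R.d_gr _ _ hr) hm (by ring)) (grT_tmul hr (M.d_gr _ _ hm) (by ring))

theorem d4_gr {i : ℤ} {x : T4 R M} (hx : x ∈ gr4 R M i) : d4 R M x ∈ gr4 R M (i - 1) := by
  refine (Submodule.span_le.2 ?_ : gr4 R M i ≤ (gr4 R M (i - 1)).comap (d4 R M)) hx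
  rintro _ ⟨p, q, p', q', r, hr, m, hm, r', hr', m', hm', rfl, rfl⟩
  rw [SetLike.mem_coe, Submodule.mem_comap, d4_tmul]
  exact add_mem (add_mem (add_mem (mem_gr4 R M (R.d_gr _ _ hr) hm hr' hm' (by ring))
    (mem_gr4 R M hr (M.d_gr _ _ hm) hr' hm' (by ring)))
    (mem_gr4 R M hr hm (R.d_gr _ _ hr') hm' (by ring)))
    (mem_gr4 R M hr hm hr' (M.d_gr _ _ hm') (by ring))

theorem tau4_gr {i : ℤ} {x : T4 R M} (hx : x ∈ gr4 R M i) : tau4 R M x ∈ gr4 R M i := by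
  refine (Submodule.span_le.2 ?_ : gr4 R M i ≤ (gr4 R M i).comap (tau4 R M)) hx
  rintro _ ⟨p, q, p', q', r, hr, m, hm, r', hr', m', hm', rfl, rfl⟩
  rw [SetLike.mem_coe, Submodule.mem_comap, tau4_tmul]
  exact mem_gr4 R M hr' hm' hr hm (by ring)

def dC : HCQ4 R M →ₗ[ZMod 2] HCQ4 R M :=
  Submodule.mapQ (rel4 R M) (rel4 R M) (d4 R M) (fun x hx => d4_rel R M x hx)
def tauC : HCQ4 R M →ₗ[ZMod 2] HCQ4 R M :=
  Submodule.mapQ (rel4 R M) (rel4 R M) (tau4 R M) (fun x hx => tau4_rel R M x hx)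
def P4 : T2 R M →ₗ[ZMod 2] T2 R M →ₗ[ZMod 2] T4 R M :=
  (TensorProduct.mk (ZMod 2) (T2 R M) (T2 R M)).compr₂
    (TensorProduct.assoc (ZMod 2) R.V M.V (R.V ⊗[ZMod 2] M.V)).toLinearMap
def PC : T2 R M →ₗ[ZMod 2] T2 R M →ₗ[ZMod 2] HCQ4 R M :=
  (P4 R M).compr₂ (rel4 R M).mkQ

theorem P4_tmul (r : R.V) (m : M.V) (y : T2 R M) : P4 R M (r ⊗ₜ m) y = r ⊗ₜ (m ⊗ₜ y) := rfl
theorem PC_apply (x y : T2 R M) : PC R M x y = (rel4 R M).mkQ (P4 R M x y) := rfl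

theorem G4_d (i : ℤ) (x : T4 R M) : (G4 R M).π i (d4 R M x) = d4 R M ((G4 R M).π (i + 1) x) := by
  rw [← Grd.comm (G4 R M) (G4 R M) (d4 R M) (-1)]
  · congr 2; ring
  · intro j y hy
    exact (mem_G4 R M).1 (d4_gr R M ((mem_G4 R M).2 hy))

theorem G4_tau (i : ℤ) (x : T4 R M) : (G4 R M).π i (tau4 R M x) = tau4 R M ((G4 R M).π i x) := by
  rw [← Grd.comm (G4 R M) (G4 R M) (tau4 R M) 0]
  · congr 2; ring
  · intro j y hy
    rw [add_zero]
    exact (mem_G4 R M).1 (tau4_gr R M ((mem_G4 R M).2 hy))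

theorem G2_d (i : ℤ) (x : T2 R M) : (G2 R M).π i (d2 R M x) = d2 R M ((G2 R M).π (i + 1) x) := by
  rw [← Grd.comm (G2 R M) (G2 R M) (d2 R M) (-1)]
  · congr 2; ring
  · intro j y hy
    exact (mem_G2 R M).1 (d2_gr R M ((mem_G2 R M).2 hy))

theorem P4_gr {i j : ℤ} {x y : T2 R M} (hx : x ∈ gr2 R M i) (hy : y ∈ gr2 R M j) :
    P4 R M x y ∈ gr4 R M (i + j) := by
  refine (Submodule.span_le.2 ?_ : gr2 R M i ≤ (gr4 R M (i + j)).comap ((P4 R M).flip y)) hx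
  rintro _ ⟨p, q, r, hr, m, hm, rfl, rfl⟩
  rw [SetLike.mem_coe, Submodule.mem_comap, LinearMap.flip_apply]
  refine (Submodule.span_le.2 ?_ : gr2 R M j ≤ (gr4 R M _).comap ((P4 R M (r ⊗ₜ m)))) hy
  rintro _ ⟨p', q', r', hr', m', hm', rfl, rfl⟩
  rw [SetLike.mem_coe, Submodule.mem_comap, P4_tmul]
  exact mem_gr4 R M hr hm hr' hm' (by ring)

theorem tau4_P4 (x y : T2 R M) : tau4 R M (P4 R M x y) = P4 R M y x := by
  refine T2ext R M (f := (tau4 R M).comp ((P4 R M).flip y)) (g := P4 R M y) (fun r m => ?_) x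
  refine T2ext R M (f := (tau4 R M).comp (P4 R M (r ⊗ₜ m))) (g := (P4 R M).flip (r ⊗ₜ m))
    (fun r' m' => ?_) y
  simp only [LinearMap.comp_apply, P4_tmul, tau4_tmul, LinearMap.flip_apply]

theorem d4_P4 (x y : T2 R M) : d4 R M (P4 R M x y) = P4 R M (d2 R M x) y + P4 R M x (d2 R M y) := by
  refine T2ext R M (f := (d4 R M).comp ((P4 R M).flip y))
    (g := ((P4 R M).flip y).comp (d2 R M) + (P4 R M).flip (d2 R M y)) (fun r m => ?_) x
  refine T2ext R M (f := (d4 R M).comp (P4 R M (r ⊗ₜ m)))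
    (g := (P4 R M (d2 R M (r ⊗ₜ m))) + (P4 R M (r ⊗ₜ m)).comp (d2 R M)) (fun r' m' => ?_) y
  simp only [LinearMap.comp_apply, LinearMap.add_apply, d2_tmul, map_add, P4_tmul, d4_tmul]
  abel

theorem C_surj (x : HCQ4 R M) : ∃ y, (rel4 R M).mkQ y = x := Submodule.mkQ_surjective _ x

/-- the `T1`, `T2` conditions -/
def CondT1 : Prop := ∀ z : HCQ4 R M, tauC R M z = z → ∃ x w, z = PC R M x x + (w + tauC R M w)
def CondT2 : Prop := ∀ x : T2 R M, (∃ w, PC R M x x = w + tauC R M w) ↔ x ∈ rel2 R M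

def mkTC (h1 : CondT1 R M) (h2 : CondT2 R M) : TC where
  C := HCQ4 R M
  G := GC R M
  d := dC R M
  τ := tauC R M
  d_d x := by
    obtain ⟨x, rfl⟩ := C_surj R M x
    change (rel4 R M).mkQ (d4 R M (d4 R M x)) = 0
    rw [d4_d4, map_zero]
  τ_τ x := by
    obtain ⟨x, rfl⟩ := C_surj R M x
    change (rel4 R M).mkQ (tau4 R M (tau4 R M x)) = _
    rw [tau4_tau4]
  d_τ x := by
    obtain ⟨x, rfl⟩ := C_surj R M x
    change (rel4 R M).mkQ (d4 R M (tau4 R M x)) = (rel4 R M).mkQ (tau4 R M (d4 R M x))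
    rw [d4_tau4]
  π_d i x := by
    obtain ⟨x, rfl⟩ := C_surj R M x
    change (rel4 R M).mkQ ((G4 R M).π i (d4 R M x)) = (rel4 R M).mkQ (d4 R M _)
    rw [G4_d]
  π_τ i x := by
    obtain ⟨x, rfl⟩ := C_surj R M x
    change (rel4 R M).mkQ ((G4 R M).π i (tau4 R M x)) = (rel4 R M).mkQ (tau4 R M _)
    rw [G4_tau]
  N := T2 R M
  GN := G2 R M
  dN := d2 R M
  π_dN := G2_d R M
  rel := rel2 R M
  P := PC R M
  τ_P x y := by
    change (rel4 R M).mkQ (tau4 R M (P4 R M x y)) = (rel4 R M).mkQ _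
    rw [tau4_P4]
  d_P x y := by
    change (rel4 R M).mkQ (d4 R M (P4 R M x y)) = (rel4 R M).mkQ _ + (rel4 R M).mkQ _
    rw [d4_P4, map_add]
  π_P i j x y hx hy := by
    change (rel4 R M).mkQ ((G4 R M).π _ (P4 R M x y)) = (rel4 R M).mkQ _
    rw [(mem_G4 R M).1 (P4_gr R M ((mem_G2 R M).2 hx) ((mem_G2 R M).2 hy))]
  dN_dN := d2_d2 R M
  T1 := h1
  T2 := h2

end BuildTC

section Sym

variable {V : Type} [AddCommGroup V] [Module (ZMod 2) V]

theorem sq_sum_comm {ι : Type} (s : Finset ι) (f : ι → V) : ∃ u : V ⊗[ZMod 2] V,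
    ∑ i ∈ s, (f i ⊗ₜ[ZMod 2] f i) = (∑ i ∈ s, f i) ⊗ₜ (∑ i ∈ s, f i) +
      (u + TensorProduct.comm (ZMod 2) V V u) := by
  classical
  induction s using Finset.induction_on with
  | empty => exact ⟨0, by simp⟩
  | insert a s ha ih =>
    obtain ⟨w, hw⟩ := ih
    refine ⟨f a ⊗ₜ (∑ i ∈ s, f i) + w, ?_⟩
    rw [Finset.sum_insert ha, Finset.sum_insert ha, hw, map_add, TensorProduct.comm_tmul]
    simp only [add_tmul, tmul_add]
    linear_combination (norm := (match_scalars <;> decide)) (0 : ZMod 2) • (rfl : w = w)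

theorem zmod2_one : ∀ z : ZMod 2, z ≠ 0 → z = 1 := by decide

theorem sym_decomp (t : V ⊗[ZMod 2] V) (ht : TensorProduct.comm (ZMod 2) V V t = t) :
    ∃ (w : V) (u : V ⊗[ZMod 2] V), t = w ⊗ₜ w + (u + TensorProduct.comm (ZMod 2) V V u) := by
  classical
  haveI : Fact (Nat.Prime 2) := ⟨Nat.prime_two⟩
  obtain ⟨ι, ⟨b⟩⟩ : ∃ (ι : Type), Nonempty (Module.Basis ι (ZMod 2) V) :=
    ⟨_, ⟨Module.Basis.ofVectorSpace (ZMod 2) V⟩⟩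
  letI : LinearOrder ι := IsWellOrder.linearOrder (WellOrderingRel (α := ι))
  let B := b.tensorProduct b
  have hB : ∀ p, B p = b p.1 ⊗ₜ b p.2 := fun p => by simp [B, Module.Basis.tensorProduct_apply']
  set c := B.repr t with hc
  have hcs : ∀ i j, c (i, j) = c (j, i) := by
    intro i j
    have h1 : ∀ t : V ⊗[ZMod 2] V, B.repr (TensorProduct.comm (ZMod 2) V V t) (i, j) =
        B.repr t (j, i) := by
      intro t
      induction t using TensorProduct.induction_on with
      | zero => simp
      | add x y hx hy => simp [hx, hy]
      | tmul x y => simp [B, mul_comm]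
    rw [hc, ← h1, ht]
  have hone : ∀ p ∈ c.support, c p = 1 := by
    intro p hp
    have h := Finsupp.mem_support_iff.1 hp
    exact zmod2_one _ h
  have hsum : t = ∑ p ∈ c.support, b p.1 ⊗ₜ[ZMod 2] b p.2 := by
    conv_lhs => rw [← B.linearCombination_repr t, Finsupp.linearCombination_apply, Finsupp.sum]
    refine Finset.sum_congr rfl fun p hp => ?_
    rw [← hc, hone p hp, one_smul, hB]
  set u : V ⊗[ZMod 2] V := ∑ p ∈ c.support with p.1 < p.2, b p.1 ⊗ₜ[ZMod 2] b p.2 with hu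
  have h2 : TensorProduct.comm (ZMod 2) V V u =
      ∑ p ∈ c.support with p.2 < p.1, b p.1 ⊗ₜ[ZMod 2] b p.2 := by
    rw [hu, map_sum]
    refine Finset.sum_nbij' Prod.swap Prod.swap ?_ ?_ ?_ ?_ ?_
    · rintro ⟨i, j⟩ h
      simp only [Finset.mem_filter, Finsupp.mem_support_iff, Prod.fst_swap, Prod.snd_swap,
        Prod.swap_prod_mk] at h ⊢
      rw [hcs]; exact h
    · rintro ⟨i, j⟩ h
      simp only [Finset.mem_filter, Finsupp.mem_support_iff, Prod.fst_swap, Prod.snd_swap,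
        Prod.swap_prod_mk] at h ⊢
      rw [hcs]; exact h
    · simp
    · simp
    · simp
  have h3 : ∃ s : Finset ι, ∑ p ∈ c.support with p.1 = p.2, b p.1 ⊗ₜ[ZMod 2] b p.2 =
      ∑ i ∈ s, b i ⊗ₜ[ZMod 2] b i := by
    refine ⟨(c.support.filter fun p => p.1 = p.2).image Prod.fst, ?_⟩
    rw [Finset.sum_image]
    · refine Finset.sum_congr rfl fun p hp => ?_
      rw [(Finset.mem_filter.1 hp).2]
    · rintro ⟨i, j⟩ h ⟨i', j'⟩ h' e
      simp at h h' e
      ext <;> simp [← h.2, ← h'.2, e]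
  obtain ⟨s, hs⟩ := h3
  obtain ⟨u', hu'⟩ := sq_sum_comm s b
  refine ⟨∑ i ∈ s, b i, u' + u, ?_⟩
  have h4 : t = u + (∑ p ∈ c.support with p.1 = p.2, b p.1 ⊗ₜ[ZMod 2] b p.2) +
      ∑ p ∈ c.support with p.2 < p.1, b p.1 ⊗ₜ[ZMod 2] b p.2 := by
    conv_lhs => rw [hsum]
    rw [hu, ← Finset.sum_union, ← Finset.sum_union]
    · refine Finset.sum_congr ?_ fun _ _ => rfl
      ext p
      simp only [Finset.mem_union, Finset.mem_filter]
      have h := lt_trichotomy p.1 p.2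
      tauto
    · rw [Finset.disjoint_left]
      intro p hp hp'
      simp only [Finset.mem_union, Finset.mem_filter] at hp hp'
      rcases hp with hp | hp
      · exact lt_asymm hp.2 hp'.2
      · exact absurd hp'.2 (by rw [hp.2]; exact lt_irrefl _)
    · rw [Finset.disjoint_left]
      intro p hp hp'
      simp only [Finset.mem_filter] at hp hp'
      exact absurd hp.2 (by rw [hp'.2]; exact lt_irrefl _)
  rw [h4, hs, hu', ← h2, map_add]
  abel

theorem sq_ne (w : V) (u : V ⊗[ZMod 2] V)
    (h : w ⊗ₜ w = u + TensorProduct.comm (ZMod 2) V V u) : w = 0 := by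
  haveI : Fact (Nat.Prime 2) := ⟨Nat.prime_two⟩
  by_contra hw
  obtain ⟨f, hf⟩ := Module.Projective.exists_dual_ne_zero (ZMod 2) hw
  have key : ∀ t, LinearMap.mul' (ZMod 2) (ZMod 2) (TensorProduct.map f f
      (TensorProduct.comm (ZMod 2) V V t)) = LinearMap.mul' (ZMod 2) (ZMod 2)
        (TensorProduct.map f f t) := by
    intro t
    induction t using TensorProduct.induction_on with
    | zero => simp
    | add x y hx hy => simp only [map_add, hx, hy]
    | tmul x y => simp [mul_comm]
  have h2 := congrArg (fun t => LinearMap.mul' (ZMod 2) (ZMod 2) (TensorProduct.map f f t)) h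
  simp only [map_add, key, TensorProduct.map_tmul, LinearMap.mul'_apply] at h2
  rw [ZModModule.add_self] at h2
  exact hf (mul_self_eq_zero.1 h2)

end Sym

section Free

variable {A : DGA (ZMod 2)}

theorem sandwichT_tmul (X : DGBimod A) (g : X.V) (a b : A.V) :
    sandwichT X g (a ⊗ₜ b) = X.actR (X.actL a g) b := rfl

/-- A (levelled) free presentation of a cell bimodule. -/
structure FP (X : DGBimod A) where
  J : Type
  g : J → X.V
  deg : J → ℤ
  lev : J → ℕ
  g_gr : ∀ j, g j ∈ X.gr (deg j)
  d_g : ∀ j, X.d (g j) ∈ (⨆ (i : J) (_ : lev i < lev j), LinearMap.range (sandwichT X (g i)))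
  bij : Function.Bijective (Finsupp.lsum (ZMod 2) (fun j => sandwichT X (g j)))

variable {X : DGBimod A}

def FP.fil (F : FP X) (n : ℕ) : Submodule (ZMod 2) X.V :=
  ⨆ (i : F.J) (_ : F.lev i < n), LinearMap.range (sandwichT X (F.g i))

theorem sandwich_mem {Fil : Submodule (ZMod 2) X.V} (hL : ∀ a, ∀ x ∈ Fil, X.actL a x ∈ Fil)
    (hR : ∀ a, ∀ x ∈ Fil, X.actR x a ∈ Fil) {g : X.V} (hg : g ∈ Fil) (c : A.V ⊗[ZMod 2] A.V) :
    sandwichT X g c ∈ Fil := by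
  induction c using TensorProduct.induction_on with
  | zero => simp
  | add x y hx hy => rw [map_add]; exact add_mem hx hy
  | tmul a b => rw [sandwichT_tmul]; exact hR _ _ (hL _ _ hg)

theorem exists_FP (Fil : ℕ → Submodule (ZMod 2) X.V) (h0 : Fil 0 = ⊥) (hm : Monotone Fil)
    (ht : (⨆ n, Fil n) = ⊤)
    (hL : ∀ n a, ∀ x ∈ Fil n, X.actL a x ∈ Fil n) (hR : ∀ n a, ∀ x ∈ Fil n, X.actR x a ∈ Fil n)
    (I : ℕ → Type) (g : ∀ n, I n → X.V) (deg : ∀ n, I n → ℤ)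
    (h1 : ∀ n i, g n i ∈ Fil (n + 1)) (h2 : ∀ n i, X.d (g n i) ∈ Fil n)
    (h3 : ∀ n i p q, ∀ a ∈ A.gr p, ∀ b ∈ A.gr q,
      X.actR (X.actL a (g n i)) b ∈ X.gr (p + q + deg n i))
    (h4 : ∀ n, Fil (n + 1) ≤ Fil n ⊔ (⨆ i, LinearMap.range (sandwichT X (g n i))))
    (h5 : ∀ n (u : Finset (I n)) (c : I n → A.V ⊗[ZMod 2] A.V),
      (∑ i ∈ u, sandwichT X (g n i) (c i)) ∈ Fil n → ∀ i ∈ u, c i = 0) :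
    ∃ F : FP X, (∀ n, F.fil n = Fil n) ∧ ((∀ n, Finite (I n)) → ∀ n, {j | F.lev j < n}.Finite) := by
  classical
  have hfil : ∀ n, (⨆ (i : Σ n, I n) (_ : i.1 < n), LinearMap.range (sandwichT X (g i.1 i.2)))
      = Fil n := by
    intro n
    refine le_antisymm (iSup₂_le ?_) ?_
    · rintro ⟨m, i⟩ hmn _ ⟨c, rfl⟩
      exact sandwich_mem (hL n) (hR n) (hm (Nat.succ_le_of_lt hmn) (h1 m i)) c
    · induction n with
      | zero => rw [h0]; exact bot_le
      | succ n ih =>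
        refine (h4 n).trans (sup_le (ih.trans ?_) (iSup_le fun i => ?_))
        · exact iSup_mono fun i => iSup_mono' fun h => ⟨h.trans (Nat.lt_succ_self n), le_rfl⟩
        · exact le_iSup₂_of_le (⟨n, i⟩ : Σ n, I n) (Nat.lt_succ_self n) le_rfl
  refine ⟨⟨Σ n, I n, fun j => g j.1 j.2, fun j => deg j.1 j.2, fun j => j.1, ?_, ?_, ?_, ?_⟩,
    fun n => hfil n, ?_⟩
  · rintro ⟨n, i⟩
    have := h3 n i 0 0 _ A.one_gr _ A.one_gr
    rwa [X.actL_one, X.actR_one, zero_add, zero_add] at this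
  · rintro ⟨n, i⟩
    dsimp only
    rw [hfil]
    exact h2 n i
  · rw [injective_iff_map_eq_zero]
    have key : ∀ n, ∀ c : (Σ n, I n) →₀ A.V ⊗[ZMod 2] A.V, (∀ j ∈ c.support, j.1 < n) →
        Finsupp.lsum (ZMod 2) (fun j : Σ n, I n => sandwichT X (g j.1 j.2)) c = 0 → c = 0 := by
      intro n
      induction n with
      | zero =>
        intro c hc _
        ext j
        by_contra hj
        exact absurd (hc j (Finsupp.mem_support_iff.2 hj)) (Nat.not_lt_zero _)
      | succ n ih =>
        intro c hc hz
        refine ih c (fun j hj => lt_of_le_of_ne (Nat.lt_succ_iff.1 (hc j hj)) ?_) hz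
        rintro rfl
        obtain ⟨n, i⟩ := j
        refine Finsupp.mem_support_iff.1 hj ?_
        refine h5 n (c.support.preimage (Sigma.mk n) (sigma_mk_injective.injOn))
          (fun i => c ⟨n, i⟩) ?_ i (by simpa using hj)
        rw [Finsupp.lsum_apply, Finsupp.sum,
          ← Finset.sum_filter_add_sum_filter_not c.support (fun j => j.1 = n)] at hz
        have e1 : ∑ i ∈ c.support.preimage (Sigma.mk n) (sigma_mk_injective.injOn),
            sandwichT X (g n i) (c ⟨n, i⟩) =
            ∑ j ∈ c.support with j.1 = n, sandwichT X (g j.1 j.2) (c j) := by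
          refine Finset.sum_bij (fun i _ => ⟨n, i⟩) ?_ ?_ ?_ ?_
          · intro i hi
            simp only [Finset.mem_preimage] at hi
            simp [Finset.mem_filter] at hi ⊢
            exact hi
          · intro i _ i' _ h
            exact sigma_mk_injective h
          · rintro ⟨m, i'⟩ hi
            obtain ⟨hi, hmn⟩ := Finset.mem_filter.1 hi
            dsimp only at hmn
            subst hmn
            exact ⟨i', by simpa using hi, rfl⟩
          · intros; rfl
        rw [e1, eq_neg_of_add_eq_zero_left hz]
        refine neg_mem (sum_mem fun j hj => ?_)
        obtain ⟨hj, hne⟩ := Finset.mem_filter.1 hj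
        have hlt : j.1 < n := lt_of_le_of_ne (Nat.lt_succ_iff.1 (hc j hj)) hne
        exact sandwich_mem (hL n) (hR n) (hm (Nat.succ_le_of_lt hlt) (h1 _ _)) _
    intro c hc
    refine key (c.support.sup (fun j => j.1) + 1) c (fun j hj => ?_) hc
    exact Nat.lt_succ_of_le (Finset.le_sup (f := fun j : Σ n, I n => j.1) hj)
  · rw [← LinearMap.range_eq_top, eq_top_iff, ← ht]
    refine iSup_le fun n => ?_
    rw [← hfil n]
    refine iSup₂_le fun j _ => ?_
    rintro _ ⟨c, rfl⟩
    exact ⟨Finsupp.single j c, by simp⟩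
  · intro hf n
    haveI : Finite (Σ m : Fin n, I m) := inferInstance
    refine (Set.finite_range (fun j : Σ m : Fin n, I m => (⟨j.1, j.2⟩ : Σ n, I n))).subset ?_
    rintro ⟨m, i⟩ h
    exact ⟨⟨⟨m, h⟩, i⟩, rfl⟩

theorem IsCellBimod.fp (h : IsCellBimod X) : Nonempty (FP X) := by
  obtain ⟨Fil, h0, hm, ht, -, hL, hR, hs⟩ := h
  choose I g deg h1 h2 h3 h4 h5 using hs
  obtain ⟨F, -⟩ := exists_FP Fil h0 hm ht hL hR I g deg h1 h2 h3 h4 h5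
  exact ⟨F⟩

theorem IsFiniteCellBimod.fp (h : IsFiniteCellBimod X) :
    ∃ (F : FP X) (n : ℕ), F.fil n = ⊤ ∧ {j | F.lev j < n}.Finite := by
  obtain ⟨Fil, ⟨h0, hm, ht, -, hL, hR, hs⟩, n, hn⟩ := h
  choose I hI g deg h1 h2 h3 h4 h5 using hs
  obtain ⟨F, hF, hfin⟩ := exists_FP Fil h0 hm ht hL hR I g deg h1 h2 h3 h4 h5
  exact ⟨F, n, by rw [hF, hn], hfin hI n⟩

theorem IsFiniteCellBimod.cell (h : IsFiniteCellBimod X) : IsCellBimod X := by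
  obtain ⟨Fil, ⟨h0, hm, ht, hd, hL, hR, hs⟩, -⟩ := h
  refine ⟨Fil, h0, hm, ht, hd, hL, hR, fun n => ?_⟩
  obtain ⟨I, -, h⟩ := hs n
  exact ⟨I, h⟩

theorem IsFiniteCellRetract.cell (h : IsFiniteCellRetract X) : IsCellRetract X := by
  obtain ⟨C, hC, h⟩ := h
  exact ⟨C, hC.cell, h⟩

namespace FP
variable (F : FP X)

/-- induction on generators -/
theorem ind {p : X.V → Prop} (h0 : p 0) (ha : ∀ x y, p x → p y → p (x + y))
    (hg : ∀ i j, ∀ a ∈ A.gr i, ∀ b ∈ A.gr j, ∀ s, p (X.actR (X.actL a (F.g s)) b)) (x : X.V) :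
    p x := by
  obtain ⟨c, rfl⟩ := F.bij.2 x
  induction c using Finsupp.induction_linear with
  | zero => simpa using h0
  | add x y hx hy => rw [map_add]; exact ha _ _ hx hy
  | single s c =>
    rw [Finsupp.lsum_single]
    induction c using TensorProduct.induction_on with
    | zero => simpa using h0
    | add x y hx hy => rw [map_add]; exact ha _ _ hx hy
    | tmul a b =>
      rw [sandwichT_tmul]
      induction a using DGA.hind with
      | h0 => simpa using h0
      | ha x y hx hy => simp only [map_add, LinearMap.add_apply]; exact ha _ _ hx hy
      | h1 i a hai =>
        induction b using DGA.hind with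
        | h0 => simpa using h0
        | ha x y hx hy => simp only [map_add]; exact ha _ _ hx hy
        | h1 j b hb => exact hg i j a hai b hb s

theorem fil_ind {n : ℕ} {p : X.V → Prop} (h0 : p 0) (ha : ∀ x y, p x → p y → p (x + y))
    (hg : ∀ a b s, F.lev s < n → p (X.actR (X.actL a (F.g s)) b)) (x : X.V) (hx : x ∈ F.fil n) :
    p x := by
  refine Submodule.iSup_induction _ (motive := p) hx (fun s y hy => ?_) h0 ha
  refine Submodule.iSup_induction _ (motive := p) hy ?_ h0 ha
  rintro hs _ ⟨c, rfl⟩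
  induction c using TensorProduct.induction_on with
  | zero => simpa using h0
  | add x y hx hy => rw [map_add]; exact ha _ _ (hx) (hy)
  | tmul a b => exact hg a b s hs

variable (Y : DGBimod A)

/-- the linear map determined by values on generators -/
def lift (v : F.J → Y.V) : X.V →ₗ[ZMod 2] Y.V :=
  (Finsupp.lsum (ZMod 2) (fun j => sandwichT Y (v j))).comp
    (LinearEquiv.ofBijective _ F.bij).symm.toLinearMap

theorem lift_sandwich (v : F.J → Y.V) (j : F.J) (a b : A.V) :
    F.lift Y v (X.actR (X.actL a (F.g j)) b) = Y.actR (Y.actL a (v j)) b := by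
  have : (LinearEquiv.ofBijective _ F.bij).symm (X.actR (X.actL a (F.g j)) b) =
      Finsupp.single j (a ⊗ₜ b) := by
    rw [LinearEquiv.symm_apply_eq]
    simp [sandwichT_tmul]
  rw [lift, LinearMap.comp_apply, LinearEquiv.coe_coe, this]
  simp [sandwichT_tmul]

theorem lift_g (v : F.J → Y.V) (j : F.J) : F.lift Y v (F.g j) = v j := by
  have := F.lift_sandwich Y v j A.one A.one
  rwa [X.actL_one, X.actR_one, Y.actL_one, Y.actR_one] at this

theorem lift_mem {s : ℤ} (v : F.J → Y.V) (hv : ∀ j, v j ∈ Y.gr (F.deg j + s)) :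
    F.lift Y v ∈ grHomSub X Y s := by
  refine ⟨?_, ?_, ?_⟩
  · have key : ∀ i x, F.lift Y v ((GB X).π i x) = (GB Y).π (i + s) (F.lift Y v x) := by
      intro i x
      induction x using F.ind with
      | h0 => simp
      | ha x y hx hy => simp only [map_add, hx, hy]
      | hg p q a ha b hb j =>
        have h1 : X.actR (X.actL a (F.g j)) b ∈ X.gr (p + F.deg j + q) :=
          X.actR_gr _ _ _ (X.actL_gr _ _ _ ha _ (F.g_gr j)) _ hb
        have h2 : Y.actR (Y.actL a (v j)) b ∈ Y.gr (p + F.deg j + q + s) := by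
          have := Y.actR_gr _ _ _ (Y.actL_gr _ _ _ ha _ (hv j)) _ hb
          convert this using 2; ring
        rw [lift_sandwich, (GB X).pi_of_hom ((mem_GB X).1 h1), (GB Y).pi_of_hom ((mem_GB Y).1 h2)]
        by_cases h : p + F.deg j + q = i
        · rw [if_pos (by lia), if_pos (by lia), lift_sandwich]
        · rw [if_neg (by lia), if_neg (by lia), map_zero]
    intro i x hx
    rw [mem_GB] at hx ⊢
    rw [← key, hx]
  · intro a x
    induction x using F.ind with
    | h0 => simp
    | ha x y hx hy => simp only [map_add, hx, hy]
    | hg p q b _ c _ j =>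
      rw [← X.actLR, ← X.actL_mul, lift_sandwich, lift_sandwich, Y.actL_mul, Y.actLR]
  · intro x a
    induction x using F.ind with
    | h0 => simp
    | ha x y hx hy => simp only [map_add, LinearMap.add_apply, hx, hy]
    | hg p q b _ c _ j =>
      rw [X.actR_mul, lift_sandwich, lift_sandwich, Y.actR_mul]

end FP
end Free

section Lifting

variable {A : DGA (ZMod 2)} {P X Y : DGBimod A}

theorem sw_act {s : ℤ} {h : P.V →ₗ[ZMod 2] X.V} (hh : h ∈ grHomSub P X s) (a : A.V) (x : P.V)
    (b : A.V) : h (P.actR (P.actL a x) b) = X.actR (X.actL a (h x)) b := by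
  rw [hh.2.2, hh.2.1]

theorem htp_act {s : ℤ} {h : P.V →ₗ[ZMod 2] X.V} (hh : h ∈ grHomSub P X s) (a : A.V) (x : P.V)
    (b : A.V) : X.d (h (P.actR (P.actL a x) b)) + h (P.d (P.actR (P.actL a x) b)) =
      X.actR (X.actL a (X.d (h x) + h (P.d x))) b := by
  simp only [sw_act hh, dL, dR, map_add, LinearMap.add_apply]
  linear_combination (norm := (match_scalars <;> decide)) (0 : ZMod 2) • (rfl : h x = h x)

theorem FP.fil_mono (F : FP P) {m n : ℕ} (h : m ≤ n) : F.fil m ≤ F.fil n :=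
  iSup_mono fun _ => iSup_mono' fun hi => ⟨lt_of_lt_of_le hi h, le_rfl⟩

theorem FP.g_mem (F : FP P) {n : ℕ} {j : F.J} (h : F.lev j < n) : F.g j ∈ F.fil n := by
  refine Submodule.mem_iSup_of_mem j (Submodule.mem_iSup_of_mem h ⟨A.one ⊗ₜ A.one, ?_⟩)
  rw [sandwichT_tmul, P.actL_one, P.actR_one]

theorem FP.dg_mem (F : FP P) {n : ℕ} {j : F.J} (h : F.lev j ≤ n) : P.d (F.g j) ∈ F.fil n :=
  F.fil_mono h (F.d_g j)

theorem FP.eq_on (F : FP P) {s s' : ℤ} {h h' : P.V →ₗ[ZMod 2] X.V} (hh : h ∈ grHomSub P X s)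
    (hh' : h' ∈ grHomSub P X s') {n : ℕ} (hg : ∀ j, F.lev j < n → h (F.g j) = h' (F.g j)) :
    ∀ x ∈ F.fil n, h x = h' x := by
  intro x hx
  refine F.fil_ind (n := n) (p := fun x => h x = h' x) ?_ ?_ ?_ x hx
  · simp
  · intro x y hx hy; rw [map_add, map_add, hx, hy]
  · intro a b j hj; rw [sw_act hh, sw_act hh', hg j hj]

theorem bcm_gr {s : ℤ} {f : P.V →ₗ[ZMod 2] X.V} (h : IsBHom P X s f) : f ∈ grHomSub P X s :=
  ⟨h.1, h.2.2.1, h.2.2.2⟩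

theorem comp_gr {s t : ℤ} {f : P.V →ₗ[ZMod 2] X.V} {g : X.V →ₗ[ZMod 2] Y.V}
    (hf : f ∈ grHomSub P X s) (hg : g ∈ grHomSub X Y t) : g.comp f ∈ grHomSub P Y (s + t) := by
  refine ⟨fun i x hx => ?_, fun a m => ?_, fun m a => ?_⟩
  · rw [← add_assoc]; exact hg.1 _ _ (hf.1 _ _ hx)
  · simp only [LinearMap.comp_apply, hf.2.1, hg.2.1]
  · simp only [LinearMap.comp_apply, hf.2.2, hg.2.2]

theorem comp_bh {s t : ℤ} {f : P.V →ₗ[ZMod 2] X.V} {g : X.V →ₗ[ZMod 2] Y.V}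
    (hf : IsBHom P X s f) (hg : IsBHom X Y t g) : IsBHom P Y (s + t) (g.comp f) := by
  have := comp_gr (bcm_gr hf) (bcm_gr hg)
  refine ⟨this.1, fun x => ?_, this.2.1, this.2.2⟩
  simp only [LinearMap.comp_apply, hf.2.1, hg.2.1]

section
variable (F : FP P) (s : ℤ) (φ : X.V →ₗ[ZMod 2] Y.V) (α : P.V →ₗ[ZMod 2] X.V)
  (β : P.V →ₗ[ZMod 2] Y.V)

structure Good (n : ℕ) (hk : (P.V →ₗ[ZMod 2] X.V) × (P.V →ₗ[ZMod 2] Y.V)) : Prop where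
  h : hk.1 ∈ grHomSub P X (s + 1)
  k : hk.2 ∈ grHomSub P Y (s + 2)
  e1 : ∀ j, F.lev j < n → X.d (hk.1 (F.g j)) + hk.1 (P.d (F.g j)) = α (F.g j)
  e2 : ∀ j, F.lev j < n → Y.d (hk.2 (F.g j)) + hk.2 (P.d (F.g j)) =
    φ (hk.1 (F.g j)) + β (F.g j)

variable {F s φ α β}

theorem Good.all1 (hα : IsBHom P X s α) {n : ℕ}
    {hk} (G : Good F s φ α β n hk) :
    ∀ x ∈ F.fil n, X.d (hk.1 x) + hk.1 (P.d x) = α x := by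
  intro x hx
  refine F.fil_ind (n := n) (p := fun x => X.d (hk.1 x) + hk.1 (P.d x) = α x) ?_ ?_ ?_ x hx
  · simp
  · intro x y hx hy
    simp only [map_add, ← hx, ← hy]; abel
  · intro a b j hj; rw [htp_act G.h, G.e1 j hj, sw_act (bcm_gr hα)]

theorem Good.all2 (hφ : IsBHom X Y 0 φ) (hβ : β ∈ grHomSub P Y (s + 1)) {n : ℕ}
    {hk} (G : Good F s φ α β n hk) :
    ∀ x ∈ F.fil n, Y.d (hk.2 x) + hk.2 (P.d x) = φ (hk.1 x) + β x := by
  intro x hx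
  refine F.fil_ind (n := n) (p := fun x => Y.d (hk.2 x) + hk.2 (P.d x) = φ (hk.1 x) + β x)
    ?_ ?_ ?_ x hx
  · simp
  · intro x y hx hy
    simp only [map_add] at hx hy ⊢
    linear_combination (norm := (match_scalars <;> decide)) (1 : ZMod 2) • hx + (1 : ZMod 2) • hy
  · intro a b j hj
    rw [htp_act G.k, G.e2 j hj, sw_act hβ, sw_act G.h, sw_act (bcm_gr hφ)]
    simp only [map_add, LinearMap.add_apply]

theorem Good.step (hφ : IsBHom X Y 0 φ) (hq : IsQIsoDeg X.V Y.V X.gr Y.gr X.d Y.d 0 φ)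
    (hα : IsBHom P X s α) (hβ : β ∈ grHomSub P Y (s + 1))
    (hαβ : ∀ x, Y.d (β x) + β (P.d x) = φ (α x)) {n : ℕ} {hk} (G : Good F s φ α β n hk) :
    ∃ hk', Good F s φ α β (n + 1) hk' ∧ ∀ j, F.lev j < n → hk'.1 (F.g j) = hk.1 (F.g j) ∧
      hk'.2 (F.g j) = hk.2 (F.g j) := by
  classical
  have new : ∀ j, F.lev j = n → ∃ x ∈ X.gr (F.deg j + (s + 1)), ∃ y ∈ Y.gr (F.deg j + (s + 2)),
      X.d x + hk.1 (P.d (F.g j)) = α (F.g j) ∧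
      Y.d y + hk.2 (P.d (F.g j)) = φ x + β (F.g j) := by
    intro j hj
    have hdg := F.dg_mem hj.le
    have a1 := G.all1 hα _ hdg
    have a2 := G.all2 hφ hβ _ hdg
    rw [P.d_d, map_zero, add_zero] at a1 a2
    have hdgr := P.d_gr _ _ (F.g_gr j)
    have hc : α (F.g j) + hk.1 (P.d (F.g j)) ∈ X.gr (F.deg j + s) := by
      refine add_mem (hα.1 _ _ (F.g_gr j)) ?_
      have := G.h.1 _ _ hdgr
      convert this using 2; ring
    have hdc : X.d (α (F.g j) + hk.1 (P.d (F.g j))) = 0 := by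
      rw [map_add, ← hα.2.1, a1, ZModModule.add_self]
    have hb : β (F.g j) + hk.2 (P.d (F.g j)) ∈ Y.gr (F.deg j + (s + 1)) := by
      refine add_mem (hβ.1 _ _ (F.g_gr j)) ?_
      have := G.k.1 _ _ hdgr
      convert this using 2; ring
    have hφc : φ (α (F.g j) + hk.1 (P.d (F.g j))) = Y.d (β (F.g j) + hk.2 (P.d (F.g j))) := by
      have := hαβ (F.g j)
      rw [map_add, map_add]
      linear_combination (norm := (match_scalars <;> decide)) (1 : ZMod 2) • this + (1 : ZMod 2) • a2
    obtain ⟨x0, hx0, hx0'⟩ := (hq (F.deg j + s)).2 _ hc hdc ⟨_, by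
      rw [SetLike.mem_coe]; convert hb using 2; ring, hφc.symm⟩
    have hy : φ x0 + (β (F.g j) + hk.2 (P.d (F.g j))) ∈ Y.gr (F.deg j + s + 1 + 0) := by
      refine add_mem (hφ.1 _ _ hx0) ?_
      convert hb using 2; ring
    have hdy : Y.d (φ x0 + (β (F.g j) + hk.2 (P.d (F.g j)))) = 0 := by
      rw [map_add, ← hφ.2.1, hx0', hφc, ZModModule.add_self]
    obtain ⟨x1, hx1, hdx1, y1, hy1, hy1'⟩ := (hq (F.deg j + s + 1)).1 _ hy hdy
    refine ⟨x0 + x1, ?_, y1, ?_, ?_, ?_⟩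
    · convert add_mem hx0 hx1 using 2; ring
    · rw [SetLike.mem_coe] at hy1; convert hy1 using 2; ring
    · rw [map_add, hx0', hdx1]
      linear_combination (norm := (match_scalars <;> decide)) (0 : ZMod 2) • hdx1
    · rw [hy1', map_add, ZModModule.sub_eq_add]
      linear_combination (norm := (match_scalars <;> decide)) (0 : ZMod 2) • hy1'
  choose! xv hxv yv hyv n1 n2 using new
  set u : F.J → X.V := fun j => if F.lev j = n then xv j else hk.1 (F.g j) with hu
  set v : F.J → Y.V := fun j => if F.lev j = n then yv j else hk.2 (F.g j) with hv
  have hu' : F.lift X u ∈ grHomSub P X (s + 1) := F.lift_mem X u fun j => by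
    simp only [hu]; split_ifs with hj
    exacts [hxv j hj, G.h.1 _ _ (F.g_gr j)]
  have hv' : F.lift Y v ∈ grHomSub P Y (s + 2) := F.lift_mem Y v fun j => by
    simp only [hv]; split_ifs with hj
    exacts [hyv j hj, G.k.1 _ _ (F.g_gr j)]
  have ou : ∀ j, F.lev j < n → F.lift X u (F.g j) = hk.1 (F.g j) := fun j hj => by
    rw [F.lift_g, hu]; simp only [hj.ne, if_false]
  have ov : ∀ j, F.lev j < n → F.lift Y v (F.g j) = hk.2 (F.g j) := fun j hj => by
    rw [F.lift_g, hv]; simp only [hj.ne, if_false]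
  have eu := F.eq_on hu' G.h ou
  have ev := F.eq_on hv' G.k ov
  refine ⟨(F.lift X u, F.lift Y v), ⟨hu', hv', fun j hj => ?_, fun j hj => ?_⟩,
    fun j hj => ⟨ou j hj, ov j hj⟩⟩
  · dsimp only
    rw [eu _ (F.dg_mem (Nat.lt_succ_iff.1 hj))]
    rcases (Nat.lt_succ_iff.1 hj).lt_or_eq with h | h
    · rw [ou j h, G.e1 j h]
    · rw [F.lift_g, hu]; simp only [h, if_true]; exact n1 j h
  · dsimp only
    rw [ev _ (F.dg_mem (Nat.lt_succ_iff.1 hj))]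
    rcases (Nat.lt_succ_iff.1 hj).lt_or_eq with h | h
    · rw [ov j h, ou j h, G.e2 j h]
    · rw [F.lift_g, F.lift_g, hu, hv]; simp only [h, if_true]; exact n2 j h

theorem lifting_fp (F : FP P) (hφ : IsBHom X Y 0 φ)
    (hq : IsQIsoDeg X.V Y.V X.gr Y.gr X.d Y.d 0 φ)
    (hα : IsBHom P X s α) (hβ : β ∈ grHomSub P Y (s + 1))
    (hαβ : ∀ x, Y.d (β x) + β (P.d x) = φ (α x)) :
    ∃ h ∈ grHomSub P X (s + 1), ∃ k ∈ grHomSub P Y (s + 2),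
      (∀ x, X.d (h x) + h (P.d x) = α x) ∧ ∀ x, Y.d (k x) + k (P.d x) = φ (h x) + β x := by
  have st : ∀ n, ∀ a : {hk // Good F s φ α β n hk}, ∃ b : {hk // Good F s φ α β (n + 1) hk},
      ∀ j, F.lev j < n → b.1.1 (F.g j) = a.1.1 (F.g j) ∧ b.1.2 (F.g j) = a.1.2 (F.g j) := by
    rintro n ⟨hk, G⟩
    obtain ⟨hk', G', e⟩ := G.step hφ hq hα hβ hαβ
    exact ⟨⟨hk', G'⟩, e⟩
  choose nx hnx using st
  have z : Good F s φ α β 0 (0, 0) := ⟨zero_mem _, zero_mem _, fun j h => absurd h (Nat.not_lt_zero _),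
    fun j h => absurd h (Nat.not_lt_zero _)⟩
  let sq : ∀ n, {hk // Good F s φ α β n hk} := fun n => Nat.rec ⟨_, z⟩ (fun n a => nx n a) n
  have sq1 : ∀ n j, F.lev j < n → (sq (n + 1)).1.1 (F.g j) = (sq n).1.1 (F.g j) ∧
      (sq (n + 1)).1.2 (F.g j) = (sq n).1.2 (F.g j) := fun n j h => hnx n (sq n) j h
  have sq2 : ∀ j n, F.lev j + 1 ≤ n → (sq n).1.1 (F.g j) = (sq (F.lev j + 1)).1.1 (F.g j) ∧
      (sq n).1.2 (F.g j) = (sq (F.lev j + 1)).1.2 (F.g j) := by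
    intro j n hn
    induction n, hn using Nat.le_induction with
    | base => exact ⟨rfl, rfl⟩
    | succ n hn ih => rw [(sq1 n j hn).1, (sq1 n j hn).2]; exact ih
  let h := F.lift X (fun j => (sq (F.lev j + 1)).1.1 (F.g j))
  let k := F.lift Y (fun j => (sq (F.lev j + 1)).1.2 (F.g j))
  have hh : h ∈ grHomSub P X (s + 1) := F.lift_mem X _ fun j => (sq (F.lev j + 1)).2.h.1 _ _ (F.g_gr j)
  have kk : k ∈ grHomSub P Y (s + 2) := F.lift_mem Y _ fun j => (sq (F.lev j + 1)).2.k.1 _ _ (F.g_gr j)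
  have eh : ∀ n, ∀ x ∈ F.fil n, h x = (sq n).1.1 x := fun n =>
    F.eq_on hh (sq n).2.h fun j hj => by rw [(sq2 j n hj).1]; exact F.lift_g _ _ _
  have ek : ∀ n, ∀ x ∈ F.fil n, k x = (sq n).1.2 x := fun n =>
    F.eq_on kk (sq n).2.k fun j hj => by rw [(sq2 j n hj).2]; exact F.lift_g _ _ _
  have e1 : ∀ j, X.d (h (F.g j)) + h (P.d (F.g j)) = α (F.g j) := fun j => by
    have hl := Nat.lt_succ_self (F.lev j)
    rw [eh _ _ (F.g_mem hl), eh _ _ (F.dg_mem hl.le)]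
    exact (sq _).2.e1 j hl
  have e2 : ∀ j, Y.d (k (F.g j)) + k (P.d (F.g j)) = φ (h (F.g j)) + β (F.g j) := fun j => by
    have hl := Nat.lt_succ_self (F.lev j)
    rw [ek _ _ (F.g_mem hl), ek _ _ (F.dg_mem hl.le), eh _ _ (F.g_mem hl)]
    exact (sq _).2.e2 j hl
  have GG : ∀ n, Good F s φ α β n (h, k) := fun n => ⟨hh, kk, fun j _ => e1 j, fun j _ => e2 j⟩
  have tot : ∀ x, ∃ n, x ∈ F.fil n := by
    intro x
    induction x using F.ind with
    | h0 => exact ⟨0, zero_mem _⟩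
    | ha x y hx hy =>
      obtain ⟨m, hm⟩ := hx
      obtain ⟨n, hn⟩ := hy
      exact ⟨max m n, add_mem (F.fil_mono (le_max_left _ _) hm) (F.fil_mono (le_max_right _ _) hn)⟩
    | hg i i' a _ b _ j =>
      refine ⟨F.lev j + 1, Submodule.mem_iSup_of_mem j (Submodule.mem_iSup_of_mem
        (Nat.lt_succ_self _) ⟨a ⊗ₜ b, rfl⟩)⟩
  refine ⟨h, hh, k, kk, fun x => ?_, fun x => ?_⟩
  · obtain ⟨n, hn⟩ := tot x
    exact (GG n).all1 hα x hn
  · obtain ⟨n, hn⟩ := tot x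
    exact (GG n).all2 hφ hβ x hn

theorem lifting (hP : IsCellRetract P) (hφ : IsBHom X Y 0 φ)
    (hq : IsQIsoDeg X.V Y.V X.gr Y.gr X.d Y.d 0 φ)
    (hα : IsBHom P X s α) (hβ : β ∈ grHomSub P Y (s + 1))
    (hαβ : ∀ x, Y.d (β x) + β (P.d x) = φ (α x)) :
    ∃ h ∈ grHomSub P X (s + 1), ∃ k ∈ grHomSub P Y (s + 2),
      (∀ x, X.d (h x) + h (P.d x) = α x) ∧ ∀ x, Y.d (k x) + k (P.d x) = φ (h x) + β x := by
  obtain ⟨C, hC, ι, r, hι, hr, -, hrι⟩ := hP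
  obtain ⟨F⟩ := hC.fp
  have hrι' : ∀ x, r (ι x) = x := fun x => LinearMap.congr_fun hrι x
  have hα' := comp_bh hr hα
  rw [zero_add] at hα'
  have hβ' := comp_gr (bcm_gr hr) hβ
  rw [zero_add] at hβ'
  obtain ⟨h, hh, k, kk, e1, e2⟩ := lifting_fp F hφ hq hα' hβ' (fun x => by
    simp only [LinearMap.comp_apply, hr.2.1, hαβ])
  have hh' := comp_gr (bcm_gr hι) hh
  have kk' := comp_gr (bcm_gr hι) kk
  rw [zero_add] at hh' kk'
  refine ⟨_, hh', _, kk', fun x => ?_, fun x => ?_⟩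
  · simp only [LinearMap.comp_apply, hι.2.1]
    rw [e1, LinearMap.comp_apply, hrι']
  · simp only [LinearMap.comp_apply, hι.2.1]
    rw [e2, LinearMap.comp_apply, hrι']

end

/-- Comparison of two resolutions. -/
theorem compare {R R' D : DGBimod A} {ρ : R.V →ₗ[ZMod 2] D.V} {ρ' : R'.V →ₗ[ZMod 2] D.V}
    (hR : IsCellRetract R) (hR' : IsCellRetract R') (hρ : IsBHom R D 0 ρ) (hρ' : IsBHom R' D 0 ρ')
    (hq : IsQIsoDeg R.V D.V R.gr D.gr R.d D.d 0 ρ)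
    (hq' : IsQIsoDeg R'.V D.V R'.gr D.gr R'.d D.d 0 ρ') :
    ∃ f g h h', IsBHom R' R 0 f ∧ IsBHom R R' 0 g ∧ h ∈ grHomSub R R 1 ∧ h' ∈ grHomSub R' R' 1 ∧
      (∀ x, R.d (h x) + h (R.d x) = f (g x) + x) ∧
      (∀ x, R'.d (h' x) + h' (R'.d x) = g (f x) + x) := by
  have one : ∀ {P X : DGBimod A} {ρP : P.V →ₗ[ZMod 2] D.V} {ρX : X.V →ₗ[ZMod 2] D.V},
      IsCellRetract P → IsBHom P D 0 ρP → IsBHom X D 0 ρX →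
      IsQIsoDeg X.V D.V X.gr D.gr X.d D.d 0 ρX → ∃ f, IsBHom P X 0 f ∧
        ∃ k ∈ grHomSub P D 1, ∀ x, D.d (k x) + k (P.d x) = ρX (f x) + ρP x := by
    intro P X ρP ρX hP hρP hρX hqX
    obtain ⟨f, hf, k, hk, e1, e2⟩ := lifting (s := -1) (α := 0) (β := ρP) hP hρX hqX
      ((bcmSub P X (-1)).zero_mem) (bcm_gr hρP) (fun x => by
        rw [hρP.2.1, ZModModule.add_self]; simp)
    refine ⟨f, ⟨hf.1, fun x => ?_, hf.2.1, hf.2.2⟩, k, hk, e2⟩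
    have := e1 x
    rw [LinearMap.zero_apply] at this
    rw [← ZModModule.neg_eq_self (X.d (f x))]
    exact (neg_eq_of_add_eq_zero_right this).symm
  have two : ∀ {P X : DGBimod A} {ρP : P.V →ₗ[ZMod 2] D.V} {ρX : X.V →ₗ[ZMod 2] D.V}
      {f : P.V →ₗ[ZMod 2] X.V} {g : X.V →ₗ[ZMod 2] P.V} {k l},
      IsCellRetract P → IsBHom P D 0 ρP → IsBHom X D 0 ρX →
      IsQIsoDeg P.V D.V P.gr D.gr P.d D.d 0 ρP → IsBHom P X 0 f → IsBHom X P 0 g →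
      k ∈ grHomSub P D 1 → l ∈ grHomSub X D 1 →
      (∀ x, D.d (k x) + k (P.d x) = ρX (f x) + ρP x) →
      (∀ x, D.d (l x) + l (X.d x) = ρP (g x) + ρX x) →
      ∃ h ∈ grHomSub P P 1, ∀ x, P.d (h x) + h (P.d x) = g (f x) + x := by
    intro P X ρP ρX f g k l hP hρP hρX hqP hf hg hk hl ek el
    have hid : IsBHom P P 0 LinearMap.id :=
      ⟨fun i x hx => by simpa using hx, fun _ => rfl, fun _ _ => rfl, fun _ _ => rfl⟩
    have hgf := comp_bh hf hg
    rw [zero_add] at hgf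
    have hlf := comp_gr (bcm_gr hf) hl
    rw [zero_add] at hlf
    obtain ⟨h, hh, -, -, e1, -⟩ := lifting (s := 0) (α := g.comp f + LinearMap.id)
      (β := l.comp f + k) hP hρP hqP ((bcmSub P P 0).add_mem hgf hid) (add_mem hlf hk) (fun x => by
        have h1 := ek x
        have h2 := el (f x)
        simp only [LinearMap.add_apply, LinearMap.comp_apply, LinearMap.id_apply, map_add, hf.2.1]
        linear_combination (norm := (match_scalars <;> decide)) (1 : ZMod 2) • h1 + (1 : ZMod 2) • h2)
    exact ⟨h, hh, e1⟩
  obtain ⟨f, hf, k, hk, ek⟩ := one hR' hρ' hρ hq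
  obtain ⟨g, hg, l, hl, el⟩ := one hR hρ hρ' hq'
  obtain ⟨h, hh, eh⟩ := two hR hρ hρ' hq hg hf hl hk el ek
  obtain ⟨h', hh', eh'⟩ := two hR' hρ' hρ hq' hf hg hk hl ek el
  exact ⟨f, g, h, h', hf, hg, hh, hh', eh, eh'⟩

end Lifting

section Maps

variable {A : DGA (ZMod 2)} {R S U : DGBimod A} (M : DGBimod A)

/-- equivariance for both actions -/
def Eqv (f : R.V →ₗ[ZMod 2] S.V) : Prop :=
  (∀ a m, f (R.actL a m) = S.actL a (f m)) ∧ (∀ m a, f (R.actR m a) = S.actR (f m) a)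

def m2 (f : R.V →ₗ[ZMod 2] S.V) : T2 R M →ₗ[ZMod 2] T2 S M := TensorProduct.map f LinearMap.id

def m4 (f g : R.V →ₗ[ZMod 2] S.V) : T4 R M →ₗ[ZMod 2] T4 S M :=
  TensorProduct.map f (TensorProduct.map LinearMap.id (TensorProduct.map g LinearMap.id))

theorem m2_tmul (f : R.V →ₗ[ZMod 2] S.V) (r m) : m2 M f (r ⊗ₜ m) = f r ⊗ₜ m := rfl
theorem m4_tmul (f g : R.V →ₗ[ZMod 2] S.V) (r m r' m') :
    m4 M f g (r ⊗ₜ (m ⊗ₜ (r' ⊗ₜ m'))) = f r ⊗ₜ (m ⊗ₜ (g r' ⊗ₜ m')) := rfl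

theorem m2_rel {f : R.V →ₗ[ZMod 2] S.V} (hf : Eqv f) (x : T2 R M) (hx : x ∈ rel2 R M) :
    m2 M f x ∈ rel2 S M := by
  refine (Submodule.span_le.2 ?_ : rel2 R M ≤ (rel2 S M).comap (m2 M f)) hx
  rintro _ (⟨r, a, m, rfl⟩ | ⟨r, a, m, rfl⟩) <;>
    rw [SetLike.mem_coe, Submodule.mem_comap, map_add, m2_tmul, m2_tmul]
  · rw [hf.2]; exact Submodule.subset_span (Or.inl ⟨_, _, _, rfl⟩)
  · rw [hf.1]; exact Submodule.subset_span (Or.inr ⟨_, _, _, rfl⟩)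

theorem m4_rel {f g : R.V →ₗ[ZMod 2] S.V} (hf : Eqv f) (hg : Eqv g) (x : T4 R M)
    (hx : x ∈ rel4 R M) : m4 M f g x ∈ rel4 S M := by
  refine rel4_map R M (m4 M f g) _ ?_ ?_ ?_ ?_ x hx <;> intro r a m r' m' <;>
    rw [map_add, m4_tmul, m4_tmul]
  · rw [hf.2]; exact gen1 S M _ _ _ _ _
  · rw [hf.1]; exact gen2 S M _ _ _ _ _
  · rw [hg.1]; exact gen3 S M _ _ _ _ _
  · rw [hg.2]; exact gen4 S M _ _ _ _ _

theorem m2_gr {s : ℤ} {f : R.V →ₗ[ZMod 2] S.V} (hf : ∀ i, ∀ x ∈ R.gr i, f x ∈ S.gr (i + s)) {i : ℤ}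
    {x : T2 R M} (hx : x ∈ gr2 R M i) : m2 M f x ∈ gr2 S M (i + s) := by
  refine (Submodule.span_le.2 ?_ : gr2 R M i ≤ (gr2 S M (i + s)).comap (m2 M f)) hx
  rintro _ ⟨p, q, r, hr, m, hm, rfl, rfl⟩
  exact grT_tmul (hf _ _ hr) hm (by ring)

theorem m4_gr {s t : ℤ} {f g : R.V →ₗ[ZMod 2] S.V} (hf : ∀ i, ∀ x ∈ R.gr i, f x ∈ S.gr (i + s))
    (hg : ∀ i, ∀ x ∈ R.gr i, g x ∈ S.gr (i + t)) {i : ℤ}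
    {x : T4 R M} (hx : x ∈ gr4 R M i) : m4 M f g x ∈ gr4 S M (i + (s + t)) := by
  refine (Submodule.span_le.2 ?_ : gr4 R M i ≤ (gr4 S M (i + (s + t))).comap (m4 M f g)) hx
  rintro _ ⟨p, q, p', q', r, hr, m, hm, r', hr', m', hm', rfl, rfl⟩
  exact mem_gr4 S M (hf _ _ hr) hm (hg _ _ hr') hm' (by ring)

theorem m2_pi {s : ℤ} {f : R.V →ₗ[ZMod 2] S.V} (hf : ∀ i, ∀ x ∈ R.gr i, f x ∈ S.gr (i + s)) (i : ℤ)
    (x : T2 R M) : (G2 S M).π (i + s) (m2 M f x) = m2 M f ((G2 R M).π i x) :=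
  Grd.comm _ _ _ s (fun _ _ hy => (mem_G2 S M).1 (m2_gr M hf ((mem_G2 R M).2 hy))) i x

theorem m4_pi {s t : ℤ} {f g : R.V →ₗ[ZMod 2] S.V} (hf : ∀ i, ∀ x ∈ R.gr i, f x ∈ S.gr (i + s))
    (hg : ∀ i, ∀ x ∈ R.gr i, g x ∈ S.gr (i + t)) (i : ℤ) (x : T4 R M) :
    (G4 S M).π (i + (s + t)) (m4 M f g x) = m4 M f g ((G4 R M).π i x) :=
  Grd.comm _ _ _ (s + t) (fun _ _ hy => (mem_G4 S M).1 (m4_gr M hf hg ((mem_G4 R M).2 hy))) i x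

def mC (f g : R.V →ₗ[ZMod 2] S.V) (hf : Eqv f) (hg : Eqv g) : HCQ4 R M →ₗ[ZMod 2] HCQ4 S M :=
  Submodule.mapQ (rel4 R M) (rel4 S M) (m4 M f g) (fun x hx => m4_rel M hf hg x hx)

theorem mC_mk (f g : R.V →ₗ[ZMod 2] S.V) (hf : Eqv f) (hg : Eqv g) (x : T4 R M) :
    mC M f g hf hg ((rel4 R M).mkQ x) = (rel4 S M).mkQ (m4 M f g x) := rfl

theorem dC_mk (x : T4 R M) : dC R M ((rel4 R M).mkQ x) = (rel4 R M).mkQ (d4 R M x) := rfl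
theorem tauC_mk (x : T4 R M) : tauC R M ((rel4 R M).mkQ x) = (rel4 R M).mkQ (tau4 R M x) := rfl
theorem GC_mk (i : ℤ) (x : T4 R M) :
    (GC R M).π i ((rel4 R M).mkQ x) = (rel4 R M).mkQ ((G4 R M).π i x) := rfl

theorem mC_pi {s t : ℤ} {f g : R.V →ₗ[ZMod 2] S.V} (hf : Eqv f) (hg : Eqv g)
    (hf' : ∀ i, ∀ x ∈ R.gr i, f x ∈ S.gr (i + s))
    (hg' : ∀ i, ∀ x ∈ R.gr i, g x ∈ S.gr (i + t)) (i : ℤ) (x : HCQ4 R M) :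
    (GC S M).π (i + (s + t)) (mC M f g hf hg x) = mC M f g hf hg ((GC R M).π i x) := by
  obtain ⟨x, rfl⟩ := C_surj R M x
  rw [mC_mk, GC_mk, GC_mk, mC_mk, m4_pi M hf' hg']

theorem mC_tau {f : R.V →ₗ[ZMod 2] S.V} (hf : Eqv f) (x : HCQ4 R M) :
    mC M f f hf hf (tauC R M x) = tauC S M (mC M f f hf hf x) := by
  obtain ⟨x, rfl⟩ := C_surj R M x
  rw [tauC_mk, mC_mk, mC_mk, tauC_mk]
  congr 1
  refine T4ext R M (f := (m4 M f f).comp (tau4 R M)) (g := (tau4 S M).comp (m4 M f f))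
    (fun r m r' m' => ?_) x
  simp only [LinearMap.comp_apply, tau4_tmul, m4_tmul]

theorem mC_P {f : R.V →ₗ[ZMod 2] S.V} (hf : Eqv f) (x y : T2 R M) :
    mC M f f hf hf (PC R M x y) = PC S M (m2 M f x) (m2 M f y) := by
  rw [PC_apply, mC_mk, PC_apply]
  congr 1
  refine T2ext R M (f := (m4 M f f).comp ((P4 R M).flip y))
    (g := ((P4 S M).flip (m2 M f y)).comp (m2 M f)) (fun r m => ?_) x
  refine T2ext R M (f := (m4 M f f).comp (P4 R M (r ⊗ₜ m)))
    (g := (P4 S M (m2 M f (r ⊗ₜ m))).comp (m2 M f)) (fun r' m' => ?_) y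
  simp only [LinearMap.comp_apply, P4_tmul, m2_tmul, m4_tmul]

theorem m2_d {f : R.V →ₗ[ZMod 2] S.V} (hf : ∀ x, f (R.d x) = S.d (f x)) (x : T2 R M) :
    m2 M f (d2 R M x) = d2 S M (m2 M f x) := by
  refine T2ext R M (f := (m2 M f).comp (d2 R M)) (g := (d2 S M).comp (m2 M f)) (fun r m => ?_) x
  simp only [LinearMap.comp_apply, d2_tmul, m2_tmul, map_add, hf]

theorem mC_d {f : R.V →ₗ[ZMod 2] S.V} (hf : Eqv f) (hd : ∀ x, f (R.d x) = S.d (f x))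
    (x : HCQ4 R M) : mC M f f hf hf (dC R M x) = dC S M (mC M f f hf hf x) := by
  obtain ⟨x, rfl⟩ := C_surj R M x
  rw [dC_mk, mC_mk, mC_mk, dC_mk]
  congr 1
  refine T4ext R M (f := (m4 M f f).comp (d4 R M)) (g := (d4 S M).comp (m4 M f f))
    (fun r m r' m' => ?_) x
  simp only [LinearMap.comp_apply, d4_tmul, m4_tmul, map_add, hd]

theorem m2_comp (f : R.V →ₗ[ZMod 2] S.V) (g : S.V →ₗ[ZMod 2] U.V) (x : T2 R M) :
    m2 M g (m2 M f x) = m2 M (g.comp f) x := by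
  refine T2ext R M (f := (m2 M g).comp (m2 M f)) (g := m2 M (g.comp f)) (fun r m => ?_) x
  simp only [LinearMap.comp_apply, m2_tmul]

theorem m2_id (x : T2 R M) : m2 M (LinearMap.id : R.V →ₗ[ZMod 2] R.V) x = x := by
  refine T2ext R M (f := m2 M (LinearMap.id : R.V →ₗ[ZMod 2] R.V)) (g := LinearMap.id)
    (fun r m => ?_) x
  simp only [m2_tmul, LinearMap.id_apply]

theorem eqv_id : Eqv (LinearMap.id : R.V →ₗ[ZMod 2] R.V) := ⟨fun _ _ => rfl, fun _ _ => rfl⟩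

theorem Eqv.comp {f : R.V →ₗ[ZMod 2] S.V} {g : S.V →ₗ[ZMod 2] U.V} (hf : Eqv f) (hg : Eqv g) :
    Eqv (g.comp f) :=
  ⟨fun a m => by simp only [LinearMap.comp_apply, hf.1, hg.1],
    fun m a => by simp only [LinearMap.comp_apply, hf.2, hg.2]⟩

theorem mC_comp {f : R.V →ₗ[ZMod 2] S.V} {g : S.V →ₗ[ZMod 2] U.V} (hf : Eqv f) (hg : Eqv g)
    (x : HCQ4 R M) : mC M g g hg hg (mC M f f hf hf x) =
      mC M (g.comp f) (g.comp f) (hf.comp hg) (hf.comp hg) x := by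
  obtain ⟨x, rfl⟩ := C_surj R M x
  simp only [mC_mk]
  congr 1
  refine T4ext R M (f := (m4 M g g).comp (m4 M f f)) (g := m4 M (g.comp f) (g.comp f))
    (fun r m r' m' => ?_) x
  simp only [LinearMap.comp_apply, m4_tmul]

theorem mC_id (x : HCQ4 R M) :
    mC M (LinearMap.id : R.V →ₗ[ZMod 2] R.V) LinearMap.id eqv_id eqv_id x = x := by
  obtain ⟨x, rfl⟩ := C_surj R M x
  simp only [mC_mk]
  congr 1
  refine T4ext R M (f := m4 M (LinearMap.id : R.V →ₗ[ZMod 2] R.V) LinearMap.id)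
    (g := LinearMap.id) (fun r m r' m' => ?_) x
  simp only [m4_tmul, LinearMap.id_apply]

theorem mC_retr {f : R.V →ₗ[ZMod 2] S.V} {g : S.V →ₗ[ZMod 2] R.V} (hf : Eqv f) (hg : Eqv g)
    (h : g.comp f = LinearMap.id) (x : HCQ4 R M) :
    mC M g g hg hg (mC M f f hf hf x) = x := by
  rw [mC_comp]
  conv_rhs => rw [← mC_id M x]
  congr 1
  simp only [h]

theorem m2_htp {e h : R.V →ₗ[ZMod 2] R.V} (H : ∀ x, R.d (h x) + h (R.d x) = e x + x) (x : T2 R M) :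
    d2 R M (m2 M h x) + m2 M h (d2 R M x) = m2 M e x + x := by
  refine T2ext R M (f := (d2 R M).comp (m2 M h) + (m2 M h).comp (d2 R M))
    (g := m2 M e + LinearMap.id) (fun r m => ?_) x
  simp only [LinearMap.comp_apply, LinearMap.add_apply, d2_tmul, m2_tmul, map_add,
    LinearMap.id_apply]
  rw [← add_tmul (e r) r, ← H r, add_tmul]
  linear_combination (norm := (match_scalars <;> decide)) (0 : ZMod 2) • (rfl : e r ⊗ₜ[ZMod 2] m = e r ⊗ₜ[ZMod 2] m)

theorem mC_htp {e h : R.V →ₗ[ZMod 2] R.V} (he : Eqv e) (hh : Eqv h)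
    (hd : ∀ x, e (R.d x) = R.d (e x))
    (H : ∀ x, R.d (h x) + h (R.d x) = e x + x) (x : HCQ4 R M) :
    dC R M (mC M h e hh he x + mC M LinearMap.id h eqv_id hh x) +
      (mC M h e hh he (dC R M x) + mC M LinearMap.id h eqv_id hh (dC R M x)) =
      mC M e e he he x + x := by
  obtain ⟨x, rfl⟩ := C_surj R M x
  simp only [mC_mk, dC_mk, ← map_add]
  congr 1
  refine T4ext R M (f := (d4 R M).comp (m4 M h e + m4 M LinearMap.id h) +
      (m4 M h e + m4 M LinearMap.id h).comp (d4 R M))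
    (g := m4 M e e + LinearMap.id) (fun r m r' m' => ?_) x
  simp only [LinearMap.comp_apply, LinearMap.add_apply, d4_tmul, m4_tmul, map_add,
    LinearMap.id_apply, hd]
  have h1 : e r ⊗ₜ[ZMod 2] (m ⊗ₜ[ZMod 2] (e r' ⊗ₜ[ZMod 2] m')) +
      r ⊗ₜ[ZMod 2] (m ⊗ₜ[ZMod 2] (e r' ⊗ₜ[ZMod 2] m')) =
      R.d (h r) ⊗ₜ[ZMod 2] (m ⊗ₜ[ZMod 2] (e r' ⊗ₜ[ZMod 2] m')) +
      h (R.d r) ⊗ₜ[ZMod 2] (m ⊗ₜ[ZMod 2] (e r' ⊗ₜ[ZMod 2] m')) := by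
    rw [← add_tmul, ← add_tmul, H]
  have h2 : r ⊗ₜ[ZMod 2] (m ⊗ₜ[ZMod 2] (e r' ⊗ₜ[ZMod 2] m')) +
      r ⊗ₜ[ZMod 2] (m ⊗ₜ[ZMod 2] (r' ⊗ₜ[ZMod 2] m')) =
      r ⊗ₜ[ZMod 2] (m ⊗ₜ[ZMod 2] (R.d (h r') ⊗ₜ[ZMod 2] m')) +
      r ⊗ₜ[ZMod 2] (m ⊗ₜ[ZMod 2] (h (R.d r') ⊗ₜ[ZMod 2] m')) := by
    rw [← tmul_add, ← tmul_add, ← add_tmul, ← tmul_add, ← tmul_add, ← add_tmul, H]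
  linear_combination (norm := (match_scalars <;> decide)) (1 : ZMod 2) • h1 + (1 : ZMod 2) • h2

theorem IsBHom.eqv {s : ℤ} {f : R.V →ₗ[ZMod 2] S.V} (h : IsBHom R S s f) : Eqv f := h.2.2

/-- the morphism of Tate data induced by a bimodule map -/
def homTC (h1 : CondT1 R M) (h2 : CondT2 R M) (h1' : CondT1 S M) (h2' : CondT2 S M)
    {f : R.V →ₗ[ZMod 2] S.V} (hf : IsBHom R S 0 f) :
    TC.Hom (mkTC R M h1 h2) (mkTC S M h1' h2') where
  f := mC M f f hf.eqv hf.eqv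
  fN := m2 M f
  f_d := mC_d M hf.eqv hf.2.1
  f_τ := mC_tau M hf.eqv
  f_π i x := by
    have := (mC_pi M hf.eqv hf.eqv hf.1 hf.1 i x).symm
    rwa [add_zero, add_zero] at this
  fN_π i x := by
    have := (m2_pi M hf.1 i x).symm
    rwa [add_zero] at this
  f_P := mC_P M hf.eqv

section
variable {f : R.V →ₗ[ZMod 2] S.V} {g : S.V →ₗ[ZMod 2] R.V} {h : S.V →ₗ[ZMod 2] S.V}
    {h' : R.V →ₗ[ZMod 2] R.V} (h1 : CondT1 R M) (h2 : CondT2 R M) (h1' : CondT1 S M)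
    (h2' : CondT2 S M) (hf : IsBHom R S 0 f)

theorem page_le (hg : IsBHom S R 0 g) (hh : h ∈ grHomSub S S 1)
    (hh' : h' ∈ grHomSub R R 1) (e : ∀ x, S.d (h x) + h (S.d x) = f (g x) + x)
    (e' : ∀ x, R.d (h' x) + h' (R.d x) = g (f x) + x) : PageIso (mkTC R M h1 h2).G.le (mkTC R M h1 h2).D (mkTC S M h1' h2').G.le
    (mkTC S M h1' h2').D (mC M f f hf.eqv hf.eqv) 3 := by
  refine TC.Hom.pageIso_le (homTC M h1 h2 h1' h2' hf) ?_ ?_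
  · intro q x hx hdx
    change T2 S M at x
    change d2 S M x ∈ rel2 S M at hdx
    change (G2 S M).π q x = x at hx
    refine ⟨m2 M g x, m2 M h x, ?_, ?_, ?_, ?_⟩
    · have := m2_pi M hg.1 q x
      rw [add_zero, hx] at this
      exact this
    · change d2 R M (m2 M g x) ∈ rel2 R M
      rw [← m2_d M hg.2.1]
      exact m2_rel M hg.eqv _ hdx
    · have := m2_pi M hh.1 q x
      rw [hx] at this
      exact this
    · change m2 M f (m2 M g x) + x + d2 S M (m2 M h x) ∈ rel2 S M
      have H := m2_htp M (e := f.comp g) e x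
      rw [m2_comp, ← H]
      convert m2_rel M (f := h) hh.2 _ hdx using 1
      linear_combination (norm := (match_scalars <;> decide)) (0 : ZMod 2) • H
  · intro q x y hx hdx hy hxy
    change T2 R M at x
    change T2 S M at y
    change d2 R M x ∈ rel2 R M at hdx
    change (G2 R M).π q x = x at hx
    change (G2 S M).π (q + 1) y = y at hy
    change m2 M f x + d2 S M y ∈ rel2 S M at hxy
    refine ⟨m2 M g y + m2 M h' x, ?_, ?_⟩
    · have a1 := m2_pi M hg.1 (q + 1) y
      have a2 := m2_pi M hh'.1 q x
      rw [add_zero, hy] at a1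
      rw [hx] at a2
      change (G2 R M).π (q + 1) (m2 M g y + m2 M h' x) = _
      rw [map_add, a1, a2]
    · change x + d2 R M (m2 M g y + m2 M h' x) ∈ rel2 R M
      have H := m2_htp M (e := g.comp f) e' x
      have a1 := m2_rel M hg.eqv _ hxy
      have a2 := m2_rel M (f := h') hh'.2 _ hdx
      rw [map_add, m2_comp, m2_d M hg.2.1] at a1
      convert add_mem a1 a2 using 1
      rw [map_add]
      linear_combination (norm := (match_scalars <;> decide)) (1 : ZMod 2) • H

theorem page_col (hg : IsBHom S R 0 g) (hh : h ∈ grHomSub S S 1)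
    (hh' : h' ∈ grHomSub R R 1) (e : ∀ x, S.d (h x) + h (S.d x) = f (g x) + x)
    (e' : ∀ x, R.d (h' x) + h' (R.d x) = g (f x) + x) : PageIso (mkTC R M h1 h2).G.col (mkTC R M h1 h2).D (mkTC S M h1' h2').G.col
    (mkTC S M h1' h2').D (mC M f f hf.eqv hf.eqv) 0 := by
  have ef := hf.eqv
  have eg := hg.eqv
  have eh : Eqv h := hh.2
  have eh' : Eqv h' := hh'.2
  have hfg := comp_bh hg hf
  have hgf := comp_bh hf hg
  rw [add_zero] at hfg hgf
  have did : ∀ {X : DGBimod A}, ∀ i, ∀ x ∈ X.gr i,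
      (LinearMap.id : X.V →ₗ[ZMod 2] X.V) x ∈ X.gr (i + 0) := fun i x hx => by simpa using hx
  refine TC.Hom.pageIso_col (homTC M h1 h2 h1' h2' hf) ?_ ?_
  · intro q x hx hdx
    change HCQ4 S M at x
    change dC S M x = 0 at hdx
    change (GC S M).π q x = x at hx
    refine ⟨mC M g g eg eg x, mC M h (f.comp g) eh (eg.comp ef) x +
      mC M LinearMap.id h eqv_id eh x, ?_, ?_, ?_, ?_⟩
    · have := mC_pi M eg eg hg.1 hg.1 q x
      rw [add_zero, add_zero, hx] at this
      exact this
    · change dC R M (mC M g g eg eg x) = 0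
      rw [← mC_d M eg hg.2.1, hdx, map_zero]
    · have a1 := mC_pi M eh (eg.comp ef) hh.1 hfg.1 q x
      have a2 := mC_pi M eqv_id eh did hh.1 q x
      rw [hx] at a1 a2
      rw [add_zero] at a1
      rw [zero_add] at a2
      change (GC S M).π (q + 1) _ = _
      rw [map_add, a1, a2]
    · have H := mC_htp M (eg.comp ef) eh hfg.2.1 e x
      rw [hdx, map_zero, map_zero, add_zero, add_zero, ← mC_comp M eg ef] at H
      exact H.symm
  · intro q x y hx hdx hy hxy
    change HCQ4 R M at x
    change HCQ4 S M at y
    change dC R M x = 0 at hdx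
    change (GC R M).π q x = x at hx
    change (GC S M).π (q + 1) y = y at hy
    change mC M f f ef ef x = dC S M y at hxy
    refine ⟨mC M g g eg eg y + (mC M h' (g.comp f) eh' (ef.comp eg) x +
      mC M LinearMap.id h' eqv_id eh' x), ?_, ?_⟩
    · have a0 := mC_pi M eg eg hg.1 hg.1 (q + 1) y
      have a1 := mC_pi M eh' (ef.comp eg) hh'.1 hgf.1 q x
      have a2 := mC_pi M eqv_id eh' did hh'.1 q x
      rw [hx] at a1 a2
      rw [hy, add_zero, add_zero] at a0
      rw [add_zero] at a1
      rw [zero_add] at a2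
      change (GC R M).π (q + 1) _ = _
      rw [map_add, map_add, a0, a1, a2]
    · have H := mC_htp M (ef.comp eg) eh' hgf.2.1 e' x
      rw [hdx, map_zero, map_zero, add_zero, add_zero, ← mC_comp M ef eg, hxy, mC_d M eg hg.2.1] at H
      change x = dC R M _
      rw [map_add, H]
      linear_combination (norm := (match_scalars <;> decide)) (0 : ZMod 2) • H
end

end Maps

section CellTwo

variable {A : DGA (ZMod 2)} {X : DGBimod A}

namespace FP
variable (F : FP X) (M : DGBimod A)

abbrev W := F.J →₀ M.V

def actW : F.W M →ₗ[ZMod 2] A.V →ₗ[ZMod 2] F.W M :=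
  Finsupp.lsum (ZMod 2) (fun j => M.actR.compr₂ (Finsupp.lsingle j))

theorem actW_single (j : F.J) (m : M.V) (a : A.V) :
    F.actW M (Finsupp.single j m) a = Finsupp.single j (M.actR m a) := by
  simp [actW]

theorem actW_mul (w : F.W M) (a b : A.V) :
    F.actW M (F.actW M w a) b = F.actW M w (A.mul a b) := by
  induction w using Finsupp.induction_linear with
  | zero => simp
  | add x y hx hy => simp only [map_add, LinearMap.add_apply, hx, hy]
  | single j m => simp only [actW_single, M.actR_mul]

theorem actW_one (w : F.W M) : F.actW M w A.one = w := by
  induction w using Finsupp.induction_linear with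
  | zero => simp
  | add x y hx hy => simp only [map_add, LinearMap.add_apply, hx, hy]
  | single j m => simp only [actW_single, M.actR_one]

def Bj (j : F.J) : A.V →ₗ[ZMod 2] A.V →ₗ[ZMod 2] (M.V →ₗ[ZMod 2] (A.V ⊗[ZMod 2] F.W M)) :=
  LinearMap.mk₂ (ZMod 2) (fun a b => (TensorProduct.mk (ZMod 2) A.V (F.W M) a).comp
      ((Finsupp.lsingle j).comp (M.actL b)))
    (fun a a' b => by ext m; simp [add_tmul])
    (fun c a b => by ext m; simp [smul_tmul'])
    (fun a b b' => by ext m; simp [tmul_add])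
    (fun c a b => by ext m; simp; rw [← Finsupp.smul_single, tmul_smul])

def lam0 : X.V →ₗ[ZMod 2] M.V →ₗ[ZMod 2] (A.V ⊗[ZMod 2] F.W M) :=
  (Finsupp.lsum (ZMod 2) (fun j => TensorProduct.lift (F.Bj M j))).comp
    (LinearEquiv.ofBijective _ F.bij).symm.toLinearMap

theorem lam0_g (j : F.J) (a b : A.V) (m : M.V) :
    F.lam0 M (X.actR (X.actL a (F.g j)) b) m = a ⊗ₜ Finsupp.single j (M.actL b m) := by
  have : (LinearEquiv.ofBijective _ F.bij).symm (X.actR (X.actL a (F.g j)) b) =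
      Finsupp.single j (a ⊗ₜ b) := by
    rw [LinearEquiv.symm_apply_eq]
    simp [sandwichT_tmul]
  rw [lam0, LinearMap.comp_apply, LinearEquiv.coe_coe, this]
  simp [Bj]

theorem lam0_R (x : X.V) (a : A.V) (m : M.V) :
    F.lam0 M (X.actR x a) m = F.lam0 M x (M.actL a m) := by
  induction x using F.ind with
  | h0 => simp
  | ha x y hx hy => simp only [map_add, LinearMap.add_apply, hx, hy]
  | hg p q b _ c _ j => rw [X.actR_mul, lam0_g, lam0_g, M.actL_mul]

theorem lam0_L (x : X.V) (a : A.V) (m : M.V) :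
    F.lam0 M (X.actL a x) m = TensorProduct.map (A.mul a) LinearMap.id (F.lam0 M x m) := by
  induction x using F.ind with
  | h0 => simp
  | ha x y hx hy => simp only [map_add, LinearMap.add_apply, hx, hy]
  | hg p q b _ c _ j =>
    rw [← X.actLR, ← X.actL_mul, lam0_g, lam0_g, map_tmul, LinearMap.id_apply]

theorem lam0_M (x : X.V) (a : A.V) (m : M.V) :
    F.lam0 M x (M.actR m a) =
      TensorProduct.map LinearMap.id ((F.actW M).flip a) (F.lam0 M x m) := by
  induction x using F.ind with
  | h0 => simp
  | ha x y hx hy => simp only [map_add, LinearMap.add_apply, hx, hy]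
  | hg p q b _ c _ j =>
    rw [lam0_g, lam0_g, map_tmul, LinearMap.id_apply, LinearMap.flip_apply, actW_single, M.actLR]

def psi0 : ((A.V ⊗[ZMod 2] F.W M) ⊗[ZMod 2] (A.V ⊗[ZMod 2] F.W M)) →ₗ[ZMod 2]
    (F.W M ⊗[ZMod 2] F.W M) :=
  (TensorProduct.map (TensorProduct.lift (F.actW M)) (TensorProduct.lift (F.actW M))).comp
    ((TensorProduct.tensorTensorTensorComm (ZMod 2) (F.W M) (F.W M) A.V A.V).toLinearMap.comp
      ((TensorProduct.comm (ZMod 2) (A.V ⊗[ZMod 2] A.V) (F.W M ⊗[ZMod 2] F.W M)).toLinearMap.comp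
        ((TensorProduct.map (TensorProduct.comm (ZMod 2) A.V A.V).toLinearMap LinearMap.id).comp
          (TensorProduct.tensorTensorTensorComm (ZMod 2) A.V (F.W M) A.V (F.W M)).toLinearMap)))

theorem psi0_tmul (a a' : A.V) (w w' : F.W M) :
    F.psi0 M ((a ⊗ₜ w) ⊗ₜ (a' ⊗ₜ w')) = F.actW M w a' ⊗ₜ F.actW M w' a := rfl

theorem psi0_comm (a : A.V) (t t' : A.V ⊗[ZMod 2] F.W M) :
    F.psi0 M (TensorProduct.map (A.mul a) LinearMap.id t ⊗ₜ t') =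
      F.psi0 M (t ⊗ₜ TensorProduct.map LinearMap.id ((F.actW M).flip a) t') := by
  induction t using TensorProduct.induction_on with
  | zero => simp
  | add x y hx hy => simp only [map_add, add_tmul, hx, hy]
  | tmul b w =>
    induction t' using TensorProduct.induction_on with
    | zero => simp
    | add x y hx hy => simp only [map_add, tmul_add, hx, hy]
    | tmul b' w' =>
      simp only [map_tmul, psi0_tmul, LinearMap.id_apply, LinearMap.flip_apply, actW_mul]

theorem psi0_comm' (a : A.V) (t t' : A.V ⊗[ZMod 2] F.W M) :
    F.psi0 M (t ⊗ₜ TensorProduct.map (A.mul a) LinearMap.id t') =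
      F.psi0 M (TensorProduct.map LinearMap.id ((F.actW M).flip a) t ⊗ₜ t') := by
  induction t using TensorProduct.induction_on with
  | zero => simp
  | add x y hx hy => simp only [map_add, add_tmul, hx, hy]
  | tmul b w =>
    induction t' using TensorProduct.induction_on with
    | zero => simp
    | add x y hx hy => simp only [map_add, tmul_add, hx, hy]
    | tmul b' w' =>
      simp only [map_tmul, psi0_tmul, LinearMap.id_apply, LinearMap.flip_apply, actW_mul]

def psi4 : T4 X M →ₗ[ZMod 2] (F.W M ⊗[ZMod 2] F.W M) :=
  (F.psi0 M).comp ((TensorProduct.map (TensorProduct.lift (F.lam0 M))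
    (TensorProduct.lift (F.lam0 M))).comp
    (TensorProduct.assoc (ZMod 2) X.V M.V (X.V ⊗[ZMod 2] M.V)).symm.toLinearMap)

theorem psi4_tmul (r m r' m') : F.psi4 M (r ⊗ₜ (m ⊗ₜ (r' ⊗ₜ m'))) =
    F.psi0 M (F.lam0 M r m ⊗ₜ F.lam0 M r' m') := rfl

theorem psi4_rel (x : T4 X M) (hx : x ∈ rel4 X M) : F.psi4 M x = 0 := by
  rw [← Submodule.mem_bot (ZMod 2)]
  refine rel4_map X M (F.psi4 M) ⊥ ?_ ?_ ?_ ?_ x hx <;> intro r a m r' m' <;>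
    rw [map_add, psi4_tmul, psi4_tmul, Submodule.mem_bot]
  · rw [lam0_R]; exact ZModModule.add_self _
  · rw [lam0_L, lam0_M, psi0_comm]; exact ZModModule.add_self _
  · rw [lam0_L, lam0_M, psi0_comm']; exact ZModModule.add_self _
  · rw [lam0_R]; exact ZModModule.add_self _

def psiC : HCQ4 X M →ₗ[ZMod 2] (F.W M ⊗[ZMod 2] F.W M) :=
  (rel4 X M).liftQ (F.psi4 M) (fun x hx => F.psi4_rel M x hx)

theorem psiC_mk (x : T4 X M) : F.psiC M ((rel4 X M).mkQ x) = F.psi4 M x := rfl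

/-- the section `W → R ⊗ M` -/
def sec : F.W M →ₗ[ZMod 2] T2 X M :=
  Finsupp.lsum (ZMod 2) (fun j => TensorProduct.mk (ZMod 2) X.V M.V (F.g j))

theorem sec_single (j : F.J) (m : M.V) : F.sec M (Finsupp.single j m) = F.g j ⊗ₜ m := by
  simp [sec]

def theta : (F.W M ⊗[ZMod 2] F.W M) →ₗ[ZMod 2] HCQ4 X M :=
  TensorProduct.lift ((PC X M).compl₁₂ (F.sec M) (F.sec M))

theorem theta_tmul (w w' : F.W M) : F.theta M (w ⊗ₜ w') = PC X M (F.sec M w) (F.sec M w') := rfl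

theorem psi_theta (t) : F.psiC M (F.theta M t) = t := by
  induction t using TensorProduct.induction_on with
  | zero => simp
  | add x y hx hy => simp only [map_add, hx, hy]
  | tmul w w' =>
    induction w using Finsupp.induction_linear with
    | zero => simp
    | add x y hx hy => simp only [map_add, add_tmul, hx, hy]
    | single j m =>
      induction w' using Finsupp.induction_linear with
      | zero => simp
      | add x y hx hy => simp only [map_add, tmul_add, hx, hy]
      | single j' m' =>
        rw [theta_tmul, PC_apply, psiC_mk, sec_single, sec_single, P4_tmul, psi4_tmul]
        have := fun j m => F.lam0_g M j A.one A.one m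
        simp only [X.actL_one, X.actR_one, M.actL_one] at this
        rw [this, this, psi0_tmul, actW_one, actW_one]

theorem eqC {x y : T4 X M} (h : x + y ∈ rel4 X M) : (rel4 X M).mkQ x = (rel4 X M).mkQ y := by
  rw [← sub_eq_zero, ← map_sub, ZModModule.sub_eq_add]
  exact (Submodule.Quotient.mk_eq_zero _).2 h

theorem move (a a' b b' : A.V) (g g' : X.V) (m m' : M.V) :
    (rel4 X M).mkQ (X.actR (X.actL a g) b ⊗ₜ (m ⊗ₜ (X.actR (X.actL a' g') b' ⊗ₜ m'))) =
      (rel4 X M).mkQ (g ⊗ₜ (M.actR (M.actL b m) a' ⊗ₜ (g' ⊗ₜ M.actR (M.actL b' m') a))) := by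
  rw [eqC M (gen1 X M _ _ _ _ _), eqC M (gen4 X M _ _ _ _ _), eqC M (gen2 X M _ _ _ _ _),
    ← eqC M (gen3 X M _ _ _ _ _)]

theorem theta_surj (z : HCQ4 X M) : ∃ t, F.theta M t = z := by
  rw [← LinearMap.mem_range]
  obtain ⟨z, rfl⟩ := C_surj X M z
  induction z using TensorProduct.induction_on with
  | zero => rw [map_zero]; exact zero_mem _
  | add x y hx hy => rw [map_add]; exact add_mem hx hy
  | tmul r z =>
  induction z using TensorProduct.induction_on with
  | zero => rw [tmul_zero, map_zero]; exact zero_mem _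
  | add x y hx hy => rw [tmul_add, map_add]; exact add_mem hx hy
  | tmul m z =>
  induction z using TensorProduct.induction_on with
  | zero => rw [tmul_zero, tmul_zero, map_zero]; exact zero_mem _
  | add x y hx hy => rw [tmul_add, tmul_add, map_add]; exact add_mem hx hy
  | tmul r' m' =>
  induction r using F.ind with
  | h0 => rw [zero_tmul, map_zero]; exact zero_mem _
  | ha x y hx hy => rw [add_tmul, map_add]; exact add_mem hx hy
  | hg _ _ a _ b _ j =>
  induction r' using F.ind with
  | h0 => rw [zero_tmul, tmul_zero, tmul_zero, map_zero]; exact zero_mem _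
  | ha x y hx hy => rw [add_tmul, tmul_add, tmul_add, map_add]; exact add_mem hx hy
  | hg _ _ a' _ b' _ j' =>
  rw [move]
  refine ⟨Finsupp.single j (M.actR (M.actL b m) a') ⊗ₜ
    Finsupp.single j' (M.actR (M.actL b' m') a), ?_⟩
  rw [theta_tmul, sec_single, sec_single]
  rfl

theorem tau_theta (t) : tauC X M (F.theta M t) = F.theta M (TensorProduct.comm (ZMod 2) _ _ t) := by
  induction t using TensorProduct.induction_on with
  | zero => simp
  | add x y hx hy => simp only [map_add, hx, hy]
  | tmul w w' =>
    rw [TensorProduct.comm_tmul, theta_tmul, theta_tmul, PC_apply, tauC_mk, tau4_P4, PC_apply]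

theorem theta_inj {t t'} (h : F.theta M t = F.theta M t') : t = t' := by
  rw [← F.psi_theta M t, h, psi_theta]

theorem sec_surj (x : T2 X M) : ∃ w, x + F.sec M w ∈ rel2 X M := by
  induction x using TensorProduct.induction_on with
  | zero => exact ⟨0, by simp⟩
  | add x y hx hy =>
    obtain ⟨w, hw⟩ := hx
    obtain ⟨v, hv⟩ := hy
    refine ⟨w + v, ?_⟩
    convert add_mem hw hv using 1
    rw [map_add]; abel
  | tmul r m =>
  induction r using F.ind with
  | h0 => exact ⟨0, by simp⟩
  | ha x y hx hy =>
    obtain ⟨w, hw⟩ := hx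
    obtain ⟨v, hv⟩ := hy
    refine ⟨w + v, ?_⟩
    convert add_mem hw hv using 1
    rw [map_add, add_tmul]; abel
  | hg _ _ a _ b _ j =>
    refine ⟨Finsupp.single j (M.actR (M.actL b m) a), ?_⟩
    rw [sec_single]
    have h1 : X.actR (X.actL a (F.g j)) b ⊗ₜ[ZMod 2] m + X.actL a (F.g j) ⊗ₜ[ZMod 2] M.actL b m
      ∈ rel2 X M := Submodule.subset_span (Or.inl ⟨_, _, _, rfl⟩)
    have h2 : X.actL a (F.g j) ⊗ₜ[ZMod 2] M.actL b m + F.g j ⊗ₜ[ZMod 2] M.actR (M.actL b m) a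
      ∈ rel2 X M := Submodule.subset_span (Or.inr ⟨_, _, _, rfl⟩)
    have := add_mem h1 h2
    rwa [add_assoc, ← add_assoc (X.actL a (F.g j) ⊗ₜ[ZMod 2] M.actL b m), ZModModule.add_self,
      zero_add] at this

end FP

variable (R M : DGBimod A)

theorem tauC_P (x y : T2 R M) : tauC R M (PC R M x y) = PC R M y x := by
  rw [PC_apply, tauC_mk, tau4_P4, PC_apply]

theorem PC_rel (x : T2 R M) (hx : x ∈ rel2 R M) : ∃ w, PC R M x x = w + tauC R M w := by
  refine Submodule.span_induction (p := fun x _ => ∃ w, PC R M x x = w + tauC R M w)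
    ?_ ?_ ?_ ?_ hx
  · rintro _ (⟨r, a, m, rfl⟩ | ⟨r, a, m, rfl⟩)
    · refine ⟨0, ?_⟩
      rw [map_zero, add_zero]
      refine T2ext R M (f := PC R M (R.actR r a ⊗ₜ[ZMod 2] m + r ⊗ₜ[ZMod 2] M.actL a m)) (g := 0)
        (fun r' m' => ?_) _
      rw [LinearMap.zero_apply, map_add, LinearMap.add_apply, PC_apply, PC_apply, P4_tmul, P4_tmul,
        ← map_add]
      exact (Submodule.Quotient.mk_eq_zero _).2 (gen1 R M _ _ _ _ _)
    · refine ⟨PC R M (R.actL a r ⊗ₜ m) (r ⊗ₜ M.actR m a), ?_⟩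
      rw [tauC_P]
      simp only [map_add, LinearMap.add_apply]
      have h : PC R M (R.actL a r ⊗ₜ m) (R.actL a r ⊗ₜ m) =
          PC R M (r ⊗ₜ M.actR m a) (r ⊗ₜ M.actR m a) := by
        simp only [PC_apply, P4_tmul]
        rw [FP.eqC M (gen2 R M _ _ _ _ _), ← FP.eqC M (gen3 R M _ _ _ _ _)]
      rw [h]
      linear_combination (norm := (match_scalars <;> decide)) (0 : ZMod 2) • h
  · exact ⟨0, by simp⟩
  · rintro x y - - ⟨w, hw⟩ ⟨v, hv⟩
    refine ⟨w + v + PC R M x y, ?_⟩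
    simp only [map_add, LinearMap.add_apply, tauC_P, hw, hv]
    abel
  · rintro c x - ⟨w, hw⟩
    refine ⟨(c * c) • w, ?_⟩
    simp only [map_smul, LinearMap.smul_apply, hw, smul_add, smul_smul]

theorem cell_T1 (h : IsCellBimod X) : CondT1 X M := by
  obtain ⟨F⟩ := h.fp
  intro z hz
  obtain ⟨t, rfl⟩ := F.theta_surj M z
  rw [F.tau_theta] at hz
  obtain ⟨w, u, h⟩ := sym_decomp t (F.theta_inj M hz)
  refine ⟨F.sec M w, F.theta M u, ?_⟩
  rw [F.tau_theta, ← F.theta_tmul, ← map_add, ← map_add, ← h]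

theorem cell_T2 (h : IsCellBimod X) : CondT2 X M := by
  obtain ⟨F⟩ := h.fp
  refine fun x => ⟨?_, PC_rel X M x⟩
  rintro ⟨w, hw⟩
  obtain ⟨v, hv⟩ := F.sec_surj M x
  obtain ⟨u, hu⟩ := PC_rel X M _ hv
  obtain ⟨t, ht⟩ := F.theta_surj M (w + u + PC X M x (F.sec M v))
  have : F.theta M (v ⊗ₜ v) = F.theta M (t + TensorProduct.comm (ZMod 2) _ _ t) := by
    rw [map_add, ← F.tau_theta, ht, F.theta_tmul]
    simp only [map_add, LinearMap.add_apply, tauC_P] at hu ⊢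
    rw [hw] at hu
    linear_combination (norm := (match_scalars <;> decide)) (1 : ZMod 2) • hu
  have := sq_ne v t (F.theta_inj M this)
  rwa [this, map_zero, add_zero] at hv

theorem retr_T1 (h : IsCellRetract R) : CondT1 R M := by
  obtain ⟨C, hC, ι, r, hι, hr, -, hri⟩ := h
  intro z hz
  obtain ⟨x, w, h⟩ := cell_T1 M hC (mC M ι ι hι.eqv hι.eqv z) (by rw [← mC_tau, hz])
  refine ⟨m2 M r x, mC M r r hr.eqv hr.eqv w, ?_⟩
  rw [← mC_tau, ← mC_P M hr.eqv, ← map_add, ← map_add, ← h, mC_retr M hι.eqv hr.eqv hri]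

theorem retr_T2 (h : IsCellRetract R) : CondT2 R M := by
  obtain ⟨C, hC, ι, r, hι, hr, -, hri⟩ := h
  refine fun x => ⟨?_, PC_rel R M x⟩
  rintro ⟨w, hw⟩
  have := (cell_T2 M hC (m2 M ι x)).1 ⟨mC M ι ι hι.eqv hι.eqv w, by
    rw [← mC_P M hι.eqv, ← mC_tau, hw, map_add]⟩
  have := m2_rel M hr.eqv _ this
  rwa [m2_comp, hri, m2_id] at this

theorem cell_bdd (h : IsFiniteCellBimod X) (hM : BoundedBimod M) :
    ∃ K : ℤ, ∀ i : ℤ, K < |i| → ∀ z, (GC X M).π i z = 0 := by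
  obtain ⟨F, n, hn, hfin⟩ := h.fp
  obtain ⟨u, hu⟩ := hM
  obtain ⟨a, ha⟩ : ∃ a : ℤ, ∀ j, F.lev j < n → |F.deg j| ≤ a := by
    obtain ⟨a, ha⟩ := (hfin.image (fun j => |F.deg j|)).bddAbove
    exact ⟨a, fun j hj => ha ⟨j, hj, rfl⟩⟩
  obtain ⟨b, hb⟩ : ∃ b : ℤ, ∀ j ∈ u, |j| ≤ b := by
    obtain ⟨b, hb⟩ := (u.finite_toSet.image (fun j : ℤ => |j|)).bddAbove
    exact ⟨b, fun j hj => hb ⟨j, hj, rfl⟩⟩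
  have hm : ∀ i m, m ∈ M.gr i → b < |i| → m = 0 := by
    intro i m hm hi
    rw [hu i (fun h => absurd (hb i h) (not_le.2 hi))] at hm
    exact hm
  refine ⟨a + a + b + b, fun i hi z => ?_⟩
  obtain ⟨z, rfl⟩ := C_surj X M z
  induction z using TensorProduct.induction_on with
  | zero => simp
  | add x y hx hy => rw [map_add, map_add, hx, hy, add_zero]
  | tmul r z =>
  induction z using TensorProduct.induction_on with
  | zero => simp
  | add x y hx hy => rw [tmul_add, map_add, map_add, hx, hy, add_zero]
  | tmul m z =>
  induction z using TensorProduct.induction_on with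
  | zero => simp
  | add x y hx hy => rw [tmul_add, tmul_add, map_add, map_add, hx, hy, add_zero]
  | tmul r' m' =>
  refine F.fil_ind (n := n) (p := fun r => (GC X M).π i ((rel4 X M).mkQ (r ⊗ₜ (m ⊗ₜ (r' ⊗ₜ m'))))
    = 0) (by simp) ?_ ?_ r (hn ▸ Submodule.mem_top)
  · intro x y hx hy
    rw [add_tmul, map_add, map_add, hx, hy, add_zero]
  intro a₁ b₁ j hj
  refine F.fil_ind (n := n) (p := fun r' => (GC X M).π i ((rel4 X M).mkQ (_ ⊗ₜ (m ⊗ₜ (r' ⊗ₜ m'))))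
    = 0) (by simp) ?_ ?_ r' (hn ▸ Submodule.mem_top)
  · intro x y hx hy
    rw [add_tmul, tmul_add, tmul_add, map_add, map_add, hx, hy, add_zero]
  intro a₂ b₂ j' hj'
  rw [FP.move]
  generalize M.actR (M.actL b₁ m) a₂ = m₁
  generalize M.actR (M.actL b₂ m') a₁ = m₂
  induction m₁ using M.hind with
  | h0 => simp
  | ha x y hx hy => rw [add_tmul, tmul_add, map_add, map_add, hx, hy, add_zero]
  | h1 p m₁ h₁ =>
  induction m₂ using M.hind with
  | h0 => simp
  | ha x y hx hy => rw [tmul_add, tmul_add, tmul_add, map_add, map_add, hx, hy, add_zero]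
  | h1 q m₂ h₂ =>
  by_cases hp : b < |p|
  · rw [hm p m₁ h₁ hp]; simp
  by_cases hq : b < |q|
  · rw [hm q m₂ h₂ hq]; simp
  have := mem_gr4 X M (F.g_gr j) h₁ (F.g_gr j') h₂ rfl
  rw [GC_mk, (G4 X M).pi_of_hom ((mem_G4 X M).1 this), if_neg, map_zero]
  have e1 := ha j hj
  have e2 := ha j' hj'
  rw [abs_le] at e1 e2
  rw [not_lt, abs_le] at hp hq
  rw [lt_abs] at hi
  omega

theorem retr_bdd (h : IsFiniteCellRetract R) (hM : BoundedBimod M) :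
    ∃ K : ℤ, ∀ i : ℤ, K < |i| → ∀ z, (GC R M).π i z = 0 := by
  obtain ⟨C, hC, ι, r, hι, hr, -, hri⟩ := h
  obtain ⟨K, hK⟩ := cell_bdd M hC hM
  refine ⟨K, fun i hi z => ?_⟩
  have := mC_pi M hι.eqv hι.eqv hι.1 hι.1 i z
  rw [add_zero, add_zero, hK i hi] at this
  rw [← mC_retr M hι.eqv hr.eqv hri ((GC R M).π i z), ← this, map_zero]

end CellTwo

section Tate

variable {A : DGA (ZMod 2)} (R M : DGBimod A)

def DC : HCQ4 R M →ₗ[ZMod 2] HCQ4 R M := dC R M + (LinearMap.id + tauC R M)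

def sig : (ℤ →₀ T4 R M) →ₗ[ZMod 2] HCQ4 R M := Finsupp.lsum (ZMod 2) (fun _ => (rel4 R M).mkQ)

theorem sig_single (p : ℤ) (y : T4 R M) : sig R M (Finsupp.single p y) = (rel4 R M).mkQ y := by
  exact Finsupp.sum_single_index (map_zero (rel4 R M).mkQ)

/-- elements of total degree `n`, modulo relations -/
def Adm (n : ℤ) : Submodule (ZMod 2) (ℤ →₀ T4 R M) where
  carrier := {x | ∀ i, (GC R M).π (n - i) ((rel4 R M).mkQ (x i)) = (rel4 R M).mkQ (x i)}
  add_mem' := by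
    intro x y hx hy i
    rw [Finsupp.add_apply, map_add, map_add, hx i, hy i]
  zero_mem' := by intro i; simp
  smul_mem' := by
    intro c x hx i
    rw [Finsupp.smul_apply, map_smul, map_smul, hx i]

theorem mk_zero {y : T4 R M} : (rel4 R M).mkQ y = 0 ↔ y ∈ rel4 R M :=
  Submodule.Quotient.mk_eq_zero _

def NT : Submodule (ZMod 2) (ℤ →₀ T4 R M) := ⨅ p : ℤ, Submodule.comap (Finsupp.lapply p) (rel4 R M)

def grTT (p q : ℤ) : Submodule (ZMod 2) (ℤ →₀ T4 R M) :=
  Submodule.map (Finsupp.lsingle p) (gr4 R M q)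

def DT : (ℤ →₀ T4 R M) →ₗ[ZMod 2] (ℤ →₀ T4 R M) :=
  (Finsupp.lmapDomain (T4 R M) (ZMod 2) (fun p => p - 1)).comp
    (Finsupp.mapRange.linearMap (LinearMap.id + tau4 R M)) + Finsupp.mapRange.linearMap (d4 R M)

def FcolT (p n : ℤ) : Submodule (ZMod 2) (ℤ →₀ T4 R M) := ⨆ (i : ℤ) (_ : i ≤ p), grTT R M i (n - i)

def FrowT (q n : ℤ) : Submodule (ZMod 2) (ℤ →₀ T4 R M) := ⨆ (j : ℤ) (_ : j ≤ q), grTT R M (n - j) j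

def ZT (F : ℤ → ℤ → Submodule (ZMod 2) (ℤ →₀ T4 R M)) (r p n : ℤ) :
    Submodule (ZMod 2) (ℤ →₀ T4 R M) :=
  (F p n ⊔ NT R M) ⊓ Submodule.comap (DT R M) (F (p - r) (n - 1) ⊔ NT R M)

def BT (F : ℤ → ℤ → Submodule (ZMod 2) (ℤ →₀ T4 R M)) (r p n : ℤ) :
    Submodule (ZMod 2) (ℤ →₀ T4 R M) :=
  Submodule.map (DT R M) (ZT R M F (r - 1) (p + r - 1) (n + 1)) ⊔ ZT R M F (r - 1) (p - 1) n ⊔ NT R M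

theorem mem_N {x : ℤ →₀ T4 R M} : x ∈ (NT R M) ↔ ∀ i, (rel4 R M).mkQ (x i) = 0 := by
  simp only [NT, Submodule.mem_iInf, Submodule.mem_comap, Finsupp.lapply_apply, mk_zero]

theorem sig_pi {n : ℤ} {x : ℤ →₀ T4 R M} (hx : x ∈ Adm R M n) (j : ℤ) :
    (GC R M).π j (sig R M x) = (rel4 R M).mkQ (x (n - j)) := by
  have : sig R M x = ∑ i ∈ x.support, (rel4 R M).mkQ (x i) := by
    simp only [sig, Finsupp.lsum_apply, Finsupp.sum]
  rw [this, map_sum, Finset.sum_eq_single (n - j)]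
  · have := hx (n - j)
    rwa [show n - (n - j) = j by ring] at this
  · intro i _ hi
    rw [← hx i]
    exact (GC R M).ne _ _ _ (by lia)
  · intro h
    rw [Finsupp.notMem_support_iff.1 h, map_zero, map_zero]

theorem N_adm (n : ℤ) {x : ℤ →₀ T4 R M} (hx : x ∈ NT R M) : x ∈ Adm R M n := by
  intro i
  rw [(mem_N R M).1 hx i, map_zero]

theorem N_sig {n : ℤ} {x : ℤ →₀ T4 R M} (h : x ∈ Adm R M n) :
    x ∈ (NT R M) ↔ sig R M x = 0 := by
  rw [mem_N]
  constructor
  · intro hx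
    refine (GC R M).sep _ fun j => ?_
    rw [sig_pi R M h, hx]
  · intro hx i
    have := sig_pi R M h (n - i)
    rw [hx, map_zero, show n - (n - i) = i by ring] at this
    exact this.symm

theorem fil_le (S : ℤ → Prop) (n : ℤ) {x : ℤ →₀ T4 R M}
    (hx : x ∈ (⨆ (i : ℤ) (_ : S i), grTT R M i (n - i)) ⊔ NT R M) :
    x ∈ Adm R M n ∧ ∀ i, ¬ S i → (rel4 R M).mkQ (x i) = 0 := by
  let U : Submodule (ZMod 2) (ℤ →₀ T4 R M) :=
    Adm R M n ⊓ ⨅ (i : ℤ) (_ : ¬ S i), Submodule.comap (Finsupp.lapply i) (rel4 R M)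
  have hU : ∀ x, x ∈ U ↔ x ∈ Adm R M n ∧ ∀ i, ¬ S i → (rel4 R M).mkQ (x i) = 0 := by
    intro x
    simp only [U, Submodule.mem_inf, Submodule.mem_iInf, Submodule.mem_comap, Finsupp.lapply_apply,
      mk_zero]
  rw [← hU]
  refine (sup_le (iSup₂_le ?_) ?_ : _ ≤ U) hx
  · rintro i hi _ ⟨y, hy, rfl⟩
    rw [hU]
    constructor
    · intro j
      rw [Finsupp.lsingle_apply]
      by_cases h : i = j
      · subst h
        rw [Finsupp.single_eq_same, GC_mk, (mem_G4 R M).1 hy]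
      · rw [Finsupp.single_eq_of_ne (Ne.symm h)]; simp
    · intro j hj
      rw [Finsupp.lsingle_apply, Finsupp.single_eq_of_ne (by rintro rfl; exact hj hi), map_zero]
  · intro x hx
    rw [hU]
    exact ⟨N_adm R M n hx, fun i _ => (mem_N R M).1 hx i⟩

theorem fil_ge (S : ℤ → Prop) (n : ℤ) {x : ℤ →₀ T4 R M}
    (hx : x ∈ Adm R M n) (h : ∀ i, ¬ S i → (rel4 R M).mkQ (x i) = 0) :
    x ∈ (⨆ (i : ℤ) (_ : S i), grTT R M i (n - i)) ⊔ (NT R M) := by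
  have hN : ∀ i y, (rel4 R M).mkQ y = 0 →
      (Finsupp.single i y : ℤ →₀ T4 R M) ∈ (NT R M) := by
    intro i y hy
    rw [mem_N]
    intro j
    by_cases hij : i = j
    · subst hij; rw [Finsupp.single_eq_same, hy]
    · rw [Finsupp.single_eq_of_ne (Ne.symm hij), map_zero]
  rw [← Finsupp.sum_single x]
  refine Submodule.sum_mem _ fun i _ => ?_
  by_cases hi : S i
  · have e : Finsupp.single i (x i) = Finsupp.single i ((G4 R M).π (n - i) (x i)) +
        Finsupp.single i (x i - (G4 R M).π (n - i) (x i)) := by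
      rw [← Finsupp.single_add]; congr 1; abel
    rw [e]
    refine add_mem (Submodule.mem_sup_left ?_) (Submodule.mem_sup_right (hN _ _ ?_))
    · refine Submodule.mem_iSup_of_mem i (Submodule.mem_iSup_of_mem hi ?_)
      exact ⟨_, (mem_G4 R M).2 ((G4 R M).same _ _), rfl⟩
    · rw [map_sub, ← GC_mk, hx i, sub_self]
  · exact Submodule.mem_sup_right (hN _ _ (h i hi))

theorem mem_col {p n : ℤ} {x : ℤ →₀ T4 R M} :
    x ∈ FcolT R M p n ⊔ (NT R M) ↔
      x ∈ Adm R M n ∧ sig R M x ∈ (GC R M).col (p - n) := by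
  constructor
  · intro hx
    obtain ⟨h1, h2⟩ := fil_le R M (fun i => i ≤ p) n hx
    refine ⟨h1, fun j hj => ?_⟩
    rw [sig_pi R M h1]
    exact h2 _ (by lia)
  · rintro ⟨h1, h2⟩
    refine fil_ge R M (fun i => i ≤ p) n h1 (fun i hi => ?_)
    have := h2 (n - i) (by lia)
    rwa [sig_pi R M h1, show n - (n - i) = i by ring] at this

theorem mem_row {q n : ℤ} {x : ℤ →₀ T4 R M} :
    x ∈ FrowT R M q n ⊔ (NT R M) ↔
      x ∈ Adm R M n ∧ sig R M x ∈ (GC R M).le q := by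
  have e : FrowT R M q n = ⨆ (i : ℤ) (_ : n - i ≤ q), grTT R M i (n - i) := by
    refine le_antisymm (iSup₂_le fun j hj => ?_) (iSup₂_le fun i hi => ?_)
    · refine le_iSup₂_of_le (n - j) (by lia) ?_
      rw [show n - (n - j) = j by ring]
    · refine le_iSup₂_of_le (n - i) (by lia) ?_
      rw [show n - (n - i) = i by ring]
  rw [e]
  constructor
  · intro hx
    obtain ⟨h1, h2⟩ := fil_le R M (fun i => n - i ≤ q) n hx
    refine ⟨h1, fun j hj => ?_⟩
    rw [sig_pi R M h1]
    exact h2 _ (by lia)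
  · rintro ⟨h1, h2⟩
    refine fil_ge R M (fun i => n - i ≤ q) n h1 (fun i hi => ?_)
    have := h2 (n - i) (by lia)
    rwa [sig_pi R M h1, show n - (n - i) = i by ring] at this

theorem sig_surj (n : ℤ) (c : HCQ4 R M) : ∃ x ∈ Adm R M n, sig R M x = c := by
  obtain ⟨y, rfl⟩ := C_surj R M c
  refine ⟨∑ j ∈ ((G4 R M).fin y).toFinset, Finsupp.single (n - j) ((G4 R M).π j y), ?_, ?_⟩
  · refine Submodule.sum_mem _ fun j _ i => ?_
    by_cases h : n - j = i
    · subst h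
      rw [Finsupp.single_eq_same, GC_mk, show n - (n - j) = j by ring, (G4 R M).same]
    · rw [Finsupp.single_eq_of_ne (Ne.symm h)]; simp
  · conv_rhs => rw [← (G4 R M).sum_pi y]
    rw [map_sum, map_sum]
    simp only [sig_single]

theorem D_single (p : ℤ) (y : T4 R M) : (DT R M) (Finsupp.single p y : ℤ →₀ T4 R M) =
    (Finsupp.single (p - 1) (y + tau4 R M y) + Finsupp.single p (d4 R M y) : ℤ →₀ T4 R M) := by
  simp [DT, Finsupp.mapDomain_single, Finsupp.mapDomain_add]

theorem sig_D (x : ℤ →₀ T4 R M) : sig R M (DT R M x) = DC R M (sig R M x) := by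
  induction x using Finsupp.induction_linear with
  | zero => simp only [map_zero]
  | add x y hx hy =>
    simp only [map_add, hx, hy]
  | single p y =>
    rw [D_single, map_add, sig_single, sig_single, sig_single]
    simp only [DC, LinearMap.add_apply, LinearMap.id_apply, dC_mk, tauC_mk, map_add]
    abel

theorem D_adm {n n' : ℤ} {x : ℤ →₀ T4 R M} (hx : x ∈ Adm R M n) (hn : n' = n - 1) :
    (DT R M) x ∈ Adm R M n' := by
  subst hn
  let D : (ℤ →₀ T4 R M) →ₗ[ZMod 2] (ℤ →₀ T4 R M) := DT R M
  have hD : ∀ x i, D x i = x (i + 1) + tau4 R M (x (i + 1)) + d4 R M (x i) := by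
    intro x i
    induction x using Finsupp.induction_linear with
    | zero => simp
    | add x y hx hy => simp only [map_add, Finsupp.add_apply, hx, hy]; abel
    | single p y =>
      have : D (Finsupp.single p y) = _ := D_single R M p y
      rw [this, Finsupp.add_apply]
      congr 1
      · by_cases h : p = i + 1
        · subst h
          rw [add_sub_cancel_right, Finsupp.single_eq_same, Finsupp.single_eq_same]
        · rw [Finsupp.single_eq_of_ne (by lia), Finsupp.single_eq_of_ne (by lia)]; simp
      · by_cases h : p = i
        · subst h; rw [Finsupp.single_eq_same, Finsupp.single_eq_same]
        · rw [Finsupp.single_eq_of_ne (by lia), Finsupp.single_eq_of_ne (by lia)]; simp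
  change D x ∈ Adm R M (n - 1)
  intro i
  have h1 := hx i
  have h2 := hx (i + 1)
  rw [GC_mk] at h1 h2
  have h3 := congrArg (tauC R M) h2
  have h4 := congrArg (dC R M) h1
  rw [tauC_mk, tauC_mk] at h3
  rw [dC_mk, dC_mk] at h4
  rw [hD, GC_mk]
  simp only [map_add, G4_d, G4_tau]
  rw [show n - 1 - i = n - (i + 1) by ring, show n - (i + 1) + 1 = n - i by ring, h2, h3, h4]

abbrev QQ {V : Type} [AddCommGroup V] [Module (ZMod 2) V] (Z B : Submodule (ZMod 2) V) : Type :=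
  ↥Z ⧸ Submodule.comap Z.subtype B

section Pages

variable (F : ℤ → ℤ → Submodule (ZMod 2) (ℤ →₀ T4 R M)) (Fil : ℤ → Submodule (ZMod 2) (HCQ4 R M))
  (ε : ℤ)

theorem mem_Zpage
    (hF : ∀ p n x, x ∈ F p n ⊔ (NT R M) ↔ x ∈ Adm R M n ∧ sig R M x ∈ Fil (p - ε * n))
    {r p n : ℤ} {x : ℤ →₀ T4 R M} : x ∈ ZT R M F r p n ↔
    x ∈ Adm R M n ∧ sig R M x ∈ ZZ Fil (DC R M) (r - ε) (p - ε * n) := by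
  have : x ∈ ZT R M F r p n ↔ x ∈ F p n ⊔ (NT R M) ∧
    (DT R M) x ∈ F (p - r) (n - 1) ⊔ (NT R M) := Iff.rfl
  rw [this, hF, hF, mem_ZZ, ← sig_D, show p - r - ε * (n - 1) = p - ε * n - (r - ε) by ring]
  constructor
  · rintro ⟨⟨h1, h2⟩, h3, h4⟩; exact ⟨h1, h2, h4⟩
  · rintro ⟨h1, h2, h3⟩; exact ⟨⟨h1, h2⟩, D_adm R M h1 rfl, h3⟩

theorem mem_Bpage
    (hF : ∀ p n x, x ∈ F p n ⊔ (NT R M) ↔ x ∈ Adm R M n ∧ sig R M x ∈ Fil (p - ε * n))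
    {r p n : ℤ} {x : ℤ →₀ T4 R M} (hx : x ∈ Adm R M n) :
    x ∈ BT R M F r p n ↔
    sig R M x ∈ BB Fil (DC R M) (r - ε) (p - ε * n) := by
  have e1 : r - ε - 1 = r - 1 - ε := by ring
  have e2 : p - ε * n + (r - ε) - 1 = p + r - 1 - ε * (n + 1) := by ring
  have e3 : p - ε * n - 1 = p - 1 - ε * n := by ring
  unfold BB
  rw [e1, e2, e3]
  constructor
  · intro h
    obtain ⟨y, hy, w, hw, rfl⟩ := Submodule.mem_sup.1 h
    obtain ⟨_, ⟨u, hu, rfl⟩, v, hv, rfl⟩ := Submodule.mem_sup.1 hy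
    obtain ⟨-, hu2⟩ := (mem_Zpage R M F Fil ε hF).1 hu
    obtain ⟨-, hv2⟩ := (mem_Zpage R M F Fil ε hF).1 hv
    have : sig R M (DT R M u + v + w) = DC R M (sig R M u) + sig R M v := by
      rw [← sig_D]
      refine (map_add (sig R M) _ _).trans ?_
      rw [(N_sig R M (N_adm R M n hw)).1 hw, add_zero]
      exact map_add (sig R M) _ _
    rw [this]
    exact Submodule.add_mem_sup (Submodule.mem_map_of_mem hu2) hv2
  · intro h
    obtain ⟨_, ⟨u', hu', rfl⟩, v', hv', e⟩ := Submodule.mem_sup.1 h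
    obtain ⟨u, hu, rfl⟩ := sig_surj R M (n + 1) u'
    obtain ⟨v, hv, rfl⟩ := sig_surj R M n v'
    have a1 : (DT R M) u ∈ Adm R M n := D_adm R M hu (by ring)
    have a2 : x - (DT R M u + v : ℤ →₀ T4 R M) ∈ (NT R M) := by
      rw [N_sig R M (n := n) (sub_mem hx (add_mem a1 hv)), map_sub, map_add, sig_D, e, sub_self]
    have : x = (DT R M u + v : ℤ →₀ T4 R M) +
      (x - (DT R M u + v : ℤ →₀ T4 R M)) := by abel
    rw [this]
    refine Submodule.add_mem_sup (Submodule.add_mem_sup (Submodule.mem_map_of_mem ?_) ?_) a2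
    · exact (mem_Zpage R M F Fil ε hF).2 ⟨hu, hu'⟩
    · exact (mem_Zpage R M F Fil ε hF).2 ⟨hv, hv'⟩

theorem Epage_EE
    (hF : ∀ p n x, x ∈ F p n ⊔ (NT R M) ↔ x ∈ Adm R M n ∧ sig R M x ∈ Fil (p - ε * n))
    (r p n : ℤ) : Nonempty (QQ (V := ℤ →₀ T4 R M) (ZT R M F r p n) (BT R M F r p n) ≃ₗ[ZMod 2]
    EE Fil (DC R M) (r - ε) (p - ε * n)) := by
  refine corr (U := ℤ →₀ T4 R M) (V := ℤ →₀ T4 R M) LinearMap.id (sig R M)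
    (ZT R M F r p n) (BT R M F r p n) _ _ ?_ ?_ ?_
  · intro v hv
    exact ⟨v, hv, ((mem_Zpage R M F Fil ε hF).1 hv).2, by simp⟩
  · intro w hw
    obtain ⟨u, hu, rfl⟩ := sig_surj R M n w
    exact ⟨u, (mem_Zpage R M F Fil ε hF).2 ⟨hu, hw⟩, hw, by simp⟩
  · intro u hu _
    exact mem_Bpage R M F Fil ε hF ((mem_Zpage R M F Fil ε hF).1 hu).1

theorem zeroDiff_ZD
    (hF : ∀ p n x, x ∈ F p n ⊔ (NT R M) ↔ x ∈ Adm R M n ∧ sig R M x ∈ Fil (p - ε * n))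
    (hε : ε = 0) {r p : ℤ} (h : Submodule.map (DT R M) (ZT R M F r p 0) ≤ 
      Submodule.map (DT R M) (ZT R M F (r - 1) (p - 1) 0) ⊔ ZT R M F (r - 1) (p - r - 1) (0 - 1) ⊔ NT R M) :
    ZD Fil (DC R M) r p := by
  subst hε
  intro x hx
  obtain ⟨x, hxa, rfl⟩ := sig_surj R M 0 x
  have hz : x ∈ ZT R M F r p 0 :=
    (mem_Zpage R M F Fil 0 hF).2 ⟨hxa, by simpa using hx⟩
  have := h (Submodule.mem_map_of_mem hz)
  obtain ⟨y, hy, w, hw, e⟩ := Submodule.mem_sup.1 this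
  obtain ⟨_, ⟨u, hu, rfl⟩, v, hv, rfl⟩ := Submodule.mem_sup.1 hy
  obtain ⟨-, hu2⟩ := (mem_Zpage R M F Fil 0 hF).1 hu
  obtain ⟨-, hv2⟩ := (mem_Zpage R M F Fil 0 hF).1 hv
  have : sig R M (DT R M u + v + w) = DC R M (sig R M u) + sig R M v := by
    rw [← sig_D]
    refine (map_add (sig R M) _ _).trans ?_
    rw [(N_sig R M (N_adm R M 0 hw)).1 hw, add_zero]
    exact map_add (sig R M) _ _
  rw [← sig_D, ← e, this]
  unfold BB
  rw [show p - r + r - 1 = p - 1 by ring]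
  refine Submodule.add_mem_sup (Submodule.mem_map_of_mem ?_) ?_
  · simpa using hu2
  · simpa using hv2

end Pages

theorem vhE_EE (r p q : ℤ) : Nonempty ((TateBicx R M).vhE r p q ≃ₗ[ZMod 2]
    EE (GC R M).col (DC R M) (r - 1) (-q)) := by
  have := Epage_EE R M (FcolT R M) (GC R M).col 1
    (fun p n x => by rw [one_mul]; exact mem_col R M) r p (p + q)
  rw [show p - 1 * (p + q) = -q by ring] at this
  exact this

theorem pi_ZD (h : PiFormalBimod R M) (r : ℤ) (hr : 3 ≤ r) (p : ℤ) :
    ZD (GC R M).le (DC R M) r p :=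
  zeroDiff_ZD R M (FrowT R M) (GC R M).le 0
    (fun p n x => by rw [zero_mul, sub_zero]; exact mem_row R M) rfl (h r hr p 0)

theorem EE_HH4 (h1 : CondT1 R M) (h2 : CondT2 R M) (p q : ℤ) (hpq : p = -q) :
    Nonempty (EE (GC R M).col (DC R M) 0 p ≃ₗ[ZMod 2] HH4 R M q) := by
  have hZ : ∀ x, x ∈ ZZ (GC R M).col (DC R M) 0 p ↔
      x ∈ (GC R M).col p ∧ dC R M ((GC R M).π (-p) x) = 0 := fun x =>
    TC.mem_ZZcol (mkTC R M h1 h2)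
  have hB : ∀ x, x ∈ ZZ (GC R M).col (DC R M) 0 p → (x ∈ BB (GC R M).col (DC R M) 0 p ↔
      ∃ y, (GC R M).π (-p + 1) y = y ∧ (GC R M).π (-p) x = dC R M y) := fun x hx =>
    TC.mem_BBcol (mkTC R M h1 h2) hx
  subst hpq
  rw [neg_neg] at hZ hB
  have hhom : ∀ u, u ∈ gr4 R M q ⊔ rel4 R M →
      (GC R M).π q ((rel4 R M).mkQ u) = (rel4 R M).mkQ u := by
    intro u hu
    obtain ⟨a, ha, b, hb, rfl⟩ := Submodule.mem_sup.1 hu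
    rw [map_add, (mk_zero R M).2 hb, add_zero, GC_mk, (mem_G4 R M).1 ha]
  have hd : ∀ u, dC R M ((rel4 R M).mkQ u) = 0 ↔ d4 R M u ∈ rel4 R M := by
    intro u
    rw [dC_mk, mk_zero]
  refine corr (rel4 R M).mkQ LinearMap.id _ _ _ _ ?_ ?_ ?_
  · intro v hv
    obtain ⟨y, rfl⟩ := C_surj R M v
    obtain ⟨hv1, hv2⟩ := (hZ _).1 hv
    have hZ' : (rel4 R M).mkQ ((G4 R M).π q y) ∈ ZZ (GC R M).col (DC R M) 0 (-q) := by
      rw [hZ, ← GC_mk]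
      exact ⟨(GC R M).hom_col ((GC R M).same _ _) (by lia), by rw [(GC R M).same, hv2]⟩
    refine ⟨(G4 R M).π q y, hZ', ⟨?_, ?_⟩, ?_⟩
    · exact Submodule.mem_sup_left ((mem_G4 R M).2 ((G4 R M).same _ _))
    · exact (hd _).1 (by rw [LinearMap.id_apply, ← GC_mk]; exact hv2)
    · refine (hB _ (sub_mem hZ' hv)).2 ⟨0, by simp, ?_⟩
      rw [map_zero, map_sub, ← GC_mk, (GC R M).same, sub_self]
  · intro w hw
    refine ⟨w, ?_, hw, by simp⟩
    rw [hZ, hhom _ hw.1]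
    exact ⟨(GC R M).hom_col (hhom _ hw.1) (by lia), (hd _).2 hw.2⟩
  · intro u hu1 hu2
    rw [hB _ hu1, hhom u hu2.1]
    constructor
    · rintro ⟨y, hy, e⟩
      obtain ⟨y, rfl⟩ := C_surj R M y
      rw [← hy, GC_mk, dC_mk, ← sub_eq_zero, ← map_sub, mk_zero] at e
      have : u = d4 R M ((G4 R M).π (q + 1) y) + (u - d4 R M ((G4 R M).π (q + 1) y)) := by abel
      rw [LinearMap.id_apply, this]
      exact Submodule.add_mem_sup (Submodule.mem_map_of_mem (Submodule.mem_sup_left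
        ((mem_G4 R M).2 ((G4 R M).same _ _)))) e
    · intro hu
      obtain ⟨_, ⟨y, hy, rfl⟩, b, hb, e⟩ := Submodule.mem_sup.1 hu
      obtain ⟨y, hy1, c, hc, rfl⟩ := Submodule.mem_sup.1 hy
      rw [LinearMap.id_apply] at e
      refine ⟨(rel4 R M).mkQ y, by rw [GC_mk, (mem_G4 R M).1 hy1], ?_⟩
      rw [← e, map_add, (mk_zero R M).2 hb, add_zero, map_add, map_add,
        (mk_zero R M).2 (d4_rel R M c hc), add_zero, dC_mk]

theorem le_bot_of {V : Type} [AddCommGroup V] [Module (ZMod 2) V] (G : Grd V) {K : ℤ}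
    (hK : ∀ i : ℤ, K < |i| → ∀ z, G.π i z = 0) : (∀ p, p < -K → G.le p = ⊥) ∧
    (∀ p, K < p → G.le p = ⊤) ∧ (∀ p, p < -K → G.col p = ⊥) ∧ (∀ p, K < p → G.col p = ⊤) := by
  refine ⟨fun p hp => ?_, fun p hp => ?_, fun p hp => ?_, fun p hp => ?_⟩
  · rw [eq_bot_iff]
    intro x hx
    refine G.sep x fun i => ?_
    by_cases h : p < i
    · exact hx i h
    · exact hK i (lt_abs.2 (by lia)) x
  · rw [eq_top_iff]
    intro x _ i hi
    exact hK i (lt_abs.2 (by lia)) x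
  · rw [eq_bot_iff]
    intro x hx
    refine G.sep x fun i => ?_
    by_cases h : i < -p
    · exact hx i h
    · exact hK i (lt_abs.2 (by lia)) x
  · rw [eq_top_iff]
    intro x _ i hi
    exact hK i (lt_abs.2 (by lia)) x

theorem gr_le_gen {V W : Type} [AddCommGroup V] [Module (ZMod 2) V] [AddCommGroup W]
    [Module (ZMod 2) W] {F : ℤ → Submodule (ZMod 2) V} {F' : ℤ → Submodule (ZMod 2) W}
    {D : V →ₗ[ZMod 2] V} {D' : W →ₗ[ZMod 2] W} {φ : V →ₗ[ZMod 2] W}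
    (mF : Monotone F) (dD : ∀ x, D (D x) = 0) (hF : ∀ p x, x ∈ F p → φ x ∈ F' p)
    (hD : ∀ x, φ (D x) = D' (φ x)) (h : PageIso F D F' D' φ 3)
    (hzd : ∀ t, 3 ≤ t → ∀ p, ZD F D t p) (K : ℤ)
    (b1 : ∀ p, p < -K → F p = ⊥) (b2 : ∀ p, K < p → F p = ⊤) (p : ℤ) :
    Nonempty ((↥(FilH F D p) ⧸ Submodule.comap (FilH F D p).subtype (FilH F D (p - 1))) ≃ₗ[ZMod 2]
      EE F' D' 3 p) := by
  have n1 := abs_nonneg p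
  have n2 := abs_nonneg K
  obtain ⟨e1⟩ := EE_inf (D := D) mF K b1 b2 (|p| + |K| + 3) p (by lia)
  have h3 : (3 : ℤ) ≤ |p| + |K| + 3 := by lia
  obtain ⟨e2⟩ := ZD.equiv_le mF dD h3 hzd p
  obtain ⟨e3⟩ := PageIso.equiv hF hD h p
  exact ⟨e1.symm.trans (e2.trans e3)⟩

end Tate

set_option maxHeartbeats 1000000 in
open DirectSum in
theorem hl
    (A : DGA (ZMod 2)) (R : DGBimod A) (ρ : R.V →ₗ[ZMod 2] A.diag.V)
    (hres : IsResolution R A.diag ρ)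
    (hsmooth : HomSmooth A) (hproper : HomProper A)
    (M : DGBimod A) (hbdd : BoundedBimod M) (hpi : PiFormalBimod R M) :
    (∀ p q : ℤ, Nonempty ((TateBicx R M).vhE 1 p q ≃ₗ[ZMod 2] HH4 R M q)) ∧
    (∃ Fl : ℤ → Submodule (ZMod 2) (⨁ j : ℤ, HH R M j),
      Monotone Fl ∧ (⨆ i, Fl i) = ⊤ ∧ (⨅ i, Fl i) = ⊥ ∧
      ∀ p q : ℤ, ∃ r₀ : ℤ, ∀ r : ℤ, r₀ ≤ r →
        Nonempty ((TateBicx R M).vhE r p q ≃ₗ[ZMod 2]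
          (↥(Fl (-q)) ⧸ Submodule.comap (Fl (-q)).subtype (Fl (-q - 1))))) ∧
    (Cardinal.sum (fun q : ℤ => Module.rank (ZMod 2) (HH R M q)) ≤
      Cardinal.sum (fun q : ℤ => Module.rank (ZMod 2) (HH4 R M q))) := by
  haveI : Fact (Nat.Prime 2) := ⟨Nat.prime_two⟩
  obtain ⟨hR, hρ, hq⟩ := hres
  obtain ⟨R', ρ', hfin, hρ', hq'⟩ := hsmooth
  have hR' := hfin.cell
  obtain ⟨f, g, h, h', hf, hg, hh, hh', e, e'⟩ := compare hR hR' hρ hρ' hq hq'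
  have t1 := retr_T1 R M hR
  have t2 := retr_T2 R M hR
  have t1' := retr_T1 R' M hR'
  have t2' := retr_T2 R' M hR'
  obtain ⟨K, hK⟩ := retr_bdd R' M hfin hbdd
  obtain ⟨b1, b2, b3, b4⟩ := le_bot_of (GC R' M) hK
  have dD : ∀ x, DC R M (DC R M x) = 0 := (mkTC R M t1 t2).D_D
  have dD' : ∀ x, DC R' M (DC R' M x) = 0 := (mkTC R' M t1' t2').D_D
  obtain ⟨φ, φle, φcol, φD, pl, pc⟩ : ∃ φ : HCQ4 R' M →ₗ[ZMod 2] HCQ4 R M,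
      (∀ p x, x ∈ (GC R' M).le p → φ x ∈ (GC R M).le p) ∧
      (∀ p x, x ∈ (GC R' M).col p → φ x ∈ (GC R M).col p) ∧
      (∀ x, φ (DC R' M x) = DC R M (φ x)) ∧
      PageIso (GC R' M).le (DC R' M) (GC R M).le (DC R M) φ 3 ∧
      PageIso (GC R' M).col (DC R' M) (GC R M).col (DC R M) φ 0 :=
    ⟨(homTC M t1' t2' t1 t2 hf).f, (homTC M t1' t2' t1 t2 hf).f_le, (homTC M t1' t2' t1 t2 hf).f_col,
      (homTC M t1' t2' t1 t2 hf).f_D, page_le M t1' t2' t1 t2 hf hg hh hh' e e',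
      page_col M t1' t2' t1 t2 hf hg hh hh' e e'⟩
  have hcol : ∀ r, 0 ≤ r → ∀ p, Nonempty (EE (GC R' M).col (DC R' M) r p ≃ₗ[ZMod 2]
      EE (GC R M).col (DC R M) r p) := fun r hr p =>
    PageIso.equiv φcol φD (PageIso.of_le (GC R' M).col_mono (GC R M).col_mono dD' dD
      φcol φD hr pc) p
  have hle : ∀ r, 3 ≤ r → PageIso (GC R' M).le (DC R' M) (GC R M).le (DC R M) φ r :=
    fun r hr => PageIso.of_le (GC R' M).le_mono (GC R M).le_mono dD' dD φle φD hr pl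
  have hzd : ∀ t, 3 ≤ t → ∀ p, ZD (GC R' M).le (DC R' M) t p := fun t ht p =>
    ZD.transfer dD' φle φD (hle t ht) (pi_ZD R M hpi t ht p)
  have hgrle : ∀ p, Nonempty ((↥(FilH (GC R' M).le (DC R' M) p) ⧸ Submodule.comap
      (FilH (GC R' M).le (DC R' M) p).subtype (FilH (GC R' M).le (DC R' M) (p - 1))) ≃ₗ[ZMod 2]
      EE (GC R M).le (DC R M) 3 p) := by
    exact fun p => gr_le_gen (GC R' M).le_mono dD' φle φD pl hzd K b1 b2 p
  have hHH : ∀ q, Nonempty (EE (GC R M).le (DC R M) 3 (q + q) ≃ₗ[ZMod 2] HH R M q) := fun q =>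
    (mkTC R M t1 t2).EE_le_HH (gr2 R M) (fun _ _ => mem_G2 R M) (d2_rel R M) q
  have rk1 : Module.rank (ZMod 2) (HD (DC R' M)) =
      Cardinal.sum (fun q : ℤ => Module.rank (ZMod 2) (HH R M q)) := by
    rw [rank_filtration (FilH (GC R' M).le (DC R' M)) (FilH_mono (GC R' M).le_mono) (-K - 1) (K + 1)
      (fun p hp => FilH_bot (b1 p (by lia))) (fun p hp => FilH_top (b2 p (by lia)))]
    have a1 : ∀ p, Module.rank (ZMod 2) (↥(FilH (GC R' M).le (DC R' M) p) ⧸ Submodule.comap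
      (FilH (GC R' M).le (DC R' M) p).subtype (FilH (GC R' M).le (DC R' M) (p - 1))) =
      Module.rank (ZMod 2) (EE (GC R M).le (DC R M) 3 p) := fun p => (hgrle p).some.rank_eq
    have a2 : ∀ q, Module.rank (ZMod 2) (HH R M q) =
      Module.rank (ZMod 2) (EE (GC R M).le (DC R M) 3 (q + q)) := fun q => (hHH q).some.symm.rank_eq
    simp only [a1, a2]
    refine (sum_reindex (fun q : ℤ => q + q) (fun a b hab => by simp only at hab; lia)
      (fun p => Module.rank (ZMod 2) (EE (GC R M).le (DC R M) 3 p)) ?_).symm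
    intro p hp
    by_contra hcon
    push Not at hcon
    have : Subsingleton (EE (GC R M).le (DC R M) 3 p) :=
      (mkTC R M t1 t2).EE_le_odd (fun q hq => hcon q hq.symm)
    exact hp (rank_subsingleton' _ _)
  have rk2 : Module.rank (ZMod 2) (⨁ j : ℤ, HH R M j) = Module.rank (ZMod 2) (HD (DC R' M)) := by
    rw [rk1, rank_directSum]
  obtain ⟨E⟩ := nonempty_linearEquiv_of_rank_eq rk2
  refine ⟨fun p q => ?_, ?_, ?_⟩
  · obtain ⟨e1⟩ := vhE_EE R M 1 p q
    obtain ⟨e2⟩ := EE_HH4 R M t1 t2 (-q) q rfl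
    exact ⟨e1.trans e2⟩
  · have hc := b3
    refine ⟨fun i => (FilH (GC R' M).col (DC R' M) i).comap E.toLinearMap, ?_, ?_, ?_, ?_⟩
    · intro a b hab
      exact Submodule.comap_mono (FilH_mono (GC R' M).col_mono hab)
    · rw [eq_top_iff]
      refine le_iSup_of_le (K + 1) ?_
      have hx : FilH (GC R' M).col (DC R' M) (K + 1) = ⊤ := FilH_top (b4 (K + 1) (by lia))
      beta_reduce
      rw [hx, Submodule.comap_top]
    · rw [eq_bot_iff]
      refine iInf_le_of_le (-K - 1) ?_
      have hy : FilH (GC R' M).col (DC R' M) (-K - 1) = ⊥ := FilH_bot (b3 (-K - 1) (by lia))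
      beta_reduce
      rw [hy]
      intro x hx
      have : E x = 0 := hx
      simpa using this
    · intro p q
      have n1 := abs_nonneg (-q)
      have n2 := abs_nonneg K
      refine ⟨|-q| + |K| + 4, fun r hr => ?_⟩
      obtain ⟨e1⟩ := vhE_EE R M r p q
      obtain ⟨e2⟩ := hcol (r - 1) (by lia) (-q)
      obtain ⟨e3⟩ := EE_inf (D := DC R' M) (GC R' M).col_mono K b3 b4 (r - 1) (-q) (by lia)
      obtain ⟨e4⟩ := corr E.toLinearMap LinearMap.id (FilH (GC R' M).col (DC R' M) (-q))
        (FilH (GC R' M).col (DC R' M) (-q - 1))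
        ((FilH (GC R' M).col (DC R' M) (-q)).comap E.toLinearMap)
        ((FilH (GC R' M).col (DC R' M) (-q - 1)).comap E.toLinearMap)
        (fun v hv => ⟨E.symm v, by simpa using hv, by simpa using hv, by simp⟩)
        (fun w hw => ⟨w, hw, hw, by simp⟩) (fun u _ _ => Iff.rfl)
      exact ⟨e1.trans (e2.symm.trans (e3.trans e4))⟩
  · rw [← rk1, rank_filtration (FilH (GC R' M).col (DC R' M)) (FilH_mono (GC R' M).col_mono)
      (-K - 1) (K + 1)
      (fun p hp => FilH_bot (b3 p (by lia))) (fun p hp => FilH_top (b4 p (by lia)))]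
    refine (Cardinal.sum_le_sum _ (fun p => Module.rank (ZMod 2) (HH4 R M (-p)))
      fun p => ?_).trans (le_of_eq ?_)
    · refine (rank_gr_le dD' p).trans (le_of_eq ?_)
      obtain ⟨e1⟩ := hcol 0 le_rfl p
      obtain ⟨e2⟩ := EE_HH4 R M t1 t2 p (-p) (by ring)
      exact (e1.trans e2).rank_eq
    · exact sum_reindex (fun p : ℤ => -p) neg_injective
        (fun q => Module.rank (ZMod 2) (HH4 R M q)) (fun q _ => ⟨-q, neg_neg q⟩)

open DirectSum in
/-- **Theorem 3.1 (Lipshitz–Treumann).** Let `A` be a dg algebra over `𝔽₂` which is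
homologically smooth and proper, and let `M` be a bounded, `π`-formal dg `(A,A)`-bimodule.
Then the spectral sequence `ᵛʰE` of the Hochschild–Tate bicomplex satisfies:
(1) `ᵛʰE¹_{p,q} ≅ HH_q(A, M ⊗̃_A M)` for all `p, q`;
(2) there is an increasing filtration `F` of `⊕ⱼ HH_j(A,M)` with
`ᵛʰE^∞_{p,q} ≅ F_{-q}/F_{-q-1}`;
in particular `∑_q dim HH_q(A, M ⊗̃_A M) ≥ ∑_q dim HH_q(A, M)`. -/
theorem hochschild_localization
    (A : DGA (ZMod 2)) (R : DGBimod A) (ρ : R.V →ₗ[ZMod 2] A.diag.V)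
    (hres : IsResolution R A.diag ρ)
    (hsmooth : HomSmooth A) (hproper : HomProper A)
    (M : DGBimod A) (hbdd : BoundedBimod M) (hpi : PiFormalBimod R M) :
    (∀ p q : ℤ, Nonempty ((TateBicx R M).vhE 1 p q ≃ₗ[ZMod 2] HH4 R M q)) ∧
    (∃ Fl : ℤ → Submodule (ZMod 2) (⨁ j : ℤ, HH R M j),
      Monotone Fl ∧ (⨆ i, Fl i) = ⊤ ∧ (⨅ i, Fl i) = ⊥ ∧
      ∀ p q : ℤ, ∃ r₀ : ℤ, ∀ r : ℤ, r₀ ≤ r →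
        Nonempty ((TateBicx R M).vhE r p q ≃ₗ[ZMod 2]
          (↥(Fl (-q)) ⧸ Submodule.comap (Fl (-q)).subtype (Fl (-q - 1))))) ∧
    (Cardinal.sum (fun q : ℤ => Module.rank (ZMod 2) (HH R M q)) ≤
      Cardinal.sum (fun q : ℤ => Module.rank (ZMod 2) (HH4 R M q))) := by
  exact hl A R ρ hres hsmooth hproper M hbdd hpi
end LT
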